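/- Let E ⊆ ℝ^{n+1} (n ≥ 2) be an n-dimensional Ahlfors–David regular set, equipped with a dyadic system 𝔻(E). Then E is uniformly rectifiable if and only if E satisfies the Weak Half-Space Approximation (WHSA) property. -/

import Mathlib

open MeasureTheory Metric Set
open scoped ENNReal NNReal InnerProductSpace

noncomputable section

abbrev ES (n : ℕ) : Type := EuclideanSpace ℝ (Fin (n + 1))

/-- The surface measure `σ = H^n|_E`. -/
def surfMeasure (n : ℕ) (E : Set (ES n)) : Measure (ES n) :=
  (μH[(n : ℝ)]).restrict E

/-- `E ⊆ ℝ^{n+1}` is `n`-dimensional Ahlfors–David regular with constant `C`. -/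
def IsADR (n : ℕ) (C : ℝ) (E : Set (ES n)) : Prop :=
  IsClosed E ∧ 1 ≤ C ∧
    ∀ x ∈ E, ∀ r : ℝ, 0 < r → ENNReal.ofReal r < EMetric.diam E →
      ENNReal.ofReal (C⁻¹ * r ^ n) ≤ μH[(n : ℝ)] (E ∩ ball x r) ∧
      μH[(n : ℝ)] (E ∩ ball x r) ≤ ENNReal.ofReal (C * r ^ n)

/-- A Christ–David–Semmes dyadic system on `E`. -/
structure DyadicSystem (n : ℕ) (E : Set (ES n)) where
  cubes : ℤ → Set (Set (ES n))
  center : Set (ES n) → ES n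
  a₀ : ℝ
  γ : ℝ
  Cstar : ℝ
  a₀_pos : 0 < a₀
  γ_pos : 0 < γ
  Cstar_pos : 0 < Cstar
  borel : ∀ k : ℤ, ∀ Q ∈ cubes k, MeasurableSet Q
  cover : ∀ k : ℤ, ⋃₀ cubes k = E
  nested : ∀ k m : ℤ, k ≤ m → ∀ Q ∈ cubes m, ∀ Q' ∈ cubes k, Q ⊆ Q' ∨ Q ∩ Q' = ∅
  parent : ∀ k : ℤ, ∀ Q ∈ cubes k, ∀ m : ℤ, m < k → ∃! Q', Q' ∈ cubes m ∧ Q ⊆ Q'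
  diam_le : ∀ k : ℤ, ∀ Q ∈ cubes k, EMetric.diam Q ≤ ENNReal.ofReal (Cstar * 2 ^ (-k))
  center_mem : ∀ k : ℤ, ∀ Q ∈ cubes k, center Q ∈ Q
  contains_ball : ∀ k : ℤ, ∀ Q ∈ cubes k, E ∩ ball (center Q) (a₀ * 2 ^ (-k)) ⊆ Q
  small_boundary : ∀ k : ℤ, ∀ Q ∈ cubes k, ∀ ϱ : ℝ, 0 < ϱ → ϱ < a₀ →
    μH[(n : ℝ)] {x ∈ Q | Metric.infDist x (E \ Q) ≤ ϱ * 2 ^ (-k)} ≤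
      ENNReal.ofReal (Cstar * ϱ ^ γ) * μH[(n : ℝ)] Q

/-- Uniform rectifiability: big pieces of Lipschitz images. -/
def IsUR (n : ℕ) (θ M₀ : ℝ) (E : Set (ES n)) : Prop :=
  0 < θ ∧ 0 < M₀ ∧
    ∀ x ∈ E, ∀ r : ℝ, 0 < r → ENNReal.ofReal r < EMetric.diam E →
      ∃ ρ : EuclideanSpace ℝ (Fin n) → ES n,
        LipschitzWith M₀.toNNReal ρ ∧
        ENNReal.ofReal (θ * r ^ n) ≤ μH[(n : ℝ)] (E ∩ ball x r ∩ ρ '' ball 0 r)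

/-- `P` is an affine hyperplane of `ℝ^{n+1}`. -/
def IsHyperplane {n : ℕ} (P : Set (ES n)) : Prop :=
  ∃ (ν : ES n) (c : ℝ), ‖ν‖ = 1 ∧ P = {Z | ⟪ν, Z⟫_ℝ = c}

/-- `H` is an open half-space with boundary hyperplane `P`. -/
def IsHalfSpacePair {n : ℕ} (H P : Set (ES n)) : Prop :=
  ∃ (ν : ES n) (c : ℝ), ‖ν‖ = 1 ∧ H = {Z | c < ⟪ν, Z⟫_ℝ} ∧ P = {Z | ⟪ν, Z⟫_ℝ = c}

/-- The `ε`-local BAUP condition for a cube `Q` of generation `k`. -/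
def LocalBAUP {n : ℕ} (E : Set (ES n)) (D : DyadicSystem n E) (ε : ℝ) (k : ℤ)
    (Q : Set (ES n)) : Prop :=
  ∃ Ps : Set (Set (ES n)), Ps.Nonempty ∧ (∀ P ∈ Ps, IsHyperplane P) ∧
    (∀ y ∈ E ∩ ball (D.center Q) (10 * Metric.diam Q),
      Metric.infDist y (⋃₀ Ps) ≤ ε * 2 ^ (-k)) ∧
    (∀ z ∈ (⋃₀ Ps) ∩ ball (D.center Q) (10 * Metric.diam Q),
      Metric.infDist z E ≤ ε * 2 ^ (-k))

/-- The `ε`-local WHSA condition with parameter `K₀` for a cube `Q` of generation `k`. -/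
def LocalWHSA {n : ℕ} (E : Set (ES n)) (D : DyadicSystem n E) (K₀ ε : ℝ) (k : ℤ)
    (Q : Set (ES n)) : Prop :=
  ∃ Hs P : Set (ES n), IsHalfSpacePair Hs P ∧
    (∀ Z ∈ P ∩ ball (D.center Q) (ε ^ (-2 : ℤ) * 2 ^ (-k)),
      Metric.infDist Z E ≤ ε * 2 ^ (-k)) ∧
    (∃ z ∈ closure Q, Metric.infDist z P ≤ K₀ ^ ((3 : ℝ) / 2) * 2 ^ (-k)) ∧
    Hs ∩ ball (D.center Q) (ε ^ (-2 : ℤ) * 2 ^ (-k)) ∩ E = ∅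

/-- The family of (generations of) cubes `B` satisfies a Carleson packing condition with
constant `C`. -/
def PackedBy {n : ℕ} (E : Set (ES n)) (D : DyadicSystem n E)
    (B : ℤ → Set (ES n) → Prop) (C : ℝ) : Prop :=
  ∀ k₀ : ℤ, ∀ Q₀ ∈ D.cubes k₀,
    ∑' p : {p : ℤ × Set (ES n) // p.2 ∈ D.cubes p.1 ∧ B p.1 p.2 ∧ p.2 ⊆ Q₀},
      μH[(n : ℝ)] p.1.2 ≤ ENNReal.ofReal C * μH[(n : ℝ)] Q₀

/-- Harmonic: `C²` with vanishing Laplacian. -/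
def HarmonicOn {n : ℕ} (u : ES n → ℝ) (U : Set (ES n)) : Prop :=
  ContDiffOn ℝ 2 u U ∧ ∀ x ∈ U,
    ∑ i : Fin (n + 1),
      fderiv ℝ (fun y => fderiv ℝ u y (EuclideanSpace.single i 1)) x
        (EuclideanSpace.single i 1) = 0

/-- Double counting along a measurable relation `W`. -/
theorem double_counting {S T : Type*} [MeasurableSpace S] [MeasurableSpace T]
    (σ : Measure S) (ν : Measure T) [SFinite σ] [SFinite ν] {W : Set (S × T)}
    (hW : MeasurableSet W) {A : Set S} {Z : Set T} {m M : ℝ≥0∞}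
    (h1 : ∀ x ∈ A, m ≤ ν (Z ∩ {t | (x, t) ∈ W}))
    (h2 : ∀ t ∈ Z, σ {x | (x, t) ∈ W} ≤ M) :
    m * σ A ≤ M * ν Z := by
  have hmeas : Measurable fun x => (ν.restrict Z) (Prod.mk x ⁻¹' W) :=
    measurable_measure_prodMk_left hW
  calc m * σ A ≤ m * σ {x | m ≤ (ν.restrict Z) (Prod.mk x ⁻¹' W)} := by
        gcongr
        intro x hx
        simp only [mem_ofPred_eq]
        rw [Measure.restrict_apply (measurable_prodMk_left hW), inter_comm]
        exact h1 x hx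
    _ ≤ ∫⁻ x, (ν.restrict Z) (Prod.mk x ⁻¹' W) ∂σ := mul_meas_ge_le_lintegral hmeas m
    _ = (σ.prod (ν.restrict Z)) W := (Measure.prod_apply hW).symm
    _ = ∫⁻ t in Z, σ ((fun x => (x, t)) ⁻¹' W) ∂ν := Measure.prod_apply_symm hW
    _ ≤ ∫⁻ _ in Z, M ∂ν := setLIntegral_mono measurable_const h2
    _ = M * ν Z := by simp

theorem transfer_ball {S : Type*} [PseudoMetricSpace S] [SecondCountableTopology S]
    [MeasurableSpace S] [OpensMeasurableSpace S]
    (σ : Measure S) [SFinite σ] {A Z : Set S} {m M : ℝ≥0∞} {R : ℝ}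
    (h1 : ∀ x ∈ A, m ≤ σ (Z ∩ ball x R)) (h2 : ∀ z ∈ Z, σ (ball z R) ≤ M) :
    m * σ A ≤ M * σ Z := by
  have hW : MeasurableSet {p : S × S | dist p.1 p.2 < R} :=
    (isOpen_lt (by fun_prop) continuous_const).measurableSet
  refine double_counting σ σ hW ?_ ?_
  · intro x hx
    refine (h1 x hx).trans (measure_mono ?_)
    rintro y ⟨hy, hyx⟩
    exact ⟨hy, by simpa [dist_comm] using hyx⟩
  · intro t ht
    exact (measure_mono fun x hx => by simpa using hx).trans (h2 t ht)

/-- Ahlfors regularity of a measure, with lower bounds at the points of `F`. -/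
structure ADMeas {S : Type*} [PseudoMetricSpace S] [MeasurableSpace S] (μ : Measure S)
    (F : Set S) (n : ℕ) (C : ℝ) : Prop where
  one_le : 1 ≤ C
  lower : ∀ x ∈ F, ∀ r, 0 < r → ENNReal.ofReal (C⁻¹ * r ^ n) ≤ μ (ball x r)
  upper : ∀ x, ∀ r, 0 < r → μ (ball x r) ≤ ENNReal.ofReal (C * r ^ n)

namespace ADMeas
variable {S : Type*} [PseudoMetricSpace S] [MeasurableSpace S] {μ : Measure S}
    {F : Set S} {n : ℕ} {C : ℝ}

theorem pos (h : ADMeas μ F n C) : 0 < C := one_pos.trans_le h.one_le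

theorem measure_ball_lt_top (h : ADMeas μ F n C) (x : S) (r : ℝ) : μ (ball x r) < ⊤ := by
  rcases le_or_gt r 0 with hr | hr
  · simp [ball_eq_empty.2 hr]
  · exact (h.upper x r hr).trans_lt ENNReal.ofReal_lt_top

theorem sigmaFinite (h : ADMeas μ F n C) : SigmaFinite μ := by
  rcases isEmpty_or_nonempty S with hS | ⟨⟨x⟩⟩
  · have : μ = 0 := Measure.eq_zero_of_isEmpty μ
    rw [this]; infer_instance
  refine ⟨⟨⟨fun i : ℕ => ball x i, fun _ => trivial, fun i => h.measure_ball_lt_top x i, ?_⟩⟩⟩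
  exact iUnion_ball_nat x

/-- Transfer from fat sets: if near each point of `A` there is a ball of radius `c` centred on `F`,
contained in `Z` up to null sets, then `μ A ≲ μ Z`. -/
theorem transfer [SecondCountableTopology S] [OpensMeasurableSpace S]
    (h : ADMeas μ F n C) {A Z : Set S}
    {R c : ℝ} (hc : 0 < c) (hR : 0 < R)
    (h1 : ∀ x ∈ A, ∃ y ∈ F, μ (ball y c) ≤ μ (Z ∩ ball x R)) :
    μ A ≤ ENNReal.ofReal (C ^ 2 * (R / c) ^ n) * μ Z := by
  have := h.sigmaFinite
  have hC := h.pos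
  have key := transfer_ball μ (A := A) (Z := Z) (m := ENNReal.ofReal (C⁻¹ * c ^ n))
    (M := ENNReal.ofReal (C * R ^ n)) (R := R)
    (fun x hx => by
      obtain ⟨y, hy, hle⟩ := h1 x hx
      exact (h.lower y hy c hc).trans hle) (fun z _ => h.upper z R hR)
  have h0 : 0 < C⁻¹ * c ^ n := by positivity
  have h3 : C ^ 2 * (R / c) ^ n = (C⁻¹ * c ^ n)⁻¹ * (C * R ^ n) := by
    rw [div_pow]; field_simp
  rw [h3, ENNReal.ofReal_mul (by positivity), mul_assoc, ENNReal.ofReal_inv_of_pos h0]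
  rw [← ENNReal.div_eq_inv_mul, ENNReal.le_div_iff_mul_le (by simp [h0]) (by simp), mul_comm]
  exact key

end ADMeas

/-- number of scales `j + i` at which `x` belongs to `A`. -/
def scaleCount {S : Type*} (A : ℤ → Set S) (j : ℤ) (x : S) : ℝ≥0∞ :=
  ∑' i : ℕ, (A (j + i)).indicator 1 x

theorem measurable_scaleCount {S : Type*} [MeasurableSpace S] {A : ℤ → Set S}
    (hA : ∀ k, MeasurableSet (A k)) (j : ℤ) : Measurable (scaleCount A j) :=
  Measurable.tsum fun _ => measurable_one.indicator (hA _)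

theorem lintegral_scaleCount {S : Type*} [MeasurableSpace S] {A : ℤ → Set S}
    (hA : ∀ k, MeasurableSet (A k)) (j : ℤ) (μ : Measure S) :
    ∫⁻ x, scaleCount A j x ∂μ = ∑' i : ℕ, μ (A (j + i)) := by
  unfold scaleCount
  rw [lintegral_tsum fun i => (measurable_one.indicator (hA _)).aemeasurable]
  congr 1; ext i
  rw [lintegral_indicator_one (hA _)]

theorem scaleCount_mono {S : Type*} {A B : ℤ → Set S} (h : ∀ k, A k ⊆ B k) (j : ℤ) (x : S) :
    scaleCount A j x ≤ scaleCount B j x :=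
  ENNReal.tsum_le_tsum fun i => indicator_le_indicator_of_subset (h _) (fun _ => zero_le) x

/-- Chebyshev's inequality for the number of bad scales. -/
theorem measure_scaleCount_gt {S : Type*} [MeasurableSpace S] {A : ℤ → Set S}
    (hA : ∀ k, MeasurableSet (A k)) (j : ℤ) (μ : Measure S) [SFinite μ] (B : Set S) {N T : ℝ≥0∞}
    (h : ∑' i : ℕ, μ (A (j + i) ∩ B) ≤ T) :
    N * μ {x ∈ B | N ≤ scaleCount A j x} ≤ T := by
  have h1 := mul_meas_ge_le_lintegral (μ := μ.restrict B) (measurable_scaleCount hA j) N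
  rw [lintegral_scaleCount hA j] at h1
  rw [Measure.restrict_apply (measurableSet_le measurable_const (measurable_scaleCount hA j))] at h1
  refine le_trans ?_ (h1.trans (le_trans (le_of_eq ?_) h))
  · gcongr
    rintro x ⟨h1, h2⟩
    exact ⟨h2, h1⟩
  · congr 1; ext i; rw [Measure.restrict_apply (hA _)]

theorem scaleCount_add_nat {S : Type*} (A : ℤ → Set S) (j : ℤ) (m : ℕ) (x : S) :
    scaleCount A (j + m) x ≤ scaleCount A j x := by
  unfold scaleCount
  have : ∀ i : ℕ, (A (j + m + i)).indicator (1 : S → ℝ≥0∞) x =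
      (A (j + ((i + m : ℕ) : ℤ))).indicator 1 x := by
    intro i; congr 2; push_cast; ring
  simp_rw [this]
  exact ENNReal.tsum_comp_le_tsum_of_injective (add_left_injective m)
    (fun i : ℕ => (A (j + i)).indicator (1 : S → ℝ≥0∞) x)

/-- The set of bad scales is finite, of controlled size. -/
theorem finite_scales {S : Type*} {A : ℤ → Set S} {j : ℤ} {x : S} {N : ℕ}
    (h : scaleCount A j x ≤ N) :
    ∃ s : Finset ℕ, s.card ≤ N ∧ ∀ i : ℕ, i ∈ s ↔ x ∈ A (j + i) := by
  obtain ⟨hf, hc⟩ := ENNReal.finset_card_const_le_le_of_tsum_le (ENNReal.natCast_ne_top N) h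
    one_ne_zero
  refine ⟨hf.toFinset, ?_, fun i => ?_⟩
  · rw [div_one] at hc; exact_mod_cast hc
  · simp only [Finite.mem_toFinset, mem_ofPred_eq, indicator_apply]
    by_cases hx : x ∈ A (j + i) <;> simp [hx]

theorem scaleCount_le_of_finset {S : Type*} {A : ℤ → Set S} {j : ℤ} {x : S} {N : ℕ}
    (s : Finset ℕ) (hs : s.card ≤ N) (h : ∀ i : ℕ, x ∈ A (j + i) → i ∈ s) :
    scaleCount A j x ≤ N := by
  unfold scaleCount
  rw [tsum_eq_sum (s := s)]
  · calc ∑ i ∈ s, (A (j + i)).indicator (1 : S → ℝ≥0∞) x ≤ ∑ i ∈ s, 1 :=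
        Finset.sum_le_sum fun i _ => indicator_le_self' (by simp) x
      _ ≤ N := by simp; exact_mod_cast hs
  · intro i hi
    exact indicator_of_notMem (fun hx => hi (h i hx)) _

theorem exists_popular_coloring {S K : Type*} [MeasurableSpace S] [Fintype K] [Nonempty K]
    [MeasurableSpace K] [MeasurableSingletonClass K] (μ : Measure S) [IsFiniteMeasure μ]
    {col : ℕ → S → K} (hcol : ∀ i, Measurable (col i)) {B : ℕ → Set S}
    (hB : ∀ i, MeasurableSet (B i)) (X : Set S) (N : ℕ)
    (hN : ∀ x ∈ X, ∃ s : Finset ℕ, s.card ≤ N ∧ ∀ i, x ∈ B i → i ∈ s) :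
    ∃ a : ℕ → K, ((Fintype.card K : ℝ≥0∞)⁻¹ ^ N / 2) * μ X ≤
      μ {x ∈ X | ∀ i, x ∈ B i → col i x = a i} := by
  classical
  by_contra! hcon
  set q : ℝ≥0∞ := (Fintype.card K : ℝ≥0∞)⁻¹ with hq
  have hq0 : q ≠ 0 := by simp [hq]
  have hq1 : q ≤ 1 := by
    rw [hq, ENNReal.inv_le_one]; exact_mod_cast Fintype.card_pos
  let u : Measure K := (PMF.uniformOfFintype K).toMeasure
  let P : Measure (ℕ → K) := Measure.infinitePi fun _ => u
  let W : Set (S × (ℕ → K)) := {p | ∀ i, p.1 ∈ B i → col i p.1 = p.2 i}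
  have hW : MeasurableSet W := by
    have : W = ⋂ i, ({p | p.1 ∈ (B i)ᶜ} ∪ {p | col i p.1 = p.2 i}) := by
      ext p; simp [W, imp_iff_not_or]
    rw [this]
    refine MeasurableSet.iInter fun i => ((hB i).compl.preimage measurable_fst).union ?_
    exact measurableSet_eq_fun ((hcol i).comp measurable_fst)
      ((measurable_pi_apply i).comp measurable_snd)
  have key := double_counting μ P (W := W ∩ {p | p.1 ∈ toMeasurable μ X}) (A := X) (Z := univ)
    (hW.inter ((measurableSet_toMeasurable μ X).preimage measurable_fst)) (m := q ^ N)
    (M := q ^ N / 2 * μ X) ?_ ?_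
  · have h1 : μ X ≠ ⊤ := measure_ne_top _ _
    simp only [measure_univ, mul_one] at key
    have h2 : μ X ≠ 0 := by
      intro h0
      have := hcon (fun _ => Classical.arbitrary K)
      simp [h0] at this
    have h3 : q ^ N * μ X ≠ 0 := mul_ne_zero (pow_ne_zero _ hq0) h2
    have h4 : q ^ N * μ X ≠ ⊤ :=
      ENNReal.mul_ne_top (ENNReal.pow_ne_top (hq1.trans_lt ENNReal.one_lt_top).ne) h1
    have h5 : q ^ N / 2 * μ X = q ^ N * μ X / 2 := by
      rw [div_eq_mul_inv, div_eq_mul_inv]; ring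
    rw [h5] at key
    exact absurd key (not_le.2 (ENNReal.half_lt_self h3 h4))
  · intro x hx
    obtain ⟨s, hs, hxs⟩ := hN x hx
    have hsub : Set.pi s (fun i => {col i x}) ⊆
        univ ∩ {t | (x, t) ∈ W ∩ {p | p.1 ∈ toMeasurable μ X}} := by
      intro a ha
      refine ⟨trivial, fun i hi => ?_, subset_toMeasurable μ X hx⟩
      have := ha i (hxs i hi)
      simpa using this.symm
    refine le_trans ?_ (measure_mono hsub)
    rw [Measure.infinitePi_pi _ (fun i _ => measurableSet_singleton _)]
    have : ∀ i ∈ s, u {col i x} = q := by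
      intro i _
      simp only [u]
      rw [PMF.toMeasure_apply_singleton _ _ (measurableSet_singleton _)]
      simp [hq]
    rw [Finset.prod_congr rfl this, Finset.prod_const]
    exact pow_le_pow_right_of_le_one' hq1 hs
  · intro a _
    have hm : MeasurableSet {x | (x, a) ∈ W} := hW.preimage measurable_prodMk_right
    have h1 : {x | (x, a) ∈ W ∩ {p | p.1 ∈ toMeasurable μ X}} =
        toMeasurable μ X ∩ {x | (x, a) ∈ W} := by
      ext x; simp [and_comm]
    rw [h1, Measure.measure_toMeasurable_inter_of_sFinite hm]
    exact (hcon a).le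


theorem floor_residue {q : ℕ} {t u L : ℝ} (hL : |t - u| ≤ L) (hq : L + 1 < q)
    (h : ((⌊t⌋ : ℤ) : ZMod q) = ((⌊u⌋ : ℤ) : ZMod q)) : |t - u| ≤ 1 := by
  have h1 := (ZMod.intCast_eq_intCast_iff_dvd_sub _ _ _).1 h
  have h2 : |(⌊u⌋ : ℤ) - ⌊t⌋| < q := by
    have a1 := Int.floor_le t
    have a2 := Int.lt_floor_add_one t
    have a3 := Int.floor_le u
    have a4 := Int.lt_floor_add_one u
    have := abs_le.1 hL
    have : ((|(⌊u⌋ : ℤ) - ⌊t⌋| : ℤ) : ℝ) < (q : ℤ) := by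
      push_cast
      rw [abs_lt]; constructor <;> linarith
    exact_mod_cast this
  have h3 := Int.eq_zero_of_abs_lt_dvd h1 h2
  have h4 : (⌊u⌋ : ℝ) = ⌊t⌋ := by exact_mod_cast sub_eq_zero.1 h3
  have a1 := Int.floor_le t
  have a2 := Int.lt_floor_add_one t
  have a3 := Int.floor_le u
  have a4 := Int.lt_floor_add_one u
  rw [abs_le]; constructor <;> linarith

/-- Thinning: if every point of `X` has at most `N` bad scales, then a large part of `X` has the
property that at a common bad scale, points at distance `≤ L 2^{-k}` are at
distance `≤ s 2^{-k}`. -/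
theorem exists_thinning (d N : ℕ) {s L : ℝ} (hs : 0 < s) (hL : 0 < L) :
    ∃ c : ℝ≥0∞, c ≠ 0 ∧ ∀ (μ : Measure (EuclideanSpace ℝ (Fin d))) [IsFiniteMeasure μ]
      (B : ℤ → Set (EuclideanSpace ℝ (Fin d))) (_ : ∀ k, MeasurableSet (B k)) (j : ℤ)
      (X : Set (EuclideanSpace ℝ (Fin d))) (_ : ∀ x ∈ X, scaleCount B j x ≤ N),
      ∃ F ⊆ X, c * μ X ≤ μ F ∧ (MeasurableSet X → MeasurableSet F) ∧
        ∀ k, j ≤ k → ∀ x ∈ F, ∀ y ∈ F, x ∈ B k → y ∈ B k →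
        dist x y ≤ L * 2 ^ (-k) → dist x y ≤ s * 2 ^ (-k) := by
  set s' : ℝ := s / (√d + 1) with hs'
  have hs'0 : 0 < s' := by positivity
  obtain ⟨q, hq⟩ := exists_nat_gt (L / s' + 1)
  have hq0 : 0 < q := by
    have : (0 : ℝ) < q := by have : 0 < L / s' := by positivity
                             linarith
    exact_mod_cast this
  haveI : NeZero q := ⟨hq0.ne'⟩
  letI : MeasurableSpace (ZMod q) := ⊤
  haveI : MeasurableSingletonClass (ZMod q) := ⟨fun _ => trivial⟩
  refine ⟨(Fintype.card (Fin d → ZMod q) : ℝ≥0∞)⁻¹ ^ N / 2, ?_, ?_⟩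
  · refine ENNReal.div_ne_zero.2 ⟨pow_ne_zero _ (ENNReal.inv_ne_zero.2 (by simp)), by simp⟩
  intro μ _ B hB j X hX
  let col : ℕ → EuclideanSpace ℝ (Fin d) → Fin d → ZMod q :=
    fun i x p => ((⌊x p * (2 : ℝ) ^ (j + i) / s'⌋ : ℤ) : ZMod q)
  have hcol : ∀ i, Measurable (col i) := by
    intro i
    refine measurable_pi_iff.2 fun p => ?_
    refine (measurable_from_top (f := fun z : ℤ => (z : ZMod q))).comp ?_
    refine Int.measurable_floor.comp ?_
    fun_prop
  obtain ⟨a, ha⟩ := exists_popular_coloring μ hcol (B := fun i => B (j + i))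
    (fun i => hB _) X N (fun x hx => by
      obtain ⟨t, ht, h⟩ := finite_scales (hX x hx)
      exact ⟨t, ht, fun i hi => (h i).2 hi⟩)
  refine ⟨_, fun x hx => hx.1, ha, ?_, ?_⟩
  · intro hXm
    have : {x | x ∈ X ∧ ∀ i : ℕ, x ∈ B (j + i) → col i x = a i} =
      X ∩ ⋂ i : ℕ, ((B (j + i))ᶜ ∪ (col i) ⁻¹' {a i}) := by
      ext x; simp [imp_iff_not_or]
    rw [this]
    exact hXm.inter (MeasurableSet.iInter fun i => ((hB _).compl).union
      (hcol i (measurableSet_singleton _)))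
  intro k hk x hx y hy hxk hyk hxy
  obtain ⟨i, rfl⟩ : ∃ i : ℕ, k = j + i := ⟨(k - j).toNat, by omega⟩
  have hc : col i x = col i y := (hx.2 i hxk).trans (hy.2 i hyk).symm
  have hk2 : (0 : ℝ) < 2 ^ (j + (i : ℤ)) := by positivity
  rw [zpow_neg] at hxy ⊢
  have hp : ∀ p, |x p - y p| ≤ s' * (2 ^ (j + (i : ℤ)))⁻¹ := by
    intro p
    have h1 : |x p - y p| ≤ dist x y := by
      rw [dist_eq_norm]
      simpa using PiLp.norm_apply_le (x - y) p
    have e : x p * (2 : ℝ) ^ (j + (i : ℤ)) / s' - y p * (2 : ℝ) ^ (j + (i : ℤ)) / s' =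
        (x p - y p) * ((2 : ℝ) ^ (j + (i : ℤ)) / s') := by ring
    have e2 : |x p * (2 : ℝ) ^ (j + (i : ℤ)) / s' - y p * (2 : ℝ) ^ (j + (i : ℤ)) / s'| =
        |x p - y p| * ((2 : ℝ) ^ (j + (i : ℤ)) / s') := by
      rw [e, abs_mul, abs_of_pos (by positivity : 0 < (2 : ℝ) ^ (j + (i : ℤ)) / s')]
    have h2 := floor_residue (q := q) (L := L / s') (t := x p * (2 : ℝ) ^ (j + (i : ℤ)) / s')
      (u := y p * (2 : ℝ) ^ (j + (i : ℤ)) / s') (by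
        rw [e2, mul_div_assoc', div_le_div_iff_of_pos_right hs'0]
        calc |x p - y p| * 2 ^ (j + (i : ℤ)) ≤ (L * (2 ^ (j + (i : ℤ)))⁻¹) * 2 ^ (j + (i : ℤ)) := by
              gcongr; exact h1.trans hxy
          _ = L := by field_simp) hq (congrFun hc p)
    rw [e2, mul_div_assoc', div_le_one hs'0] at h2
    rwa [← div_eq_mul_inv, le_div_iff₀ hk2]
  rw [EuclideanSpace.dist_eq]
  calc √(∑ p, dist (x p) (y p) ^ 2) ≤ √(∑ _p : Fin d, (s' * (2 ^ (j + (i : ℤ)))⁻¹) ^ 2) := by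
        apply Real.sqrt_le_sqrt
        gcongr with p
        rw [Real.dist_eq]; exact hp p
    _ = √d * (s' * (2 ^ (j + (i : ℤ)))⁻¹) := by
        rw [Finset.sum_const, Finset.card_univ, Fintype.card_fin, nsmul_eq_mul,
          Real.sqrt_mul (by positivity), Real.sqrt_sq (by positivity)]
    _ ≤ s * (2 ^ (j + (i : ℤ)))⁻¹ := by
        rw [← mul_assoc]; gcongr
        rw [hs', mul_div_assoc', div_le_iff₀ (by positivity)]
        nlinarith [Real.sqrt_nonneg (d : ℝ)]

/-- Standing assumptions: `E` is an unbounded Ahlfors regular set. -/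
structure Regular (n : ℕ) (C : ℝ) (E : Set (ES n)) : Prop where
  closed : IsClosed E
  ad : ADMeas (surfMeasure n E) E n C
  unbdd : ¬ Bornology.IsBounded E
  dim_pos : 0 < n

theorem surfMeasure_apply {n : ℕ} {E A : Set (ES n)} (hE : IsClosed E) :
    surfMeasure n E A = μH[(n : ℝ)] (A ∩ E) := by
  unfold surfMeasure
  rw [Measure.restrict_apply' hE.measurableSet]

theorem IsADR.regular {n : ℕ} {C : ℝ} {E : Set (ES n)} (h : IsADR n C E) (hn : 0 < n)
    (hb : ¬ Bornology.IsBounded E) : Regular n (C * 2 ^ n) E := by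
  obtain ⟨hc, hC, h⟩ := h
  have hd : EMetric.diam E = ⊤ := by
    by_contra hne
    exact hb (isBounded_iff_ediam_ne_top.2 hne)
  have h1 : (1 : ℝ) ≤ 2 ^ n := one_le_pow₀ (by norm_num)
  refine ⟨hc, ⟨by nlinarith, ?_, ?_⟩, hb, hn⟩
  · intro x hx r hr
    rw [surfMeasure_apply hc, inter_comm]
    refine le_trans (ENNReal.ofReal_le_ofReal ?_)
      (h x hx r hr (by rw [hd]; exact ENNReal.ofReal_lt_top)).1
    gcongr
    nlinarith
  · intro w r hr
    rw [surfMeasure_apply hc, inter_comm]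
    rcases (E ∩ ball w r).eq_empty_or_nonempty with h0 | ⟨x, hx, hxw⟩
    · simp [h0]
    have h2 : ball w r ⊆ ball x (2 * r) := by
      intro y hy
      rw [mem_ball] at *
      have := dist_triangle_right y x w
      linarith
    refine (measure_mono (inter_subset_inter_right E h2)).trans
      ((h x hx (2 * r) (by positivity) (by rw [hd]; exact ENNReal.ofReal_lt_top)).2.trans ?_)
    rw [mul_pow, ← mul_assoc]

namespace DyadicSystem
variable {n : ℕ} {E : Set (ES n)} (D : DyadicSystem n E) {C : ℝ}

theorem subset_of_mem {k : ℤ} {Q : Set (ES n)} (hQ : Q ∈ D.cubes k) : Q ⊆ E := by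
  rw [← D.cover k]; exact subset_sUnion_of_mem hQ

theorem eq_of_mem {k : ℤ} {Q R : Set (ES n)} (hQ : Q ∈ D.cubes k) (hR : R ∈ D.cubes k)
    {x : ES n} (hx : x ∈ Q) (hx' : x ∈ R) : Q = R := by
  apply subset_antisymm
  · exact (D.nested k k le_rfl Q hQ R hR).resolve_right
      (Set.nonempty_iff_ne_empty.1 ⟨x, hx, hx'⟩)
  · exact (D.nested k k le_rfl R hR Q hQ).resolve_right
      (Set.nonempty_iff_ne_empty.1 ⟨x, hx', hx⟩)

theorem subset_of_mem_of_le {k m : ℤ} (hkm : k ≤ m) {Q R : Set (ES n)} (hQ : Q ∈ D.cubes m)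
    (hR : R ∈ D.cubes k) {x : ES n} (hx : x ∈ Q) (hx' : x ∈ R) : Q ⊆ R :=
  (D.nested k m hkm Q hQ R hR).resolve_right (Set.nonempty_iff_ne_empty.1 ⟨x, hx, hx'⟩)

theorem exists_cube (k : ℤ) {x : ES n} (hx : x ∈ E) : ∃ Q ∈ D.cubes k, x ∈ Q := by
  rw [← D.cover k] at hx; exact hx

open Classical in
/-- The cube of generation `k` containing `x`. -/
def cubeAt (k : ℤ) (x : ES n) : Set (ES n) :=
  if hx : x ∈ E then (D.exists_cube k hx).choose else ∅

theorem cubeAt_mem (k : ℤ) {x : ES n} (hx : x ∈ E) : D.cubeAt k x ∈ D.cubes k := by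
  rw [cubeAt, dif_pos hx]; exact (D.exists_cube k hx).choose_spec.1

theorem mem_cubeAt (k : ℤ) {x : ES n} (hx : x ∈ E) : x ∈ D.cubeAt k x := by
  rw [cubeAt, dif_pos hx]; exact (D.exists_cube k hx).choose_spec.2

theorem cubeAt_eq {k : ℤ} {Q : Set (ES n)} (hQ : Q ∈ D.cubes k) {x : ES n} (hx : x ∈ Q) :
    D.cubeAt k x = Q :=
  D.eq_of_mem (D.cubeAt_mem k (D.subset_of_mem hQ hx)) hQ
    (D.mem_cubeAt k (D.subset_of_mem hQ hx)) hx

theorem cubeAt_subset {k m : ℤ} (hkm : k ≤ m) {Q : Set (ES n)} (hQ : Q ∈ D.cubes k)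
    {x : ES n} (hx : x ∈ Q) : D.cubeAt m x ⊆ Q :=
  D.subset_of_mem_of_le hkm (D.cubeAt_mem m (D.subset_of_mem hQ hx)) hQ
    (D.mem_cubeAt m (D.subset_of_mem hQ hx)) hx

theorem dist_le {k : ℤ} {Q : Set (ES n)} (hQ : Q ∈ D.cubes k) {x y : ES n} (hx : x ∈ Q)
    (hy : y ∈ Q) : dist x y ≤ D.Cstar * 2 ^ (-k) := by
  have h := (edist_le_ediam_of_mem hx hy).trans (D.diam_le k Q hQ)
  rw [edist_dist] at h
  exact (ENNReal.ofReal_le_ofReal_iff (by have := D.Cstar_pos; positivity)).1 h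

theorem subset_ball {k : ℤ} {Q : Set (ES n)} (hQ : Q ∈ D.cubes k) {x : ES n} (hx : x ∈ Q) :
    Q ⊆ ball x (2 * D.Cstar * 2 ^ (-k)) := by
  intro y hy
  have h1 := D.dist_le hQ hy hx
  have h2 : 0 < D.Cstar * 2 ^ (-k) := by have := D.Cstar_pos; positivity
  rw [mem_ball]; linarith

theorem center_mem_E {k : ℤ} {Q : Set (ES n)} (hQ : Q ∈ D.cubes k) : D.center Q ∈ E :=
  D.subset_of_mem hQ (D.center_mem k Q hQ)

theorem hausdorff_eq (hE : IsClosed E) {k : ℤ} {Q A : Set (ES n)} (hQ : Q ∈ D.cubes k)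
    (hA : A ⊆ Q) : μH[(n : ℝ)] A = surfMeasure n E A := by
  rw [surfMeasure_apply hE, inter_eq_left.2 (hA.trans (D.subset_of_mem hQ))]

theorem le_measure (h : Regular n C E) {k : ℤ} {Q : Set (ES n)} (hQ : Q ∈ D.cubes k) :
    ENNReal.ofReal (C⁻¹ * (D.a₀ * 2 ^ (-k)) ^ n) ≤ surfMeasure n E Q := by
  have h0 : 0 < D.a₀ * 2 ^ (-k) := by have := D.a₀_pos; positivity
  refine (h.ad.lower _ (D.center_mem_E hQ) _ h0).trans ?_
  rw [surfMeasure_apply h.closed, surfMeasure_apply h.closed]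
  refine measure_mono ?_
  rintro y ⟨hy, hyE⟩
  exact ⟨D.contains_ball k Q hQ ⟨hyE, hy⟩, hyE⟩

theorem measure_le (h : Regular n C E) {k : ℤ} {Q : Set (ES n)} (hQ : Q ∈ D.cubes k) :
    surfMeasure n E Q ≤ ENNReal.ofReal (C * (2 * D.Cstar * 2 ^ (-k)) ^ n) := by
  have h0 : 0 < 2 * D.Cstar * 2 ^ (-k) := by have := D.Cstar_pos; positivity
  exact (measure_mono (D.subset_ball hQ (D.center_mem k Q hQ))).trans (h.ad.upper _ _ h0)

theorem measure_ne_top (h : Regular n C E) {k : ℤ} {Q : Set (ES n)} (hQ : Q ∈ D.cubes k) :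
    surfMeasure n E Q ≠ ⊤ := ((D.measure_le h hQ).trans_lt ENNReal.ofReal_lt_top).ne

theorem pairwiseDisjoint (k : ℤ) : (D.cubes k).PairwiseDisjoint id := by
  intro Q hQ R hR hne
  rw [Function.onFun, Set.disjoint_left]
  intro x hx hx'
  exact hne (D.eq_of_mem hQ hR hx hx')

theorem countable (k : ℤ) : (D.cubes k).Countable := by
  have hinj : InjOn (fun Q => D.center Q) (D.cubes k) := by
    intro Q hQ R hR h
    refine D.eq_of_mem hQ hR (D.center_mem k Q hQ) ?_
    simp only at h
    rw [h]; exact D.center_mem k R hR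
  have hdisc : IsDiscrete ((fun Q => D.center Q) '' D.cubes k) := by
    rw [isDiscrete_iff_forall_exists_isOpen]
    rintro _ ⟨Q, hQ, rfl⟩
    refine ⟨ball (D.center Q) (D.a₀ * 2 ^ (-k)), isOpen_ball, ?_⟩
    ext y
    constructor
    · rintro ⟨hy, R, hR, rfl⟩
      have h1 := D.contains_ball k Q hQ ⟨D.center_mem_E hR, hy⟩
      rw [mem_singleton_iff]
      exact congrArg D.center (D.eq_of_mem hR hQ (D.center_mem k R hR) h1)
    · intro hy
      rw [mem_singleton_iff] at hy
      subst hy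
      exact ⟨mem_ball_self (by have := D.a₀_pos; positivity), Q, hQ, rfl⟩
  have := hdisc.to_subtype
  have hcount : ((fun Q => D.center Q) '' D.cubes k).Countable := by
    have : Countable ((fun Q => D.center Q) '' D.cubes k) :=
      TopologicalSpace.separableSpace_iff_countable.1 inferInstance
    exact this.to_set
  exact countable_of_injective_of_countable_image hinj hcount

theorem eq_biUnion {k m : ℤ} (hkm : k ≤ m) {Q : Set (ES n)} (hQ : Q ∈ D.cubes k) :
    Q = ⋃ R ∈ {R | R ∈ D.cubes m ∧ R ⊆ Q}, R := by
  apply subset_antisymm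
  · intro x hx
    exact mem_biUnion (x := D.cubeAt m x)
      ⟨D.cubeAt_mem m (D.subset_of_mem hQ hx), D.cubeAt_subset hkm hQ hx⟩
      (D.mem_cubeAt m (D.subset_of_mem hQ hx))
  · exact iUnion₂_subset fun R hR => hR.2

theorem lintegral_eq_tsum {k m : ℤ} (hkm : k ≤ m) {Q : Set (ES n)} (hQ : Q ∈ D.cubes k)
    (μ : Measure (ES n)) (f : ES n → ℝ≥0∞) :
    ∫⁻ x in Q, f x ∂μ = ∑' R : {R | R ∈ D.cubes m ∧ R ⊆ Q}, ∫⁻ x in R.1, f x ∂μ := by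
  conv_lhs => rw [D.eq_biUnion hkm hQ]
  exact lintegral_biUnion ((D.countable m).mono fun R hR => hR.1) (fun R hR => D.borel m R hR.1)
    ((D.pairwiseDisjoint m).subset fun R hR => hR.1) f

/-- Integral inequalities can be checked on descendants. -/
theorem lintegral_mono_of_children {k m : ℤ} (hkm : k ≤ m) {Q : Set (ES n)} (hQ : Q ∈ D.cubes k)
    (μ : Measure (ES n)) {f g : ES n → ℝ≥0∞}
    (h : ∀ R ∈ D.cubes m, R ⊆ Q → ∫⁻ x in R, f x ∂μ ≤ ∫⁻ x in R, g x ∂μ) :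
    ∫⁻ x in Q, f x ∂μ ≤ ∫⁻ x in Q, g x ∂μ := by
  rw [D.lintegral_eq_tsum hkm hQ, D.lintegral_eq_tsum hkm hQ]
  exact ENNReal.tsum_le_tsum fun R => h R.1 R.2.1 R.2.2

/-- The union of the cubes of generation `k` satisfying `P`. -/
def family (P : ℤ → Set (ES n) → Prop) (k : ℤ) : Set (ES n) := {x ∈ E | P k (D.cubeAt k x)}

variable {P : ℤ → Set (ES n) → Prop}

theorem family_eq (k : ℤ) : D.family P k = ⋃ R ∈ {R | R ∈ D.cubes k ∧ P k R}, R := by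
  ext x
  simp only [family, mem_ofPred_eq, mem_iUnion, exists_prop]
  constructor
  · rintro ⟨hx, h⟩
    exact ⟨_, ⟨D.cubeAt_mem k hx, h⟩, D.mem_cubeAt k hx⟩
  · rintro ⟨R, ⟨hR, h⟩, hx⟩
    exact ⟨D.subset_of_mem hR hx, by rwa [D.cubeAt_eq hR hx]⟩

theorem measurableSet_family (k : ℤ) : MeasurableSet (D.family P k) := by
  rw [family_eq]
  exact MeasurableSet.biUnion ((D.countable k).mono fun R hR => hR.1) fun R hR => D.borel k R hR.1

theorem mem_family_of_mem {k : ℤ} {Q : Set (ES n)} (hQ : Q ∈ D.cubes k) {x : ES n} (hx : x ∈ Q) :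
    x ∈ D.family P k ↔ P k Q := by
  simp [family, D.subset_of_mem hQ hx, D.cubeAt_eq hQ hx]

/-- Carleson condition over dyadic cubes. -/
def Carleson (D : DyadicSystem n E) (U : ℤ → Set (ES n)) (A : ℝ≥0∞) : Prop :=
  ∀ k : ℤ, ∀ Q ∈ D.cubes k,
    ∑' i : ℕ, surfMeasure n E (U (k + i) ∩ Q) ≤ A * surfMeasure n E Q

theorem measure_family_inter (h : Regular n C E) {k m : ℤ} (hkm : k ≤ m) {Q : Set (ES n)}
    (hQ : Q ∈ D.cubes k) : surfMeasure n E (D.family P m ∩ Q) =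
      ∑' R : {R | R ∈ D.cubes m ∧ P m R ∧ R ⊆ Q}, μH[(n : ℝ)] R.1 := by
  have : D.family P m ∩ Q = ⋃ R ∈ {R | R ∈ D.cubes m ∧ P m R ∧ R ⊆ Q}, R := by
    ext x
    simp only [mem_inter_iff, mem_iUnion, exists_prop, mem_ofPred_eq]
    constructor
    · rintro ⟨⟨hx, hP⟩, hxQ⟩
      exact ⟨_, ⟨D.cubeAt_mem m hx, hP, D.cubeAt_subset hkm hQ hxQ⟩, D.mem_cubeAt m hx⟩
    · rintro ⟨R, ⟨hR, hP, hRQ⟩, hx⟩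
      exact ⟨(D.mem_family_of_mem hR hx).2 hP, hRQ hx⟩
  have hu := measure_biUnion (μ := surfMeasure n E)
    (s := {R | R ∈ D.cubes m ∧ P m R ∧ R ⊆ Q}) ((D.countable m).mono fun R hR => hR.1)
    ((D.pairwiseDisjoint m).subset fun R hR => hR.1) (fun R hR => D.borel m R hR.1)
  simp only [id] at hu
  rw [this, hu]
  exact tsum_congr fun R => (D.hausdorff_eq h.closed R.2.1 subset_rfl).symm

theorem Carleson.of_packedBy (h : Regular n C E) {A : ℝ} (hP : PackedBy E D P A) :
    D.Carleson (D.family P) (ENNReal.ofReal A) := by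
  intro k Q hQ
  have h1 := hP k Q hQ
  rw [D.hausdorff_eq h.closed hQ subset_rfl] at h1
  refine le_trans ?_ h1
  have h2 : ∀ i : ℕ, surfMeasure n E (D.family P (k + i) ∩ Q) =
      ∑' R : {R | R ∈ D.cubes (k + i) ∧ P (k + i) R ∧ R ⊆ Q}, μH[(n : ℝ)] R.1 := fun i =>
    D.measure_family_inter h (by omega) hQ
  simp_rw [h2]
  rw [← ENNReal.tsum_sigma' (fun s : (Σ i : ℕ, {R | R ∈ D.cubes (k + i) ∧ P (k + i) R ∧ R ⊆ Q}) =>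
    μH[(n : ℝ)] s.2.1)]
  let φ : (Σ i : ℕ, {R | R ∈ D.cubes (k + i) ∧ P (k + i) R ∧ R ⊆ Q}) →
      {p : ℤ × Set (ES n) // p.2 ∈ D.cubes p.1 ∧ P p.1 p.2 ∧ p.2 ⊆ Q} :=
    fun s => ⟨(k + s.1, s.2.1), s.2.2⟩
  have hφ : Function.Injective φ := by
    rintro ⟨i, R, hR⟩ ⟨j, R', hR'⟩ heq
    simp only [φ, Subtype.mk.injEq, Prod.mk.injEq] at heq
    obtain ⟨h1, rfl⟩ := heq
    obtain rfl : i = j := by omega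
    rfl
  exact ENNReal.tsum_comp_le_tsum_of_injective hφ (fun p => μH[(n : ℝ)] p.1.2)

theorem exists_generation_gap (h : Regular n C E) : ∃ m : ℕ, ∀ k j : ℤ, ∀ Q ∈ D.cubes k,
    ∀ R ∈ D.cubes j, R ⊆ Q → k - m ≤ j := by
  have hC := h.ad.pos
  have ha := D.a₀_pos
  have hs := D.Cstar_pos
  obtain ⟨m, hm⟩ := pow_unbounded_of_one_lt (C ^ 2 * (2 * D.Cstar / D.a₀) ^ n)
    (one_lt_two : (1 : ℝ) < 2)
  refine ⟨m, fun k j Q hQ R hR hRQ => ?_⟩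
  by_contra! hlt
  have h1 := (D.le_measure h hR).trans ((measure_mono hRQ).trans (D.measure_le h hQ))
  rw [ENNReal.ofReal_le_ofReal_iff (by positivity)] at h1
  have h2 : (2 : ℝ) ^ (-j) = 2 ^ (k - j) * 2 ^ (-k) := by
    rw [← zpow_add₀ (by norm_num)]; congr 1; ring
  have h3 : (2 : ℝ) ^ m ≤ 2 ^ (k - j) := by
    rw [← zpow_natCast]
    exact zpow_le_zpow_right₀ (by norm_num) (by omega)
  have h4 : (2 : ℝ) ^ m ≤ (2 ^ (k - j)) ^ n :=
    h3.trans (le_self_pow₀ ((one_le_pow₀ (by norm_num : (1 : ℝ) ≤ 2)).trans h3) h.dim_pos.ne')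
  rw [h2] at h1
  have h5 : C⁻¹ * (D.a₀ * (2 ^ (k - j) * 2 ^ (-k))) ^ n =
    (2 ^ (k - j)) ^ n * (C⁻¹ * D.a₀ ^ n * (2 ^ (-k)) ^ n) := by
    simp only [mul_pow]; ring
  have h6 : C * (2 * D.Cstar * 2 ^ (-k)) ^ n = (C ^ 2 * (2 * D.Cstar / D.a₀) ^ n) *
      (C⁻¹ * D.a₀ ^ n * (2 ^ (-k)) ^ n) := by
    simp only [mul_pow, div_pow]; field_simp
  rw [h5, h6] at h1
  have h7 := le_of_mul_le_mul_right h1 (by positivity)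
  linarith

theorem packedBy_of_carleson (h : Regular n C E) {A : ℝ≥0∞} (hA : A ≠ ⊤)
    (hP : D.Carleson (D.family P) A) : ∃ A' : ℝ, PackedBy E D P A' := by
  obtain ⟨m, hm⟩ := D.exists_generation_gap h
  refine ⟨m + A.toReal, fun k Q hQ => ?_⟩
  rw [D.hausdorff_eq h.closed hQ subset_rfl, ENNReal.ofReal_add (by positivity) (by positivity),
    ENNReal.ofReal_toReal hA, ENNReal.ofReal_natCast, add_mul]
  have hsub : ∀ i : ℕ, ∑' R : {R | R ∈ D.cubes (k - m + i) ∧ P (k - m + i) R ∧ R ⊆ Q},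
      μH[(n : ℝ)] R.1 ≤ surfMeasure n E (D.family P (k - m + i) ∩ Q) := by
    intro i
    have hc : {R | R ∈ D.cubes (k - m + i) ∧ P (k - m + i) R ∧ R ⊆ Q}.Countable :=
      (D.countable _).mono fun R hR => hR.1
    have h1 := measure_biUnion (μ := surfMeasure n E) hc
      ((D.pairwiseDisjoint _).subset fun R hR => hR.1) (fun R hR => D.borel _ R hR.1)
    simp only [id] at h1
    rw [tsum_congr fun R : {R | R ∈ D.cubes (k - m + i) ∧ P (k - m + i) R ∧ R ⊆ Q} =>
      D.hausdorff_eq h.closed R.2.1 subset_rfl, ← h1]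
    refine measure_mono (iUnion₂_subset fun R hR x hx => ⟨?_, hR.2.2 hx⟩)
    exact (D.mem_family_of_mem hR.1 hx).2 hR.2.1
  let φ : {p : ℤ × Set (ES n) // p.2 ∈ D.cubes p.1 ∧ P p.1 p.2 ∧ p.2 ⊆ Q} →
      (Σ i : ℕ, {R | R ∈ D.cubes (k - m + i) ∧ P (k - m + i) R ∧ R ⊆ Q}) :=
    fun p => ⟨(p.1.1 - (k - m)).toNat, p.1.2, by
      have h1 := hm k p.1.1 Q hQ p.1.2 p.2.1 p.2.2.2
      have h2 : k - m + ((p.1.1 - (k - m)).toNat : ℤ) = p.1.1 := by omega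
      rw [h2]; exact p.2⟩
  have hφ : Function.Injective φ := by
    rintro ⟨⟨i, R⟩, hR⟩ ⟨⟨j, R'⟩, hR'⟩ heq
    have e1 := congrArg (fun s => s.1) heq
    have e2 := congrArg (fun s => (s.2.1 : Set (ES n))) heq
    simp only [φ] at e1 e2
    have h1 := hm k i Q hQ R hR.1 hR.2.2
    have h2 := hm k j Q hQ R' hR'.1 hR'.2.2
    obtain rfl : i = j := by omega
    subst e2
    rfl
  calc ∑' p : {p : ℤ × Set (ES n) // p.2 ∈ D.cubes p.1 ∧ P p.1 p.2 ∧ p.2 ⊆ Q},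
        μH[(n : ℝ)] p.1.2
      ≤ ∑' s : (Σ i : ℕ, {R | R ∈ D.cubes (k - m + i) ∧ P (k - m + i) R ∧ R ⊆ Q}),
        μH[(n : ℝ)] s.2.1 :=
        ENNReal.tsum_comp_le_tsum_of_injective hφ
          (fun s : (Σ i : ℕ, {R | R ∈ D.cubes (k - m + i) ∧ P (k - m + i) R ∧ R ⊆ Q}) =>
            μH[(n : ℝ)] s.2.1)
    _ = ∑' i : ℕ, ∑' R : {R | R ∈ D.cubes (k - m + i) ∧ P (k - m + i) R ∧ R ⊆ Q},
        μH[(n : ℝ)] R.1 := ENNReal.tsum_sigma' _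
    _ ≤ ∑' i : ℕ, surfMeasure n E (D.family P (k - m + i) ∩ Q) := ENNReal.tsum_le_tsum hsub
    _ = ∑ i ∈ Finset.range m, surfMeasure n E (D.family P (k - m + i) ∩ Q) +
        ∑' i : ℕ, surfMeasure n E (D.family P (k - m + (i + m : ℕ)) ∩ Q) :=
        (ENNReal.summable.sum_add_tsum_nat_add' (k := m)).symm
    _ ≤ m * surfMeasure n E Q + A * surfMeasure n E Q := by
        gcongr
        · calc _ ≤ ∑ i ∈ Finset.range m, surfMeasure n E Q :=
                Finset.sum_le_sum fun i _ => measure_mono inter_subset_right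
            _ = m * surfMeasure n E Q := by simp
        · refine le_trans (le_of_eq ?_) (hP k Q hQ)
          refine tsum_congr fun i => ?_
          congr 3
          push_cast; ring

end DyadicSystem

/-- number of scales among `k, …, k + t - 1` at which `x` belongs to `U`. -/
def truncCount {S : Type*} (U : ℤ → Set S) (t : ℕ) (k : ℤ) (x : S) : ℝ≥0∞ :=
  ∑ i ∈ Finset.range t, (U (k + i)).indicator 1 x

theorem truncCount_succ {S : Type*} (U : ℤ → Set S) (t : ℕ) (k : ℤ) (x : S) :
    truncCount U (t + 1) k x = (U k).indicator 1 x + truncCount U t (k + 1) x := by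
  unfold truncCount
  rw [Finset.sum_range_succ', add_comm]
  congr 1
  · simp
  · refine Finset.sum_congr rfl fun i _ => ?_
    congr 2; push_cast; ring

theorem truncCount_le_scaleCount {S : Type*} (U : ℤ → Set S) (t : ℕ) (k : ℤ) (x : S) :
    truncCount U t k x ≤ scaleCount U k x := ENNReal.sum_le_tsum _

theorem measurable_truncCount {S : Type*} [MeasurableSpace S] {U : ℤ → Set S}
    (hU : ∀ k, MeasurableSet (U k)) (t : ℕ) (k : ℤ) : Measurable (truncCount U t k) :=
  Finset.measurable_sum _ fun i _ => measurable_one.indicator (hU _)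

namespace DyadicSystem
variable {n : ℕ} {E : Set (ES n)} (D : DyadicSystem n E) {C : ℝ} {P : ℤ → Set (ES n) → Prop}

theorem lintegral_truncCount_le (h : Regular n C E) {N : ℕ} {c : ℝ≥0∞} (hc : c ≠ 0) (hc1 : c ≤ 1)
    (hyp : ∀ k : ℤ, ∀ Q ∈ D.cubes k,
      c * surfMeasure n E Q ≤ surfMeasure n E {x ∈ Q | scaleCount (D.family P) k x ≤ (N + 1 : ℕ)})
    (t : ℕ) : ∀ (k : ℤ), ∀ Q ∈ D.cubes k, ∀ m : ℕ,
    ∫⁻ x in Q, (truncCount (D.family P) t k x + ((N + 1 : ℕ) / c) *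
      {x | truncCount (D.family P) t k x ≤ m}.indicator 1 x) ∂(surfMeasure n E) ≤
    ∫⁻ _ in Q, ((N + 1 : ℕ) / c + m) ∂(surfMeasure n E) := by
  set U := D.family P with hU
  set A : ℝ≥0∞ := (N + 1 : ℕ) / c with hA
  have hAc : A * c = (N + 1 : ℕ) :=
    ENNReal.div_mul_cancel hc (hc1.trans_lt ENNReal.one_lt_top).ne
  have hUm : ∀ k, MeasurableSet (U k) := D.measurableSet_family
  induction t with
  | zero =>
    intro k Q hQ m
    refine lintegral_mono fun x => ?_
    simp [truncCount]
  | succ t ih =>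
    intro k Q hQ
    have hQm := D.borel k Q hQ
    by_cases hP : P k Q
    · have h1 : ∀ x ∈ Q, truncCount U (t + 1) k x = 1 + truncCount U t (k + 1) x := by
        intro x hx
        rw [truncCount_succ, indicator_of_mem ((D.mem_family_of_mem hQ hx).2 hP)]; rfl
      have hsucc : ∀ m : ℕ, ∫⁻ x in Q, (truncCount U (t + 1) k x +
          A * {x | truncCount U (t + 1) k x ≤ (m + 1 : ℕ)}.indicator 1 x) ∂(surfMeasure n E) ≤
          ∫⁻ _ in Q, (A + (m + 1 : ℕ)) ∂(surfMeasure n E) := by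
        intro m
        have e : ∀ x ∈ Q, truncCount U (t + 1) k x +
            A * {x | truncCount U (t + 1) k x ≤ (m + 1 : ℕ)}.indicator 1 x =
            1 + (truncCount U t (k + 1) x +
              A * {x | truncCount U t (k + 1) x ≤ m}.indicator 1 x) := by
          intro x hx
          have : (x ∈ {x | truncCount U (t + 1) k x ≤ (m + 1 : ℕ)}) ↔
              x ∈ {x | truncCount U t (k + 1) x ≤ m} := by
            simp only [mem_ofPred_eq]
            rw [h1 x hx, add_comm, Nat.cast_add, Nat.cast_one]
            exact ENNReal.add_le_add_iff_right ENNReal.one_ne_top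
          simp only [indicator_apply, this, h1 x hx]
          rw [add_assoc]
        rw [setLIntegral_congr_fun hQm e]
        refine D.lintegral_mono_of_children (m := k + 1) (by omega) hQ _ fun R hR _ => ?_
        rw [lintegral_add_left measurable_const]
        refine (add_le_add_right (ih (k + 1) R hR m) _).trans (le_of_eq ?_)
        rw [← lintegral_add_left measurable_const]
        congr 1; ext x; push_cast; ring
      intro m
      rcases m with _ | m
      · have e : ∀ x ∈ Q, truncCount U (t + 1) k x +
            A * {x | truncCount U (t + 1) k x ≤ (0 : ℕ)}.indicator 1 x =
            truncCount U (t + 1) k x := by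
          intro x hx
          rw [indicator_of_notMem, mul_zero, add_zero]
          simp [h1 x hx]
        rw [setLIntegral_congr_fun hQm e]
        have key := hsucc N
        have hm : MeasurableSet {x | truncCount U (t + 1) k x ≤ (N + 1 : ℕ)} :=
          measurableSet_le (measurable_truncCount hUm _ _) measurable_const
        rw [lintegral_add_left (measurable_truncCount hUm _ _),
          lintegral_const_mul _ (measurable_one.indicator hm), lintegral_indicator_one hm,
          Measure.restrict_apply hm] at key
        simp only [lintegral_const, Measure.restrict_apply_univ, Nat.cast_zero, add_zero] at key ⊢
        have h2 : ((N + 1 : ℕ) : ℝ≥0∞) * surfMeasure n E Q ≤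
            A * surfMeasure n E ({x | truncCount U (t + 1) k x ≤ (N + 1 : ℕ)} ∩ Q) := by
          have h4 : ((N + 1 : ℕ) : ℝ≥0∞) * surfMeasure n E Q = A * (c * surfMeasure n E Q) := by
            rw [← mul_assoc, hAc]
          rw [h4]
          gcongr
          refine (hyp k Q hQ).trans (measure_mono ?_)
          rintro x ⟨hx, hx'⟩
          exact ⟨(truncCount_le_scaleCount _ _ _ _).trans hx', hx⟩
        have h3 : ((N + 1 : ℕ) : ℝ≥0∞) * surfMeasure n E Q ≠ ⊤ :=
          ENNReal.mul_ne_top (ENNReal.natCast_ne_top _) (D.measure_ne_top h hQ)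
        rw [add_mul] at key
        exact (ENNReal.add_le_add_iff_right h3).1 ((add_le_add_right h2 _).trans key)
      · exact hsucc m
    · intro m
      have h1 : ∀ x ∈ Q, truncCount U (t + 1) k x = truncCount U t (k + 1) x := by
        intro x hx
        rw [truncCount_succ, indicator_of_notMem (fun hx' => hP ((D.mem_family_of_mem hQ hx).1 hx')),
          zero_add]
      have e : ∀ x ∈ Q, truncCount U (t + 1) k x +
          A * {x | truncCount U (t + 1) k x ≤ m}.indicator 1 x =
          truncCount U t (k + 1) x +
            A * {x | truncCount U t (k + 1) x ≤ m}.indicator 1 x := by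
        intro x hx
        simp only [indicator_apply, mem_ofPred_eq, h1 x hx]
      rw [setLIntegral_congr_fun hQm e]
      exact D.lintegral_mono_of_children (m := k + 1) (by omega) hQ _ fun R hR _ =>
        ih (k + 1) R hR m

/-- John–Nirenberg type self-improvement: if every cube has a big piece on which the number of bad
scales is bounded, the bad cubes satisfy a Carleson condition. -/
theorem carleson_of_bigPieces (h : Regular n C E) {N : ℕ} {c : ℝ≥0∞} (hc : c ≠ 0)
    (hyp : ∀ k : ℤ, ∀ Q ∈ D.cubes k,
      c * surfMeasure n E Q ≤ surfMeasure n E {x ∈ Q | scaleCount (D.family P) k x ≤ N}) :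
    ∃ A : ℝ≥0∞, A ≠ ⊤ ∧ D.Carleson (D.family P) A := by
  refine ⟨(N + 1 : ℕ) / min c 1 + (N + 1 : ℕ), ?_, fun k Q hQ => ?_⟩
  · exact ENNReal.add_ne_top.2 ⟨ENNReal.div_ne_top (ENNReal.natCast_ne_top _)
      (by simp [hc]), ENNReal.natCast_ne_top _⟩
  have hyp' : ∀ k : ℤ, ∀ Q ∈ D.cubes k, min c 1 * surfMeasure n E Q ≤
      surfMeasure n E {x ∈ Q | scaleCount (D.family P) k x ≤ (N + 1 : ℕ)} := by
    intro k Q hQ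
    refine le_trans (mul_le_mul_left (min_le_left _ _) _) ((hyp k Q hQ).trans (measure_mono ?_))
    rintro x ⟨hx, hx'⟩
    exact ⟨hx, hx'.trans (by exact_mod_cast N.le_succ)⟩
  rw [ENNReal.tsum_eq_iSup_nat]
  refine iSup_le fun t => ?_
  have key := D.lintegral_truncCount_le h (c := min c 1) (by simp [hc]) (min_le_right _ _) hyp' t k
    Q hQ (N + 1)
  rw [lintegral_const, Measure.restrict_apply_univ] at key
  refine le_trans ?_ key
  calc ∑ i ∈ Finset.range t, surfMeasure n E (D.family P (k + i) ∩ Q)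
      = ∫⁻ x in Q, truncCount (D.family P) t k x ∂(surfMeasure n E) := by
        unfold truncCount
        rw [lintegral_finsetSum _ fun i _ => measurable_one.indicator (D.measurableSet_family _)]
        refine Finset.sum_congr rfl fun i _ => ?_
        rw [lintegral_indicator_one (D.measurableSet_family _),
          Measure.restrict_apply (D.measurableSet_family _)]
    _ ≤ _ := lintegral_mono fun x => le_self_add

variable {U : ℤ → Set (ES n)} {A : ℝ≥0∞}

theorem Carleson.mono {D : DyadicSystem n E} {U' : ℤ → Set (ES n)} (hU : D.Carleson U A)
    (h : ∀ k, U' k ⊆ U k) : D.Carleson U' A := fun k Q hQ =>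
  (ENNReal.tsum_le_tsum fun _ => measure_mono (inter_subset_inter_left _ (h _))).trans (hU k Q hQ)

theorem Carleson.ball {D : DyadicSystem n E} (h : Regular n C E) (hU : D.Carleson U A) (j : ℤ)
    (x : ES n) (r : ℝ) :
    ∑' i : ℕ, surfMeasure n E (U (j + i) ∩ ball x r) ≤
      A * surfMeasure n E (ball x (r + 2 * D.Cstar * 2 ^ (-j))) := by
  set 𝒬 : Set (Set (ES n)) := {Q | Q ∈ D.cubes j ∧ (Q ∩ Metric.ball x r).Nonempty} with h𝒬
  have hc : 𝒬.Countable := (D.countable j).mono fun R hR => hR.1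
  have hcov : Metric.ball x r ∩ E ⊆ ⋃ Q ∈ 𝒬, Q := by
    rintro y ⟨hy, hyE⟩
    exact mem_biUnion (x := D.cubeAt j y) ⟨D.cubeAt_mem j hyE, y, D.mem_cubeAt j hyE, hy⟩
      (D.mem_cubeAt j hyE)
  have h1 : ∀ i : ℕ, surfMeasure n E (U (j + i) ∩ Metric.ball x r) ≤
      ∑' Q : 𝒬, surfMeasure n E (U (j + i) ∩ Q.1) := by
    intro i
    rw [surfMeasure_apply h.closed]
    calc μH[(n : ℝ)] (U (j + i) ∩ Metric.ball x r ∩ E)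
        ≤ μH[(n : ℝ)] (⋃ Q ∈ 𝒬, U (j + i) ∩ Q) := by
          refine measure_mono ?_
          rintro y ⟨⟨hy, hyb⟩, hyE⟩
          have := hcov ⟨hyb, hyE⟩
          simp only [mem_iUnion] at this ⊢
          obtain ⟨Q, hQ, hyQ⟩ := this
          exact ⟨Q, hQ, hy, hyQ⟩
      _ ≤ ∑' Q : 𝒬, μH[(n : ℝ)] (U (j + i) ∩ Q.1) := measure_biUnion_le _ hc _
      _ = _ := tsum_congr fun Q => D.hausdorff_eq h.closed Q.2.1 inter_subset_right
  calc _ ≤ ∑' i : ℕ, ∑' Q : 𝒬, surfMeasure n E (U (j + i) ∩ Q.1) := ENNReal.tsum_le_tsum h1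
    _ = ∑' Q : 𝒬, ∑' i : ℕ, surfMeasure n E (U (j + i) ∩ Q.1) := ENNReal.tsum_comm
    _ ≤ ∑' Q : 𝒬, A * surfMeasure n E Q.1 := ENNReal.tsum_le_tsum fun Q => hU j Q.1 Q.2.1
    _ = A * ∑' Q : 𝒬, surfMeasure n E Q.1 := ENNReal.tsum_mul_left
    _ = A * surfMeasure n E (⋃ Q ∈ 𝒬, Q) := by
        have := measure_biUnion (μ := surfMeasure n E) hc
          ((D.pairwiseDisjoint j).subset fun R hR => hR.1) (fun R hR => D.borel j R hR.1)
        simp only [id] at this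
        rw [this]
    _ ≤ _ := by
        gcongr
        refine iUnion₂_subset fun Q hQ y hy => ?_
        obtain ⟨z, hzQ, hz⟩ := hQ.2
        have h1 := D.subset_ball hQ.1 hzQ hy
        rw [mem_ball] at *
        linarith [dist_triangle y z x]

end DyadicSystem

theorem zpow_neg_add (k i : ℤ) : (2 : ℝ) ^ (-(k + i)) = 2 ^ (-i) * 2 ^ (-k) := by
  rw [← zpow_add₀ (by norm_num)]; congr 1; ring

theorem zpow_neg_le_of_le {k m : ℤ} (h : k ≤ m) : (2 : ℝ) ^ (-m) ≤ 2 ^ (-k) :=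
  zpow_le_zpow_right₀ (by norm_num) (by omega)

namespace DyadicSystem
variable {n : ℕ} {E : Set (ES n)} (D : DyadicSystem n E) {C : ℝ} {P : ℤ → Set (ES n) → Prop}
  {A : ℝ≥0∞}

theorem exists_ball_le_cube (h : Regular n C E) {R : ℝ} (hR : 0 < R) :
    ∃ K : ℝ≥0∞, K ≠ ⊤ ∧ ∀ k : ℤ, ∀ Q ∈ D.cubes k, ∀ x : ES n,
      surfMeasure n E (ball x (R * 2 ^ (-k))) ≤ K * surfMeasure n E Q := by
  have hC := h.ad.pos
  have ha := D.a₀_pos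
  refine ⟨ENNReal.ofReal (C ^ 2 * (R / D.a₀) ^ n), ENNReal.ofReal_ne_top, fun k Q hQ x => ?_⟩
  refine (h.ad.upper x _ (by positivity)).trans ?_
  refine le_trans (le_of_eq ?_) (mul_le_mul_right (D.le_measure h hQ) _)
  rw [← ENNReal.ofReal_mul (by positivity)]
  congr 1
  simp only [mul_pow, div_pow]; field_simp

theorem Carleson.shift {D : DyadicSystem n E} (h : Regular n C E) (hA : A ≠ ⊤)
    (hU : D.Carleson (D.family P) A) {L : ℝ} (hL : 0 < L) (i : ℤ) :
    ∃ A' : ℝ≥0∞, A' ≠ ⊤ ∧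
      D.Carleson (fun k => {x ∈ E | ∃ y ∈ D.family P (k + i), dist x y ≤ L * 2 ^ (-k)}) A' := by
  have hC := h.ad.pos
  have ha := D.a₀_pos
  have hs := D.Cstar_pos
  have hi : (0 : ℝ) < 2 ^ (-i) := by positivity
  obtain ⟨K, hK, hKle⟩ := D.exists_ball_le_cube h
    (R := L + 2 * D.Cstar * 2 ^ (-i) + 2 * D.Cstar + 2 * D.Cstar * 2 ^ (-i)) (by positivity)
  refine ⟨ENNReal.ofReal (C ^ 2 * ((L + 2 * D.Cstar * 2 ^ (-i)) / (D.a₀ * 2 ^ (-i))) ^ n) *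
    (A * K), ENNReal.mul_ne_top ENNReal.ofReal_ne_top (ENNReal.mul_ne_top hA hK),
    fun k Q hQ => ?_⟩
  have htr : ∀ t : ℕ, surfMeasure n E ({x ∈ E | ∃ y ∈ D.family P (k + t + i),
      dist x y ≤ L * 2 ^ (-(k + t : ℤ))} ∩ Q) ≤
      ENNReal.ofReal (C ^ 2 * ((L + 2 * D.Cstar * 2 ^ (-i)) / (D.a₀ * 2 ^ (-i))) ^ n) *
      surfMeasure n E (D.family P (k + i + t) ∩
        Metric.ball (D.center Q) ((L + 2 * D.Cstar * 2 ^ (-i) + 2 * D.Cstar) * 2 ^ (-k))) := by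
    intro t
    have hkt : (0 : ℝ) < 2 ^ (-(k + t : ℤ)) := by positivity
    have hle : (2 : ℝ) ^ (-(k + t : ℤ)) ≤ 2 ^ (-k) := zpow_neg_le_of_le (by omega)
    have e : (L + 2 * D.Cstar * 2 ^ (-i)) / (D.a₀ * 2 ^ (-i)) =
        ((L + 2 * D.Cstar * 2 ^ (-i)) * 2 ^ (-(k + t : ℤ))) /
          (D.a₀ * 2 ^ (-(k + t + i : ℤ))) := by
      rw [zpow_neg_add (k + t) i]; field_simp
    rw [e]
    refine h.ad.transfer (by positivity) (by positivity) ?_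
    rintro x ⟨⟨hxE, y, hy, hxy⟩, hxQ⟩
    have hyc := D.cubeAt_mem (k + t + i) hy.1
    refine ⟨_, D.center_mem_E hyc, ?_⟩
    rw [surfMeasure_apply h.closed, surfMeasure_apply h.closed]
    refine measure_mono ?_
    rintro z ⟨hz, hzE⟩
    have hzQ : z ∈ D.cubeAt (k + t + i) y := D.contains_ball _ _ hyc ⟨hzE, hz⟩
    have h1 := D.dist_le hyc hzQ (D.mem_cubeAt _ hy.1)
    rw [zpow_neg_add (k + t) i] at h1
    have h2 := D.subset_ball hQ (D.center_mem k Q hQ) hxQ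
    rw [mem_ball] at h2
    have h3 : dist z x < (L + 2 * D.Cstar * 2 ^ (-i)) * 2 ^ (-(k + t : ℤ)) := by
      have := dist_triangle_right z x y
      have : 0 < D.Cstar * 2 ^ (-i) * 2 ^ (-(k + t : ℤ)) := by positivity
      nlinarith
    refine ⟨⟨⟨?_, ?_⟩, h3⟩, hzE⟩
    · have : k + i + t = k + t + i := by ring
      rw [this]
      exact (D.mem_family_of_mem hyc hzQ).2
        ((D.mem_family_of_mem hyc (D.mem_cubeAt _ hy.1)).1 hy)
    · rw [mem_ball]
      have := dist_triangle z x (D.center Q)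
      have h4 : (L + 2 * D.Cstar * 2 ^ (-i)) * 2 ^ (-(k + t : ℤ)) ≤
        (L + 2 * D.Cstar * 2 ^ (-i)) * 2 ^ (-k) := by gcongr
      nlinarith
  refine (ENNReal.tsum_le_tsum htr).trans ?_
  rw [ENNReal.tsum_mul_left, mul_assoc (ENNReal.ofReal _)]
  gcongr
  refine (hU.ball h (k + i) _ _).trans ?_
  rw [mul_assoc A K]
  gcongr
  refine le_trans (le_of_eq ?_) (hKle k Q hQ (D.center Q))
  congr 2
  rw [zpow_neg_add k i]; ring

theorem Carleson.window {D : DyadicSystem n E} (h : Regular n C E) (hA : A ≠ ⊤)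
    (hU : D.Carleson (D.family P) A) {L : ℝ} (hL : 0 < L) (m : ℕ) :
    ∃ A' : ℝ≥0∞, A' ≠ ⊤ ∧
      D.Carleson (fun k => {x ∈ E | ∃ i : ℤ, |i| ≤ m ∧
        ∃ y ∈ D.family P (k + i), dist x y ≤ L * 2 ^ (-k)}) A' := by
  choose a ha hc using fun i : ℤ => hU.shift h hA hL i
  refine ⟨∑ i ∈ Finset.Icc (-m : ℤ) m, a i, ENNReal.sum_ne_top.2 fun i _ => ha i,
    fun k Q hQ => ?_⟩
  rw [Finset.sum_mul]
  calc _ ≤ ∑' t : ℕ, ∑ i ∈ Finset.Icc (-m : ℤ) m, surfMeasure n E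
          ({x ∈ E | ∃ y ∈ D.family P (k + t + i), dist x y ≤ L * 2 ^ (-(k + t : ℤ))} ∩ Q) := by
        refine ENNReal.tsum_le_tsum fun t => ?_
        refine le_trans (measure_mono ?_) (measure_biUnion_finset_le _ _)
        rintro x ⟨⟨hx, i, hi, y, hy⟩, hxQ⟩
        rw [mem_iUnion₂]
        exact ⟨i, by rw [Finset.mem_Icc]; exact abs_le.1 hi, ⟨hx, y, hy⟩, hxQ⟩
    _ = ∑ i ∈ Finset.Icc (-m : ℤ) m, ∑' t : ℕ, surfMeasure n E
          ({x ∈ E | ∃ y ∈ D.family P (k + t + i), dist x y ≤ L * 2 ^ (-(k + t : ℤ))} ∩ Q) :=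
        Summable.tsum_finsetSum fun i _ => ENNReal.summable
    _ ≤ _ := Finset.sum_le_sum fun i _ => hc i k Q hQ

end DyadicSystem

theorem scaleCount_annulus {S : Type*} {a b : ℝ} (ha : 0 < a) : ∃ N : ℕ, ∀ (d : S → ℝ) (j : ℤ)
    (x : S), scaleCount (fun k => {z | a * 2 ^ (-k) ≤ d z ∧ d z ≤ b * 2 ^ (-k)}) j x ≤ N := by
  obtain ⟨N, hN⟩ := pow_unbounded_of_one_lt (b / a) (one_lt_two : (1 : ℝ) < 2)
  refine ⟨N, fun d j x => ?_⟩
  classical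
  by_cases hex : ∃ i : ℕ, a * (2 : ℝ) ^ (-(j + i : ℤ)) ≤ d x ∧ d x ≤ b * 2 ^ (-(j + i : ℤ))
  · refine scaleCount_le_of_finset (Finset.Ico (Nat.find hex) (Nat.find hex + N)) (by simp) ?_
    intro i hi
    rw [Finset.mem_Ico]
    refine ⟨Nat.find_min' hex hi, ?_⟩
    by_contra! hlt
    have h1 := (Nat.find_spec hex).1
    have h2 := hi.2
    have h3 : (2 : ℝ) ^ (-(j + i : ℤ)) * 2 ^ N ≤ 2 ^ (-(j + (Nat.find hex) : ℤ)) := by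
      rw [← zpow_natCast, ← zpow_add₀ (by norm_num)]
      exact zpow_le_zpow_right₀ (by norm_num) (by omega)
    have h4 : (0 : ℝ) < 2 ^ (-(j + i : ℤ)) := by positivity
    rw [div_lt_iff₀ ha] at hN
    have h5 : a * ((2 : ℝ) ^ (-(j + i : ℤ)) * 2 ^ N) ≤ b * 2 ^ (-(j + i : ℤ)) :=
      (mul_le_mul_of_nonneg_left h3 ha.le).trans (h1.trans h2)
    nlinarith
  · refine scaleCount_le_of_finset ∅ (by simp) fun i hi => (hex ⟨i, hi⟩).elim

/-- The scales at which a subset `G` of an Ahlfors regular set `F` is not dense in `F` are rare. -/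
theorem ADMeas.density {S : Type*} [PseudoMetricSpace S] [SecondCountableTopology S]
    [MeasurableSpace S] [OpensMeasurableSpace S] {μ : Measure S} {F : Set S} {n : ℕ} {C : ℝ}
    (h : ADMeas μ F n C) {τ Λ : ℝ} (hτ : 0 < τ) (hΛ : 0 < Λ) :
    ∃ A : ℝ≥0∞, A ≠ ⊤ ∧ ∀ (G : Set S) (x₀ : S) (r : ℝ) (j : ℤ), (2 : ℝ) ^ (-j) ≤ r →
      G ⊆ ball x₀ r →
      ∑' t : ℕ, μ {x ∈ G | ∃ y ∈ F, dist x y < Λ * 2 ^ (-(j + t : ℤ)) ∧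
        τ * 2 ^ (-(j + t : ℤ)) < infDist y G} ≤ A * ENNReal.ofReal (r ^ n) := by
  have hC := h.pos
  obtain ⟨N, hN⟩ := scaleCount_annulus (S := S) (a := τ / 2) (b := Λ + τ) (by positivity)
  refine ⟨ENNReal.ofReal (C ^ 2 * ((Λ + τ) / (τ / 2)) ^ n) *
    (N * ENNReal.ofReal (C * (Λ + τ + 1) ^ n)), by finiteness, ?_⟩
  intro G x₀ r j hj hG
  have hr : 0 < r := lt_of_lt_of_le (by positivity) hj
  set Z : ℤ → Set S := fun k => {z | τ / 2 * 2 ^ (-k) ≤ infDist z G ∧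
    infDist z G ≤ (Λ + τ) * 2 ^ (-k)} with hZ
  have hZm : ∀ k, MeasurableSet (Z k) := fun k =>
    ((isClosed_le continuous_const (continuous_infDist_pt G)).inter
      (isClosed_le (continuous_infDist_pt G) continuous_const)).measurableSet
  set B := ball x₀ ((Λ + τ + 1) * r) with hB
  have htr : ∀ t : ℕ, μ {x ∈ G | ∃ y ∈ F, dist x y < Λ * 2 ^ (-(j + t : ℤ)) ∧
        τ * 2 ^ (-(j + t : ℤ)) < infDist y G} ≤
        ENNReal.ofReal (C ^ 2 * ((Λ + τ) / (τ / 2)) ^ n) * μ (Z (j + t) ∩ B) := by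
    intro t
    set l : ℝ := 2 ^ (-(j + t : ℤ)) with hl
    have hl0 : 0 < l := by positivity
    have hlr : l ≤ r := (zpow_neg_le_of_le (by omega)).trans hj
    have e : (Λ + τ) / (τ / 2) = ((Λ + τ) * l) / (τ / 2 * l) := by field_simp
    rw [e]
    refine h.transfer (by positivity) (by positivity) ?_
    rintro x ⟨hx, y, hy, hxy, hyG⟩
    refine ⟨y, hy, measure_mono fun z hz => ?_⟩
    rw [mem_ball] at hz
    have hzx : dist z x < (Λ + τ) * l := by
      have := dist_triangle_right z x y
      nlinarith
    refine ⟨⟨⟨?_, ?_⟩, ?_⟩, hzx⟩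
    · have := infDist_le_infDist_add_dist (s := G) (x := y) (y := z)
      rw [dist_comm] at this
      linarith
    · exact (infDist_le_dist_of_mem hx).trans hzx.le
    · rw [mem_ball]
      have h1 := hG hx
      rw [mem_ball] at h1
      have := dist_triangle z x x₀
      have : (Λ + τ) * l ≤ (Λ + τ) * r := by gcongr
      linarith
  refine (ENNReal.tsum_le_tsum htr).trans ?_
  rw [ENNReal.tsum_mul_left, mul_assoc]
  gcongr
  calc ∑' t : ℕ, μ (Z (j + t) ∩ B) = ∫⁻ x in B, scaleCount Z j x ∂μ := by
        rw [lintegral_scaleCount hZm]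
        exact tsum_congr fun t => by rw [Measure.restrict_apply (hZm _)]
    _ ≤ ∫⁻ _ in B, N ∂μ := lintegral_mono fun x => hN _ _ _
    _ = N * μ B := by simp
    _ ≤ N * ENNReal.ofReal (C * (Λ + τ + 1) ^ n) * ENNReal.ofReal (r ^ n) := by
        rw [mul_assoc, ← ENNReal.ofReal_mul (by positivity)]
        gcongr
        refine (h.upper x₀ _ (by positivity)).trans (le_of_eq ?_)
        rw [mul_pow, mul_assoc]

theorem exists_adMeas_volume (n : ℕ) :
    ∃ C : ℝ, ADMeas (volume : Measure (EuclideanSpace ℝ (Fin n))) univ n C := by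
  set b : ℝ := (volume (ball (0 : EuclideanSpace ℝ (Fin n)) 1)).toReal with hb
  have hb0 : 0 < b := ENNReal.toReal_pos (measure_ball_pos _ _ one_pos).ne' measure_ball_lt_top.ne
  have hv : ∀ (x : EuclideanSpace ℝ (Fin n)) (r : ℝ), 0 < r →
      volume (ball x r) = ENNReal.ofReal (b * r ^ n) := by
    intro x r hr
    rw [Measure.addHaar_ball_of_pos _ _ hr, finrank_euclideanSpace_fin, mul_comm b,
      ENNReal.ofReal_mul (by positivity), hb, ENNReal.ofReal_toReal measure_ball_lt_top.ne]
  refine ⟨max 1 (max b b⁻¹), le_max_left _ _, ?_, ?_⟩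
  · intro x _ r hr
    rw [hv x r hr]
    gcongr
    rw [inv_le_comm₀ (by positivity) hb0]
    exact (le_max_right _ _).trans (le_max_right _ _)
  · intro x r hr
    rw [hv x r hr]
    gcongr
    exact (le_max_left _ _).trans (le_max_right _ _)

section SecondDifferences

variable {n : ℕ} {Y : Type*} [NormedAddCommGroup Y] [InnerProductSpace ℝ Y]

/-- the second difference of `f` at `x` with step `h`. -/
def secondDiff (f : EuclideanSpace ℝ (Fin n) → Y) (h x : EuclideanSpace ℝ (Fin n)) : Y :=
  f (x + (2 : ℝ) • h) - (2 : ℝ) • f (x + h) + f x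

theorem lintegral_secondDiff {f : EuclideanSpace ℝ (Fin n) → Y} (hf : Continuous f)
    (h : EuclideanSpace ℝ (Fin n)) :
    (∫⁻ x, ENNReal.ofReal (‖f (x + (2 : ℝ) • h) - f x‖ ^ 2)) +
      ∫⁻ x, ENNReal.ofReal (‖secondDiff f h x‖ ^ 2) =
    4 * ∫⁻ x, ENNReal.ofReal (‖f (x + h) - f x‖ ^ 2) := by
  have hm : Measurable fun x => ENNReal.ofReal (‖f (x + h) - f x‖ ^ 2) :=
    ENNReal.measurable_ofReal.comp (by fun_prop : Continuous fun x => ‖f (x + h) - f x‖ ^ 2).measurable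
  have hm2 : Measurable fun x => ENNReal.ofReal (‖f (x + (2 : ℝ) • h) - f x‖ ^ 2) :=
    ENNReal.measurable_ofReal.comp
      (by fun_prop : Continuous fun x => ‖f (x + (2 : ℝ) • h) - f x‖ ^ 2).measurable
  have ht := lintegral_add_right_eq_self (μ := volume)
    (fun x => ENNReal.ofReal (‖f (x + h) - f x‖ ^ 2)) h
  rw [← lintegral_add_left hm2]
  have e : ∀ x, ENNReal.ofReal (‖f (x + (2 : ℝ) • h) - f x‖ ^ 2) +
      ENNReal.ofReal (‖secondDiff f h x‖ ^ 2) =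
      2 * ENNReal.ofReal (‖f (x + h) - f x‖ ^ 2) +
      2 * ENNReal.ofReal (‖f (x + h + h) - f (x + h)‖ ^ 2) := by
    intro x
    have h2 : x + (2 : ℝ) • h = x + h + h := by rw [two_smul, add_assoc]
    have two : ∀ a : ℝ, 2 * ENNReal.ofReal a = ENNReal.ofReal (2 * a) := fun a => by
      rw [ENNReal.ofReal_mul (by norm_num)]; simp
    rw [secondDiff, h2, ← mul_add, ← ENNReal.ofReal_add (by positivity) (by positivity),
      ← ENNReal.ofReal_add (by positivity) (by positivity), two]
    congr 1
    have p := parallelogram_law_with_norm ℝ (f (x + h + h) - f (x + h)) (f (x + h) - f x)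
    have e1 : f (x + h + h) - f (x + h) + (f (x + h) - f x) = f (x + h + h) - f x := by abel
    have e2 : f (x + h + h) - f (x + h) - (f (x + h) - f x) =
      f (x + h + h) - (2 : ℝ) • f (x + h) + f x := by rw [two_smul]; abel
    rw [e1, e2] at p
    linarith
  have hm3 : Measurable fun x => ENNReal.ofReal (‖f (x + h + h) - f (x + h)‖ ^ 2) :=
    hm.comp (measurable_add_const h)
  simp_rw [e]
  rw [lintegral_add_left (hm.const_mul 2), lintegral_const_mul _ hm,
    lintegral_const_mul _ hm3, ht, ← add_mul]
  norm_num

/-- Telescoping bound for the second differences. -/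
theorem tsum_secondDiff_le {f : EuclideanSpace ℝ (Fin n) → Y} {M : ℝ≥0} (hf : LipschitzWith M f)
    {R : ℝ} (hsupp : ∀ x, R ≤ ‖x‖ → f x = 0) (e : EuclideanSpace ℝ (Fin n)) (j : ℤ) :
    ∑' i : ℕ, ENNReal.ofReal (4 ^ (j + i : ℤ)) *
      ∫⁻ x, ENNReal.ofReal (‖secondDiff f ((2 : ℝ) ^ (-(j + i + 1 : ℤ)) • e) x‖ ^ 2) ≤
    ENNReal.ofReal ((M * ‖e‖) ^ 2) * volume (ball (0 : EuclideanSpace ℝ (Fin n))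
      (R + 2 ^ (-j) * ‖e‖)) := by
  set Φ : ℤ → ℝ≥0∞ := fun k => ENNReal.ofReal (4 ^ k) *
    ∫⁻ x, ENNReal.ofReal (‖f (x + (2 : ℝ) ^ (-k) • e) - f x‖ ^ 2) with hΦ
  set S : ℤ → ℝ≥0∞ := fun k => ENNReal.ofReal (4 ^ k) *
    ∫⁻ x, ENNReal.ofReal (‖secondDiff f ((2 : ℝ) ^ (-(k + 1)) • e) x‖ ^ 2) with hS
  have step : ∀ k, Φ k + S k = Φ (k + 1) := by
    intro k
    have h1 := lintegral_secondDiff hf.continuous ((2 : ℝ) ^ (-(k + 1)) • e)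
    have h2 : (2 : ℝ) • (2 : ℝ) ^ (-(k + 1)) • e = (2 : ℝ) ^ (-k) • e := by
      rw [smul_smul]; congr 1
      rw [neg_add, zpow_add₀ (by norm_num)]; norm_num; ring
    rw [h2] at h1
    simp only [hΦ, hS]
    rw [← mul_add, h1, ← mul_assoc]
    congr 1
    rw [zpow_add₀ (by norm_num), ENNReal.ofReal_mul (by positivity)]
    norm_num
  have tel : ∀ t : ℕ, ∑ i ∈ Finset.range t, S (j + i) ≤ Φ (j + t) := by
    intro t
    induction t with
    | zero => simp
    | succ t ih =>
      rw [Finset.sum_range_succ]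
      push_cast
      rw [← add_assoc, ← step]
      gcongr
  have hb : ∀ t : ℕ, Φ (j + t) ≤ ENNReal.ofReal ((M * ‖e‖) ^ 2) *
      volume (ball (0 : EuclideanSpace ℝ (Fin n)) (R + 2 ^ (-j) * ‖e‖)) := by
    intro t
    simp only [hΦ]
    set k : ℤ := j + t
    set B := ball (0 : EuclideanSpace ℝ (Fin n)) (R + 2 ^ (-j) * ‖e‖) with hB
    have hk : (0 : ℝ) < 2 ^ (-k) := by positivity
    have hkj : (2 : ℝ) ^ (-k) ≤ 2 ^ (-j) := zpow_neg_le_of_le (by omega)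
    have hpt : ∀ x, ENNReal.ofReal (‖f (x + (2 : ℝ) ^ (-k) • e) - f x‖ ^ 2) ≤
        B.indicator (fun _ => ENNReal.ofReal ((M * (2 ^ (-k) * ‖e‖)) ^ 2)) x := by
      intro x
      by_cases hx : x ∈ B
      · rw [indicator_of_mem hx]
        gcongr
        have := hf.norm_sub_le (x + (2 : ℝ) ^ (-k) • e) x
        rw [add_sub_cancel_left, norm_smul, Real.norm_of_nonneg hk.le] at this
        exact this
      · rw [indicator_of_notMem hx]
        rw [hB, mem_ball_zero_iff, not_lt] at hx
        have hke : 2 ^ (-k) * ‖e‖ ≤ 2 ^ (-j) * ‖e‖ := by gcongr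
        have hke0 : 0 ≤ 2 ^ (-j) * ‖e‖ := by positivity
        have h1 : f x = 0 := hsupp x (by linarith)
        have h2 : f (x + (2 : ℝ) ^ (-k) • e) = 0 := by
          apply hsupp
          have := norm_sub_le (x + (2 : ℝ) ^ (-k) • e) ((2 : ℝ) ^ (-k) • e)
          rw [add_sub_cancel_right, norm_smul, Real.norm_of_nonneg hk.le] at this
          linarith
        rw [h1, h2]; simp
    calc ENNReal.ofReal (4 ^ k) * ∫⁻ x, ENNReal.ofReal (‖f (x + (2 : ℝ) ^ (-k) • e) - f x‖ ^ 2)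
        ≤ ENNReal.ofReal (4 ^ k) *
          (ENNReal.ofReal ((M * (2 ^ (-k) * ‖e‖)) ^ 2) * volume B) := by
          gcongr
          refine (lintegral_mono hpt).trans (le_of_eq ?_)
          rw [lintegral_indicator_const measurableSet_ball]
      _ = ENNReal.ofReal ((M * ‖e‖) ^ 2) * volume B := by
          rw [← mul_assoc, ← ENNReal.ofReal_mul (by positivity)]
          congr 2
          have : (4 : ℝ) ^ k * (2 ^ (-k)) ^ 2 = 1 := by
            rw [zpow_neg, show (4 : ℝ) = 2 * 2 by norm_num, mul_zpow]
            field_simp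
          calc _ = ((4 : ℝ) ^ k * (2 ^ (-k)) ^ 2) * (M * ‖e‖) ^ 2 := by ring
            _ = _ := by rw [this, one_mul]
  rw [ENNReal.tsum_eq_iSup_nat]
  exact iSup_le fun t => (tel t).trans (hb t)

end SecondDifferences

section AlmostAffine

variable {n : ℕ} {Y : Type*} [NormedAddCommGroup Y] [InnerProductSpace ℝ Y]

/-- An approximately additive map on a box of the integer lattice is approximately linear. -/
theorem norm_sub_sum_le_of_almost_additive {G : (Fin n → ℤ) → Y} {κ : ℝ} (hκ : 0 ≤ κ) {B : ℤ}
    (hB : 1 ≤ B) (h0 : G 0 = 0)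
    (hG : ∀ a b, (∀ i, |a i| ≤ B) → (∀ i, |b i| ≤ B) → ‖G (a + b) - G a - G b‖ ≤ κ)
    (a : Fin n → ℤ) (ha : ∀ i, |a i| ≤ B) :
    ‖G a - ∑ i, (a i : ℝ) • G (Pi.single i 1)‖ ≤ 2 * κ * (∑ i, (a i).natAbs : ℕ) := by
  set ℓ : (Fin n → ℤ) → Y := fun a => ∑ i, (a i : ℝ) • G (Pi.single i 1) with hℓ
  have hadd : ∀ a b, ℓ (a + b) = ℓ a + ℓ b := by
    intro a b
    simp only [hℓ, Pi.add_apply, Int.cast_add, add_smul, Finset.sum_add_distrib]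
  have hsing : ∀ i, ℓ (Pi.single i 1) = G (Pi.single i 1) := by
    intro i
    simp only [hℓ]
    rw [Finset.sum_eq_single i]
    · simp
    · intro j _ hj; simp [hj]
    · simp
  have hbs : ∀ i j, |(Pi.single i 1 : Fin n → ℤ) j| ≤ B := by
    intro i j
    by_cases h : j = i
    · subst h; simpa using hB
    · simp [h]; omega
  have hstep : ∀ i, ∀ ε : ℤ, ε = 1 ∨ ε = -1 → ‖G (Pi.single i ε) - ℓ (Pi.single i ε)‖ ≤ κ := by
    intro i ε hε
    rcases hε with rfl | rfl
    · rw [hsing, sub_self, norm_zero]; exact hκ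
    · have h1 := hG (Pi.single i 1) (Pi.single i (-1)) (hbs i)
        (fun j => by rw [Pi.single_neg, Pi.neg_apply, abs_neg]; exact hbs i j)
      have h2 : (Pi.single i 1 : Fin n → ℤ) + Pi.single i (-1) = 0 := by
        rw [Pi.single_neg]; simp
      have h3 := hadd (Pi.single i 1) (Pi.single i (-1))
      rw [h2] at h1 h3
      have h4 : ℓ 0 = 0 := by simp [hℓ]
      rw [h4, hsing] at h3
      have h5 : ℓ (Pi.single i (-1)) = - G (Pi.single i 1) := (neg_eq_of_add_eq_zero_right h3.symm).symm
      have h6 : G (Pi.single i (-1)) - -G (Pi.single i 1) =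
          -(G 0 - G (Pi.single i 1) - G (Pi.single i (-1))) := by rw [h0]; abel
      rw [h5, h6, norm_neg]
      exact h1
  suffices H : ∀ N : ℕ, ∀ a : Fin n → ℤ, (∀ i, |a i| ≤ B) → ∑ i, (a i).natAbs = N →
      ‖G a - ℓ a‖ ≤ 2 * κ * N from H _ a ha rfl
  intro N
  induction N with
  | zero =>
    intro a _ hN
    have : a = 0 := by
      ext i
      have := (Finset.sum_eq_zero_iff.mp hN) i (Finset.mem_univ i)
      simpa using this
    subst this
    simp [h0, hℓ]
  | succ N ih =>
    intro a ha hN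
    obtain ⟨i, hi⟩ : ∃ i, a i ≠ 0 := by
      by_contra! h
      simp [h] at hN
    obtain ⟨ε, hε, hε2⟩ : ∃ ε : ℤ, (ε = 1 ∨ ε = -1) ∧ (a i - ε).natAbs + 1 = (a i).natAbs := by
      rcases lt_or_gt_of_ne hi with h | h
      · exact ⟨-1, Or.inr rfl, by omega⟩
      · exact ⟨1, Or.inl rfl, by omega⟩
    set b : Fin n → ℤ := Function.update a i (a i - ε) with hb
    have hab : a = b + Pi.single i ε := by
      ext j
      by_cases h : j = i
      · subst h; simp [hb]
      · simp [hb, h]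
    have hbB : ∀ j, |b j| ≤ B := by
      intro j
      by_cases h : j = i
      · subst h
        have := ha j
        simp only [hb, Function.update_self]
        rw [Int.abs_eq_natAbs] at this ⊢
        omega
      · simpa [hb, h] using ha j
    have hbN : ∑ j, (b j).natAbs = N := by
      have h1 := Finset.add_sum_erase Finset.univ (fun j => (b j).natAbs) (Finset.mem_univ i)
      have h2 := Finset.add_sum_erase Finset.univ (fun j => (a j).natAbs) (Finset.mem_univ i)
      have h3 : ∑ j ∈ Finset.univ.erase i, (b j).natAbs = ∑ j ∈ Finset.univ.erase i, (a j).natAbs := by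
        apply Finset.sum_congr rfl
        intro j hj
        simp [hb, Finset.ne_of_mem_erase hj]
      have h4 : b i = a i - ε := by simp [hb]
      simp only [h4] at h1
      omega
    have hεB : ∀ j, |(Pi.single i ε : Fin n → ℤ) j| ≤ B := by
      intro j
      rcases hε with rfl | rfl
      · exact hbs i j
      · rw [Pi.single_neg, Pi.neg_apply, abs_neg]; exact hbs i j
    have e : G a - ℓ a = (G (b + Pi.single i ε) - G b - G (Pi.single i ε)) + (G b - ℓ b) +
        (G (Pi.single i ε) - ℓ (Pi.single i ε)) := by
      rw [hab, hadd]; abel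
    rw [e]
    refine (norm_add₃_le).trans ?_
    have h1 := hG b _ hbB hεB
    have h2 := ih b hbB hbN
    have h3 := hstep i ε hε
    push_cast
    linarith

/-- The lattice vector with integer coordinates `a`. -/
def latticeVec (a : Fin n → ℤ) : EuclideanSpace ℝ (Fin n) := WithLp.toLp 2 fun i => (a i : ℝ)

/-- A Lipschitz map with small second differences on a fine lattice is almost linear. -/
theorem exists_linear_of_secondDiff (n : ℕ) (M τ Λ : ℝ) (hM : 0 ≤ M) (hτ : 0 < τ) :
    ∃ (m : ℕ) (B : ℤ) (κ : ℝ), 1 ≤ m ∧ 0 < κ ∧ ∀ g : EuclideanSpace ℝ (Fin n) → Y,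
      (∀ x y, ‖g x - g y‖ ≤ M * ‖x - y‖) → g 0 = 0 →
      (∀ a b : Fin n → ℤ, (∀ i, |a i| ≤ B) → (∀ i, |b i| ≤ B) →
        ‖secondDiff g ((2 : ℝ) ^ (-(m : ℤ)) • latticeVec b) ((2 : ℝ) ^ (-(m : ℤ)) • latticeVec a)‖
          ≤ κ) →
      ∃ L : EuclideanSpace ℝ (Fin n) →ₗ[ℝ] Y, ∀ v, ‖v‖ ≤ Λ → ‖g v - L v‖ ≤ τ := by
  obtain ⟨m, hm1, hm⟩ : ∃ m : ℕ, 1 ≤ m ∧ 2 * M * n * (2 : ℝ) ^ (-(m : ℤ)) ≤ τ / 2 := by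
    obtain ⟨m, hm⟩ := exists_pow_lt_of_lt_one (y := (1 / 2 : ℝ))
      (show 0 < τ / 2 / (2 * M * n + 1) by positivity) (by norm_num)
    refine ⟨m + 1, by omega, ?_⟩
    have h1 : (2 : ℝ) ^ (-((m + 1 : ℕ) : ℤ)) ≤ (1 / 2) ^ m := by
      rw [zpow_neg, zpow_natCast, one_div, inv_pow]
      gcongr <;> norm_num
    rw [lt_div_iff₀ (by positivity)] at hm
    have : 0 ≤ 2 * M * n := by positivity
    have h2 : (0 : ℝ) < (1 / 2) ^ m := by positivity
    nlinarith
  set s : ℝ := (2 : ℝ) ^ (-(m : ℤ)) with hs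
  have hs0 : 0 < s := by positivity
  set B' : ℤ := ⌈|Λ| / s⌉ + 1 with hB'
  have hB'1 : 1 ≤ B' := by
    have : 0 ≤ ⌈|Λ| / s⌉ := Int.ceil_nonneg (by positivity)
    omega
  have hB'0 : (0 : ℝ) < B' := by exact_mod_cast (by omega : 0 < B')
  refine ⟨m, 2 * B', τ / (8 * (n * B') + 1), hm1, by positivity, ?_⟩
  set κ : ℝ := τ / (8 * (n * B') + 1) with hκ
  have hκ0 : 0 < κ := by positivity
  have hκ1 : 4 * κ * (n * B') ≤ τ / 2 := by
    have : κ * (8 * (n * B') + 1) = τ := by rw [hκ]; field_simp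
    nlinarith
  intro g hg g0 hsd
  set G : (Fin n → ℤ) → Y := fun a => g (s • latticeVec a) with hGdef
  have hla : ∀ a b : Fin n → ℤ, latticeVec (a + b) = latticeVec a + latticeVec b := by
    intro a b; ext i; simp [latticeVec]
  have hl0 : latticeVec (0 : Fin n → ℤ) = 0 := by ext i; simp [latticeVec]
  have hG0 : G 0 = 0 := by simp [hGdef, hl0, g0]
  have hsd' : ∀ a b : Fin n → ℤ, (∀ i, |a i| ≤ 2 * B') → (∀ i, |b i| ≤ 2 * B') →
      ‖G (a + b + b) - (2 : ℝ) • G (a + b) + G a‖ ≤ κ := by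
    intro a b ha hb
    have := hsd a b ha hb
    rw [secondDiff, two_smul] at this
    simp only [hGdef, hla, smul_add]
    rwa [add_assoc]
  have hadd : ∀ a b, (∀ i, |a i| ≤ B') → (∀ i, |b i| ≤ B') → ‖G (a + b) - G a - G b‖ ≤ 2 * κ := by
    intro a b ha hb
    have z : ∀ i, |(0 : Fin n → ℤ) i| ≤ 2 * B' := fun i => by simp; omega
    have h1 := hsd' (a + a) (b - a) (fun i => by
      have := ha i; rw [Pi.add_apply]; rw [abs_le] at this ⊢; omega) (fun i => by
      have := ha i; have := hb i; rw [Pi.sub_apply]; rw [abs_le] at *; omega)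
    have h2 := hsd' 0 a z (fun i => by have := ha i; omega)
    have h3 := hsd' 0 b z (fun i => by have := hb i; omega)
    rw [show a + a + (b - a) + (b - a) = b + b by abel, show a + a + (b - a) = a + b by abel] at h1
    rw [zero_add, hG0, add_zero] at h2 h3
    have e : (2 : ℝ) • (G (a + b) - G a - G b) = -(G (b + b) - (2 : ℝ) • G (a + b) + G (a + a)) +
        (G (a + a) - (2 : ℝ) • G a) + (G (b + b) - (2 : ℝ) • G b) := by
      simp only [smul_sub]; abel
    have h4 : ‖(2 : ℝ) • (G (a + b) - G a - G b)‖ ≤ κ + κ + κ := by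
      rw [e]
      refine norm_add₃_le.trans ?_
      rw [norm_neg]
      gcongr
    rw [norm_smul] at h4
    norm_num at h4
    linarith
  refine ⟨∑ i, ((EuclideanSpace.proj i : EuclideanSpace ℝ (Fin n) →L[ℝ] ℝ).toLinearMap).smulRight
    (s⁻¹ • G (Pi.single i 1)), ?_⟩
  intro v hv
  have hL : ∀ w : EuclideanSpace ℝ (Fin n), (∑ i, ((EuclideanSpace.proj i :
      EuclideanSpace ℝ (Fin n) →L[ℝ] ℝ).toLinearMap).smulRight (s⁻¹ • G (Pi.single i 1))) w =
      ∑ i, (w i / s) • G (Pi.single i 1) := by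
    intro w
    simp [LinearMap.sum_apply, smul_smul, div_eq_mul_inv]
  rw [hL]
  set a : Fin n → ℤ := fun i => ⌊v i / s⌋ with ha
  have hfl : ∀ i, |v i / s - a i| ≤ 1 := by
    intro i
    rw [abs_le]
    have := Int.floor_le (v i / s)
    have := Int.lt_floor_add_one (v i / s)
    simp only [ha]
    constructor <;> linarith
  have hvi : ∀ i, |v i| ≤ |Λ| := fun i =>
    (by simpa using PiLp.norm_apply_le v i : |v i| ≤ ‖v‖).trans (hv.trans (le_abs_self _))
  have haB : ∀ i, |a i| ≤ B' := by
    intro i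
    have h1 : |(a i : ℝ)| ≤ |Λ| / s + 1 := by
      have h2 := abs_sub_abs_le_abs_sub (a i : ℝ) (v i / s)
      rw [abs_sub_comm] at h2
      have h3 := hfl i
      have h4 : |v i / s| ≤ |Λ| / s := by
        rw [abs_div, abs_of_pos hs0]; exact div_le_div_of_nonneg_right (hvi i) hs0.le
      linarith
    have h2 : |Λ| / s + 1 ≤ (B' : ℝ) := by
      rw [hB']; push_cast
      gcongr
      exact Int.le_ceil _
    exact_mod_cast h1.trans h2
  have hsing : ∀ i, ‖G (Pi.single i 1)‖ ≤ M * s := by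
    intro i
    have h1 := hg (s • latticeVec (Pi.single i 1)) 0
    rw [g0, sub_zero, sub_zero, norm_smul, Real.norm_of_nonneg hs0.le] at h1
    have h2 : latticeVec (Pi.single i 1 : Fin n → ℤ) = EuclideanSpace.single i (1 : ℝ) := by
      ext j
      by_cases h : j = i
      · subst h; simp [latticeVec]
      · simp [latticeVec, h]
    rw [h2] at h1
    simpa [hGdef, h2] using h1
  have hdist : ‖v - s • latticeVec a‖ ≤ n * s := by
    have h1 : v - s • latticeVec a = ∑ i, EuclideanSpace.single i ((v i / s - a i) * s) := by
      ext j
      rw [WithLp.ofLp_sum, Finset.sum_apply]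
      simp [latticeVec, Pi.single_apply]
      field_simp
    rw [h1]
    refine (norm_sum_le _ _).trans ?_
    calc _ ≤ ∑ i : Fin n, s := by
          refine Finset.sum_le_sum fun i _ => ?_
          rw [EuclideanSpace.norm_single, Real.norm_eq_abs, abs_mul, abs_of_pos hs0]
          have := hfl i
          nlinarith
      _ = _ := by simp
  have h1 : ‖g v - G a‖ ≤ M * (n * s) := (hg _ _).trans (by gcongr)
  have h2 : ‖G a - ∑ i, (a i : ℝ) • G (Pi.single i 1)‖ ≤ τ / 2 := by
    refine (norm_sub_sum_le_of_almost_additive (by positivity) hB'1 hG0 hadd a haB).trans ?_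
    have : ((∑ i, (a i).natAbs : ℕ) : ℝ) ≤ n * B' := by
      push_cast
      calc ∑ i, ((a i).natAbs : ℝ) ≤ ∑ i : Fin n, (B' : ℝ) := by
            refine Finset.sum_le_sum fun i _ => ?_
            have := haB i
            rw [Int.abs_eq_natAbs] at this
            rw [← Int.cast_natCast]
            exact Int.cast_le.2 this
        _ = _ := by simp
    calc _ ≤ 2 * (2 * κ) * (n * B' : ℝ) := by gcongr
      _ ≤ _ := by linarith
  have h3 : ‖(∑ i, (a i : ℝ) • G (Pi.single i 1)) - ∑ i, (v i / s) • G (Pi.single i 1)‖ ≤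
      n * (M * s) := by
    rw [← Finset.sum_sub_distrib]
    refine (norm_sum_le _ _).trans ?_
    calc _ ≤ ∑ i : Fin n, M * s := by
          refine Finset.sum_le_sum fun i _ => ?_
          rw [← sub_smul, norm_smul, Real.norm_eq_abs, abs_sub_comm]
          have := hfl i
          have := hsing i
          have : 0 ≤ M * s := by positivity
          nlinarith [norm_nonneg (G (Pi.single i 1)), abs_nonneg (v i / s - a i)]
      _ = _ := by simp
  have e : g v - ∑ i, (v i / s) • G (Pi.single i 1) = (g v - G a) +
      (G a - ∑ i, (a i : ℝ) • G (Pi.single i 1)) +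
      ((∑ i, (a i : ℝ) • G (Pi.single i 1)) - ∑ i, (v i / s) • G (Pi.single i 1)) := by abel
  rw [e]
  refine norm_add₃_le.trans ?_
  have : 2 * M * n * s = M * (n * s) + n * (M * s) := by ring
  linarith

/-- Packing of the scales at which a compactly supported Lipschitz map is not almost affine. -/
theorem exists_nonaffine_packing (n : ℕ) (τ Λ : ℝ) (M : ℝ≥0) (hτ : 0 < τ) :
    ∃ A : ℝ≥0∞, A ≠ ⊤ ∧ ∀ (f : EuclideanSpace ℝ (Fin n) → Y) (R : ℝ) (j : ℤ),
      LipschitzWith M f → (∀ x, R ≤ ‖x‖ → f x = 0) → (2 : ℝ) ^ (-j) ≤ R →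
      ∃ U : ℤ → Set (EuclideanSpace ℝ (Fin n)), (∀ k, MeasurableSet (U k)) ∧
        (∀ k, ∀ u ∉ U k, ∃ L : EuclideanSpace ℝ (Fin n) →ₗ[ℝ] Y, ∀ v, dist v u ≤ Λ * 2 ^ (-k) →
          ‖f v - f u - L (v - u)‖ ≤ τ * 2 ^ (-k)) ∧
        ∑' i : ℕ, volume (U (j + i)) ≤ A * ENNReal.ofReal (R ^ n) := by
  obtain ⟨m, B, κ, hm1, hκ, key⟩ := exists_linear_of_secondDiff (Y := Y) n M τ Λ M.2 hτ
  obtain ⟨C, hC⟩ := exists_adMeas_volume n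
  set I : Finset (Fin n → ℤ) := Finset.Icc (fun _ => -B) (fun _ => B) with hI
  have hmI : ∀ a : Fin n → ℤ, a ∈ I ↔ ∀ i, |a i| ≤ B := by
    intro a
    simp only [hI, Finset.mem_Icc, Pi.le_def, abs_le]
    exact ⟨fun h i => ⟨h.1 i, h.2 i⟩, fun h => ⟨fun i => (h i).1, fun i => (h i).2⟩⟩
  refine ⟨∑ a ∈ I, ∑ b ∈ I, ENNReal.ofReal ((κ ^ 2)⁻¹) * (ENNReal.ofReal ((M * ‖latticeVec b‖) ^ 2) *
    ENNReal.ofReal (C * (1 + ‖latticeVec b‖) ^ n)), 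
    ENNReal.sum_ne_top.2 fun a _ => ENNReal.sum_ne_top.2 fun b _ => by finiteness, ?_⟩
  intro f R j hf hsupp hjR
  have hR : 0 < R := lt_of_lt_of_le (by positivity) hjR
  set W : ℤ → (Fin n → ℤ) → (Fin n → ℤ) → Set (EuclideanSpace ℝ (Fin n)) := fun k a b =>
    {u | κ * 2 ^ (-k) < ‖secondDiff f ((2 : ℝ) ^ (-(k + m)) • latticeVec b)
      ((2 : ℝ) ^ (-(k + m)) • latticeVec a + u)‖} with hW
  have hfc := hf.continuous
  have hsc : ∀ h, Continuous (secondDiff f h) := fun h => by unfold secondDiff; fun_prop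
  refine ⟨fun k => ⋃ a ∈ I, ⋃ b ∈ I, W k a b, ?_, ?_, ?_⟩
  · intro k
    refine Finset.measurableSet_biUnion _ fun a _ => Finset.measurableSet_biUnion _ fun b _ => ?_
    have := hsc ((2 : ℝ) ^ (-(k + m)) • latticeVec b)
    exact (isOpen_lt continuous_const (by fun_prop)).measurableSet
  · intro k u hu
    simp only [mem_iUnion, not_exists, hW, mem_ofPred_eq, not_lt] at hu
    have hk : (0 : ℝ) < 2 ^ (-k) := by positivity
    have hkk : (2 : ℝ) ^ k * 2 ^ (-k) = 1 := by rw [← zpow_add₀ (by norm_num)]; simp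
    set g : EuclideanSpace ℝ (Fin n) → Y := fun x =>
      (2 : ℝ) ^ k • (f (u + (2 : ℝ) ^ (-k) • x) - f u) with hg
    obtain ⟨L, hL⟩ := key g (by
      intro x y
      simp only [hg]
      rw [← smul_sub, norm_smul, sub_sub_sub_cancel_right, Real.norm_of_nonneg (by positivity)]
      have := hf.norm_sub_le (u + (2 : ℝ) ^ (-k) • x) (u + (2 : ℝ) ^ (-k) • y)
      rw [add_sub_add_left_eq_sub, ← smul_sub, norm_smul, Real.norm_of_nonneg hk.le] at this
      calc _ ≤ (2 : ℝ) ^ k * (M * (2 ^ (-k) * ‖x - y‖)) := by gcongr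
        _ = ((2 : ℝ) ^ k * 2 ^ (-k)) * (M * ‖x - y‖) := by ring
        _ = _ := by rw [hkk, one_mul]) (by simp [hg]) (by
      intro a b ha hb
      have h1 := hu a ((hmI a).2 ha) b ((hmI b).2 hb)
      have h2 : secondDiff g ((2 : ℝ) ^ (-(m : ℤ)) • latticeVec b)
          ((2 : ℝ) ^ (-(m : ℤ)) • latticeVec a) = (2 : ℝ) ^ k •
          secondDiff f ((2 : ℝ) ^ (-(k + m)) • latticeVec b)
            ((2 : ℝ) ^ (-(k + m)) • latticeVec a + u) := by
        have h3 : (2 : ℝ) ^ (-(k + m)) = 2 ^ (-k) * 2 ^ (-(m : ℤ)) := by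
          rw [← zpow_add₀ (by norm_num)]; congr 1; ring
        simp only [secondDiff, hg, h3, smul_add, smul_sub, mul_smul]
        rw [smul_comm (2 : ℝ) ((2 : ℝ) ^ (-k)), add_comm _ u, ← add_assoc, ← add_assoc,
          smul_comm (2 : ℝ) ((2 : ℝ) ^ k) (f _), smul_comm (2 : ℝ) ((2 : ℝ) ^ k) (f _),
          two_smul ℝ (f u), smul_add]
        abel
      rw [h2, norm_smul, Real.norm_of_nonneg (by positivity)]
      calc _ ≤ (2 : ℝ) ^ k * (κ * 2 ^ (-k)) := by gcongr
        _ = ((2 : ℝ) ^ k * 2 ^ (-k)) * κ := by ring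
        _ = _ := by rw [hkk, one_mul])
    refine ⟨L, fun v hv => ?_⟩
    have h1 := hL ((2 : ℝ) ^ k • (v - u)) (by
      rw [norm_smul, Real.norm_of_nonneg (by positivity), ← dist_eq_norm]
      calc _ ≤ (2 : ℝ) ^ k * (Λ * 2 ^ (-k)) := by gcongr
        _ = ((2 : ℝ) ^ k * 2 ^ (-k)) * Λ := by ring
        _ = _ := by rw [hkk, one_mul])
    simp only [hg] at h1
    rw [smul_smul, mul_comm ((2 : ℝ) ^ (-k)), hkk, one_smul, add_sub_cancel, map_smul, ← smul_sub,
      norm_smul, Real.norm_of_nonneg (by positivity)] at h1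
    calc _ = ((2 : ℝ) ^ k * 2 ^ (-k)) * ‖f v - f u - L (v - u)‖ := by rw [hkk, one_mul]
      _ = 2 ^ (-k) * ((2 : ℝ) ^ k * ‖f v - f u - L (v - u)‖) := by ring
      _ ≤ 2 ^ (-k) * τ := by gcongr
      _ = _ := mul_comm _ _
  · have hWm : ∀ k a b, volume (W k a b) ≤ ENNReal.ofReal ((κ ^ 2)⁻¹) * (ENNReal.ofReal (4 ^ k) *
        ∫⁻ x, ENNReal.ofReal (‖secondDiff f ((2 : ℝ) ^ (-(k + m)) • latticeVec b) x‖ ^ 2)) := by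
      intro k a b
      have h1 : volume (W k a b) = volume {x | κ * 2 ^ (-k) <
          ‖secondDiff f ((2 : ℝ) ^ (-(k + m)) • latticeVec b) x‖} :=
        measure_preimage_add volume ((2 : ℝ) ^ (-(k + m)) • latticeVec a)
          {x | κ * 2 ^ (-k) < ‖secondDiff f ((2 : ℝ) ^ (-(k + m)) • latticeVec b) x‖}
      have h2 := mul_meas_ge_le_lintegral (μ := (volume : Measure (EuclideanSpace ℝ (Fin n))))
        (f := fun x => ENNReal.ofReal
          (‖secondDiff f ((2 : ℝ) ^ (-(k + m)) • latticeVec b) x‖ ^ 2))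
        (ENNReal.measurable_ofReal.comp ((hsc _).norm.pow 2).measurable)
        (ENNReal.ofReal ((κ * 2 ^ (-k)) ^ 2))
      have hkk : (4 : ℝ) ^ k * (2 ^ (-k)) ^ 2 = 1 := by
        rw [zpow_neg, show (4 : ℝ) = 2 * 2 by norm_num, mul_zpow]
        field_simp
      rw [h1, ← mul_assoc, ← ENNReal.ofReal_mul (by positivity)]
      calc volume {x | κ * 2 ^ (-k) < ‖secondDiff f ((2 : ℝ) ^ (-(k + m)) • latticeVec b) x‖}
          = ENNReal.ofReal ((κ ^ 2)⁻¹ * 4 ^ k) * (ENNReal.ofReal ((κ * 2 ^ (-k)) ^ 2) *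
            volume {x | κ * 2 ^ (-k) <
              ‖secondDiff f ((2 : ℝ) ^ (-(k + m)) • latticeVec b) x‖}) := by
            rw [← mul_assoc, ← ENNReal.ofReal_mul (by positivity)]
            have : (κ ^ 2)⁻¹ * 4 ^ k * (κ * 2 ^ (-k)) ^ 2 = 1 := by
              calc _ = ((κ ^ 2)⁻¹ * κ ^ 2) * ((4 : ℝ) ^ k * (2 ^ (-k)) ^ 2) := by ring
                _ = _ := by rw [hkk, inv_mul_cancel₀ (by positivity), one_mul]
            rw [this, ENNReal.ofReal_one, one_mul]
        _ ≤ _ := by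
            gcongr
            refine le_trans ?_ h2
            gcongr
            exact fun hx => ENNReal.ofReal_le_ofReal (by gcongr)
    have hsum : ∀ b : Fin n → ℤ, ∑' i : ℕ, ENNReal.ofReal (4 ^ (j + i : ℤ)) *
        ∫⁻ x, ENNReal.ofReal (‖secondDiff f ((2 : ℝ) ^ (-(j + i + m : ℤ)) • latticeVec b) x‖ ^ 2) ≤
        ENNReal.ofReal ((M * ‖latticeVec b‖) ^ 2) *
          (ENNReal.ofReal (C * (1 + ‖latticeVec b‖) ^ n) * ENNReal.ofReal (R ^ n)) := by
      intro b
      refine le_trans ?_ ((tsum_secondDiff_le hf hsupp (latticeVec b) (j + m - 1)).trans ?_)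
      · refine ENNReal.tsum_le_tsum fun i => ?_
        rw [show (j + m - 1 + i + 1 : ℤ) = j + i + m by ring]
        gcongr
        · norm_num
        · omega
      · gcongr
        refine (hC.upper _ _ ?_).trans ?_
        · positivity
        rw [← ENNReal.ofReal_mul (by have := hC.pos; positivity)]
        have := hC.pos
        rw [mul_assoc C, ← mul_pow]
        gcongr
        have h3 : (2 : ℝ) ^ (-(j + m - 1)) ≤ R :=
          (zpow_neg_le_of_le (by omega)).trans hjR
        nlinarith [norm_nonneg (latticeVec b)]
    calc ∑' i : ℕ, volume (⋃ a ∈ I, ⋃ b ∈ I, W (j + i) a b)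
        ≤ ∑' i : ℕ, ∑ a ∈ I, ∑ b ∈ I, volume (W (j + i) a b) := by
          refine ENNReal.tsum_le_tsum fun i => ?_
          refine (measure_biUnion_finset_le _ _).trans ?_
          exact Finset.sum_le_sum fun a _ => measure_biUnion_finset_le _ _
      _ = ∑ a ∈ I, ∑ b ∈ I, ∑' i : ℕ, volume (W (j + i) a b) := by
          rw [Summable.tsum_finsetSum fun _ _ => ENNReal.summable]
          refine Finset.sum_congr rfl fun a _ => ?_
          rw [Summable.tsum_finsetSum fun _ _ => ENNReal.summable]
      _ ≤ ∑ a ∈ I, ∑ b ∈ I, ENNReal.ofReal ((κ ^ 2)⁻¹) *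
          (ENNReal.ofReal ((M * ‖latticeVec b‖) ^ 2) *
          (ENNReal.ofReal (C * (1 + ‖latticeVec b‖) ^ n) * ENNReal.ofReal (R ^ n))) := by
          refine Finset.sum_le_sum fun a _ => Finset.sum_le_sum fun b _ => ?_
          refine (ENNReal.tsum_le_tsum fun i : ℕ => hWm (j + i) a b).trans ?_
          rw [ENNReal.tsum_mul_left]
          gcongr
          exact hsum b
      _ = _ := by
          simp only [Finset.sum_mul, mul_assoc]

end AlmostAffine

theorem exists_volume_eq_hausdorff (n : ℕ) : ∃ c : ℝ≥0, c ≠ 0 ∧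
    ∀ A : Set (EuclideanSpace ℝ (Fin n)), volume A = c * μH[(n : ℝ)] A := by
  refine ⟨_, Measure.addHaarScalarFactor_volume_hausdorffMeasure_ne_zero n, fun A => ?_⟩
  have h := Measure.isAddLeftInvariant_eq_smul (volume : Measure (EuclideanSpace ℝ (Fin n)))
    μH[(n : ℝ)]
  conv_lhs => rw [h]
  rfl

theorem exists_hausdorff_image_le (n : ℕ) : ∃ c : ℝ≥0∞, c ≠ ⊤ ∧
    ∀ (X : Type) [MetricSpace X] [MeasurableSpace X] [BorelSpace X] (M : ℝ≥0)
      (ρ : EuclideanSpace ℝ (Fin n) → X), LipschitzWith M ρ → ∀ A,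
      μH[(n : ℝ)] (ρ '' A) ≤ c * M ^ n * volume A := by
  obtain ⟨c, hc, h⟩ := exists_volume_eq_hausdorff n
  have hc' : (c : ℝ≥0∞) ≠ 0 := by exact_mod_cast hc
  refine ⟨(c : ℝ≥0∞)⁻¹, ENNReal.inv_ne_top.2 hc', ?_⟩
  intro X _ _ _ M ρ hρ A
  refine (hρ.hausdorffMeasure_image_le (Nat.cast_nonneg n) A).trans (le_of_eq ?_)
  rw [h, ENNReal.rpow_natCast, mul_assoc, mul_left_comm, ← mul_assoc (c : ℝ≥0∞)⁻¹,
    ENNReal.inv_mul_cancel hc' ENNReal.coe_ne_top, one_mul]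

theorem exists_volume_le_hausdorff_image (n : ℕ) : ∃ c : ℝ≥0∞, c ≠ ⊤ ∧
    ∀ (X : Type) [MetricSpace X] [MeasurableSpace X] [BorelSpace X] (M : ℝ≥0)
      (ρ : EuclideanSpace ℝ (Fin n) → X) (G : Set (EuclideanSpace ℝ (Fin n))),
      (∀ u ∈ G, ∀ v ∈ G, dist u v ≤ M * dist (ρ u) (ρ v)) →
      volume G ≤ c * M ^ n * μH[(n : ℝ)] (ρ '' G) := by
  obtain ⟨c, hc, h⟩ := exists_volume_eq_hausdorff n
  refine ⟨c, ENNReal.coe_ne_top, ?_⟩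
  intro X _ _ _ M ρ G hG
  set g := Function.invFunOn ρ G with hg
  have hinj : InjOn ρ G := by
    intro u hu v hv huv
    have := hG u hu v hv
    rw [huv, dist_self, mul_zero] at this
    exact dist_le_zero.1 this
  have hlip : LipschitzOnWith M g (ρ '' G) := by
    refine LipschitzOnWith.of_dist_le_mul ?_
    rintro _ ⟨u, hu, rfl⟩ _ ⟨v, hv, rfl⟩
    rw [hg, hinj.leftInvOn_invFunOn hu, hinj.leftInvOn_invFunOn hv]
    exact hG u hu v hv
  have himg : g '' (ρ '' G) = G := hinj.leftInvOn_invFunOn.image_image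
  have := hlip.hausdorffMeasure_image_le (Nat.cast_nonneg n)
  rw [himg, ENNReal.rpow_natCast] at this
  rw [h, mul_assoc]
  gcongr

/-- Where a Lipschitz map is close to a degenerate affine map, the image is small. -/
theorem exists_degenerate_image_le {n : ℕ} {C : ℝ} {E : Set (ES n)} (hE : Regular n C E)
    (M : ℝ≥0) : ∃ A : ℝ≥0∞, A ≠ ⊤ ∧ ∀ (δ : ℝ) (ρ : EuclideanSpace ℝ (Fin n) → ES n)
      (u : EuclideanSpace ℝ (Fin n)) (t : ℝ) (L : EuclideanSpace ℝ (Fin n) →ₗ[ℝ] ES n)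
      (h : EuclideanSpace ℝ (Fin n)), 0 < δ → δ ≤ 1 → LipschitzWith M ρ → 0 < t → ‖h‖ = 1 →
      ‖L h‖ ≤ δ → (∀ v, dist v u ≤ 10 * t → ‖ρ v - ρ u - L (v - u)‖ ≤ δ * t) →
      surfMeasure n E (ρ '' closedBall u (5 * t)) ≤ A * ENNReal.ofReal (δ * t ^ n) := by
  obtain ⟨CV, hV⟩ := exists_adMeas_volume n
  have hC := hE.ad.pos
  have hCV := hV.pos
  refine ⟨ENNReal.ofReal (2 * C * CV ^ 2 * ((M + 4) * 8) ^ n), ENNReal.ofReal_ne_top, ?_⟩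
  intro δ ρ u t L h hδ hδ1 hρ ht hh hLh haff
  have := hE.ad.sigmaFinite
  set J : ℕ := ⌊1 / (2 * δ)⌋₊ with hJ
  have hJ1 : 1 / (2 * δ) ≤ (J + 1 : ℕ) := by push_cast; exact (Nat.lt_floor_add_one _).le
  have hJ2 : ∀ i ∈ Finset.range (J + 1), 2 * i * δ ≤ 1 := by
    intro i hi
    have h1 : (i : ℝ) ≤ J := by exact_mod_cast Nat.lt_succ_iff.1 (Finset.mem_range.1 hi)
    have h2 : (J : ℝ) ≤ 1 / (2 * δ) := Nat.floor_le (by positivity)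
    have h3 := h1.trans h2
    rw [le_div_iff₀ (by positivity)] at h3
    linarith
  have hW : MeasurableSet {p : ES n × EuclideanSpace ℝ (Fin n) |
      dist (ρ p.2) p.1 < (M + 4) * (δ * t)} := by
    have := hρ.continuous
    exact (isOpen_lt (by fun_prop) continuous_const).measurableSet
  have key := double_counting (surfMeasure n E) (volume : Measure (EuclideanSpace ℝ (Fin n))) hW
    (A := ρ '' closedBall u (5 * t)) (Z := ball u (8 * t))
    (m := ENNReal.ofReal (1 / (2 * δ) * (CV⁻¹ * (δ * t) ^ n)))
    (M := ENNReal.ofReal (C * ((M + 4) * (δ * t)) ^ n)) ?_ ?_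
  · have h1 : 0 < 1 / (2 * δ) * (CV⁻¹ * (δ * t) ^ n) := by positivity
    have h2 : ENNReal.ofReal (1 / (2 * δ) * (CV⁻¹ * (δ * t) ^ n)) *
        surfMeasure n E (ρ '' closedBall u (5 * t)) ≤
        ENNReal.ofReal (C * ((M + 4) * (δ * t)) ^ n * (CV * (8 * t) ^ n)) := by
      refine key.trans ?_
      rw [ENNReal.ofReal_mul (p := C * ((M + 4) * (δ * t)) ^ n) (by positivity)]
      exact mul_le_mul_right (hV.upper _ _ (by positivity)) _
    rw [mul_comm, ← ENNReal.le_div_iff_mul_le (Or.inl (ENNReal.ofReal_pos.2 h1).ne')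
      (Or.inl ENNReal.ofReal_ne_top),
      ← ENNReal.ofReal_div_of_pos h1] at h2
    refine h2.trans (le_of_eq ?_)
    rw [← ENNReal.ofReal_mul (by positivity)]
    congr 1
    simp only [mul_pow]
    field_simp
  · rintro _ ⟨v, hv, rfl⟩
    rw [mem_closedBall] at hv
    set p : ℕ → EuclideanSpace ℝ (Fin n) := fun i => v + (2 * i * δ * t) • h with hp
    have hpv : ∀ i ∈ Finset.range (J + 1), dist (p i) v ≤ t := by
      intro i hi
      rw [hp, dist_eq_norm, add_sub_cancel_left, norm_smul, hh, mul_one,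
        Real.norm_of_nonneg (by positivity)]
      have := hJ2 i hi
      nlinarith
    have hρp : ∀ i ∈ Finset.range (J + 1), ‖ρ (p i) - ρ v‖ ≤ 3 * (δ * t) := by
      intro i hi
      have h1 := haff v (by linarith)
      have h2 := haff (p i) (by linarith [dist_triangle (p i) v u, hpv i hi])
      have h3 : ‖L (p i - v)‖ ≤ δ * t := by
        rw [hp, add_sub_cancel_left, map_smul, norm_smul, Real.norm_of_nonneg (by positivity)]
        have h4 := hJ2 i hi
        have h5 : 2 * i * δ * t ≤ t := by nlinarith
        calc _ ≤ t * δ := by gcongr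
          _ = _ := mul_comm _ _
      have e : ρ (p i) - ρ v = (ρ (p i) - ρ u - L (p i - u)) - (ρ v - ρ u - L (v - u)) +
          L (p i - v) := by
        simp only [map_sub]; abel
      rw [e]
      refine (norm_add_le _ _).trans ?_
      have := norm_sub_le (ρ (p i) - ρ u - L (p i - u)) (ρ v - ρ u - L (v - u))
      linarith
    have hsub : (⋃ i ∈ Finset.range (J + 1), ball (p i) (δ * t)) ⊆
        ball u (8 * t) ∩ {w | (ρ v, w) ∈ {p : ES n × EuclideanSpace ℝ (Fin n) |
          dist (ρ p.2) p.1 < (M + 4) * (δ * t)}} := by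
      refine iUnion₂_subset fun i hi w hw => ?_
      rw [mem_ball] at hw
      have hδt : δ * t ≤ t := by nlinarith
      refine ⟨?_, ?_⟩
      · rw [mem_ball]
        have := dist_triangle4 w (p i) v u
        have := hpv i hi
        linarith
      · simp only [mem_ofPred_eq]
        have h1 := hρ.dist_le_mul w (p i)
        have h2 := hρp i hi
        rw [← dist_eq_norm] at h2
        have h3 : (M : ℝ) * dist w (p i) ≤ M * (δ * t) := by gcongr
        have := dist_triangle (ρ w) (ρ (p i)) (ρ v)
        have : 0 < δ * t := by positivity
        linarith
    refine le_trans ?_ (measure_mono hsub)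
    rw [measure_biUnion_finset]
    · calc ENNReal.ofReal (1 / (2 * δ) * (CV⁻¹ * (δ * t) ^ n))
          ≤ (J + 1 : ℕ) * ENNReal.ofReal (CV⁻¹ * (δ * t) ^ n) := by
            rw [← ENNReal.ofReal_natCast, ← ENNReal.ofReal_mul (by positivity)]
            gcongr
        _ = ∑ i ∈ Finset.range (J + 1), ENNReal.ofReal (CV⁻¹ * (δ * t) ^ n) := by simp
        _ ≤ _ := Finset.sum_le_sum fun i _ => hV.lower _ trivial _ (by positivity)
    · intro i _ k _ hik
      apply ball_disjoint_ball
      rw [hp, dist_eq_norm, add_sub_add_left_eq_sub, ← sub_smul, norm_smul, hh, mul_one,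
        Real.norm_eq_abs, show (2 * i * δ * t - 2 * k * δ * t : ℝ) = (i - k) * (2 * (δ * t)) by ring,
        abs_mul, abs_of_pos (by positivity : 0 < 2 * (δ * t))]
      have h1 : (1 : ℝ) ≤ |(i : ℝ) - k| := by
        have h2 : (1 : ℤ) ≤ |(i : ℤ) - k| := Int.one_le_abs (by omega)
        exact_mod_cast h2
      have : 0 < δ * t := by positivity
      nlinarith
    · exact fun i _ => measurableSet_ball
  · intro v _
    refine (measure_mono ?_).trans (hE.ad.upper (ρ v) ((M + 4) * (δ * t)) (by positivity))
    intro x hx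
    rw [mem_ball, dist_comm]
    exact hx

/-- A Vitali covering bound for the image of a set of points having balls with small images. -/
theorem exists_vitali_image_le {n : ℕ} {C : ℝ} {E : Set (ES n)} (_hE : Regular n C E) :
    ∃ A : ℝ≥0∞, A ≠ ⊤ ∧ ∀ (ρ : EuclideanSpace ℝ (Fin n) → ES n)
      (D : Set (EuclideanSpace ℝ (Fin n))) (x₀ : EuclideanSpace ℝ (Fin n)) (r : ℝ) (η : ℝ≥0∞)
      (t : EuclideanSpace ℝ (Fin n) → ℝ), 0 < r → D ⊆ ball x₀ r → (∀ u ∈ D, 0 < t u ∧ t u ≤ r) →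
      (∀ u ∈ D, surfMeasure n E (ρ '' closedBall u (5 * t u)) ≤ η * ENNReal.ofReal (t u ^ n)) →
      surfMeasure n E (ρ '' D) ≤ A * η * ENNReal.ofReal (r ^ n) := by
  obtain ⟨CV, hV⟩ := exists_adMeas_volume n
  have hCV := hV.pos
  refine ⟨ENNReal.ofReal (CV ^ 2 * 2 ^ n), ENNReal.ofReal_ne_top, ?_⟩
  intro ρ D x₀ r η t hr hD ht hη
  obtain ⟨I, hID, hdis, hcov⟩ := Vitali.exists_disjoint_subfamily_covering_enlargement_closedBall
    D (fun u => u) t r (fun u hu => (ht u hu).2) 5 (by norm_num)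
  have hIc : I.Countable := hdis.countable_of_nonempty_interior fun u hu =>
    ⟨u, ball_subset_interior_closedBall (mem_ball_self (ht u (hID hu)).1)⟩
  have := hIc.to_subtype
  have h1 : ρ '' D ⊆ ⋃ b ∈ I, ρ '' closedBall b (5 * t b) := by
    rintro _ ⟨u, hu, rfl⟩
    obtain ⟨b, hb, hsub⟩ := hcov u hu
    exact mem_iUnion₂.2 ⟨b, hb, u, hsub (mem_closedBall_self (ht u hu).1.le), rfl⟩
  have h2 : ∑' b : I, volume (closedBall (b : EuclideanSpace ℝ (Fin n)) (t b)) ≤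
      ENNReal.ofReal (CV * (2 * r) ^ n) := by
    rw [← measure_biUnion hIc hdis fun _ _ => measurableSet_closedBall]
    refine (measure_mono (iUnion₂_subset fun b hb w hw => ?_)).trans
      (hV.upper x₀ (2 * r) (by positivity))
    rw [mem_closedBall] at hw
    have h3 := hD (hID hb)
    rw [mem_ball] at h3 ⊢
    linarith [dist_triangle w b x₀, (ht b (hID hb)).2]
  calc surfMeasure n E (ρ '' D)
      ≤ ∑' b : I, surfMeasure n E (ρ '' closedBall b (5 * t b)) :=
        (measure_mono h1).trans (measure_biUnion_le _ hIc _)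
    _ ≤ ∑' b : I, η * (ENNReal.ofReal CV * volume (closedBall (b : EuclideanSpace ℝ (Fin n)) (t b))) := by
        refine ENNReal.tsum_le_tsum fun b => (hη b (hID b.2)).trans ?_
        gcongr
        have h4 := hV.lower b trivial (t b) (ht b (hID b.2)).1
        calc ENNReal.ofReal (t b ^ n) = ENNReal.ofReal CV * ENNReal.ofReal (CV⁻¹ * t b ^ n) := by
              rw [← ENNReal.ofReal_mul hCV.le]; congr 1; field_simp
          _ ≤ _ := by
              gcongr
              exact h4.trans (measure_mono ball_subset_closedBall)
    _ = η * (ENNReal.ofReal CV * ∑' b : I, volume (closedBall (b : EuclideanSpace ℝ (Fin n)) (t b))) := by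
        rw [ENNReal.tsum_mul_left, ENNReal.tsum_mul_left]
    _ ≤ η * (ENNReal.ofReal CV * ENNReal.ofReal (CV * (2 * r) ^ n)) := by gcongr
    _ = _ := by
        rw [mul_comm _ η, mul_assoc, ← ENNReal.ofReal_mul (by positivity),
          ← ENNReal.ofReal_mul (by positivity)]
        congr 2
        rw [mul_pow]; ring

/-- At the point `x` and scale `t`, the set `E` is bilaterally `η t`-close to the hyperplane
`⟪N, ·⟫ = c` inside a ball of radius `Λ t`. -/
def FlatPlane {n : ℕ} (E : Set (ES n)) (Λ η : ℝ) (x : ES n) (t : ℝ) (N : ES n) (c : ℝ) : Prop :=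
  ‖N‖ = 1 ∧ (∀ y ∈ E, dist y x ≤ Λ * t → |⟪N, y⟫_ℝ - c| ≤ η * t) ∧
    ∀ p, dist p x ≤ Λ * t → ⟪N, p⟫_ℝ = c → infDist p E ≤ η * t

def FlatAt {n : ℕ} (E : Set (ES n)) (Λ η : ℝ) (x : ES n) (t : ℝ) : Prop :=
  ∃ N c, FlatPlane E Λ η x t N c

theorem infDist_hyperplane_le {n : ℕ} {N : ES n} (hN : ‖N‖ = 1) (c : ℝ) (x : ES n) :
    infDist x {Z | ⟪N, Z⟫_ℝ = c} ≤ |⟪N, x⟫_ℝ - c| := by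
  have h : x - (⟪N, x⟫_ℝ - c) • N ∈ {Z : ES n | ⟪N, Z⟫_ℝ = c} := by
    simp [inner_sub_right, inner_smul_right, hN]
  refine (infDist_le_dist_of_mem h).trans (le_of_eq ?_)
  rw [dist_eq_norm, sub_sub_cancel, norm_smul, hN, mul_one, Real.norm_eq_abs]

theorem localWHSA_of_flat {n : ℕ} {E : Set (ES n)} (D : DyadicSystem n E) {ε Λ : ℝ} (hε : 0 < ε)
    (hε1 : ε ≤ 1) (hΛ : ε ^ (-2 : ℤ) + D.Cstar + 1 ≤ Λ) {k : ℤ} {Q : Set (ES n)}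
    (hQ : Q ∈ D.cubes k) {x : ES n} (hx : x ∈ Q) (h : FlatAt E Λ (ε / 2) x (2 ^ (-k))) :
    LocalWHSA E D 1 ε k Q := by
  obtain ⟨N, c, hN, h1, h2⟩ := h
  set t : ℝ := 2 ^ (-k) with ht
  have ht0 : 0 < t := by positivity
  have hC := D.Cstar_pos
  have hε2 : 0 < ε ^ (-2 : ℤ) := by positivity
  have hcx : dist (D.center Q) x ≤ D.Cstar * t := D.dist_le hQ (D.center_mem k Q hQ) hx
  have hΛt : (ε ^ (-2 : ℤ) + D.Cstar + 1) * t ≤ Λ * t := by gcongr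
  refine ⟨{Z | c + ε / 2 * t < ⟪N, Z⟫_ℝ}, {Z | ⟪N, Z⟫_ℝ = c + ε / 2 * t}, ⟨N, _, hN, rfl, rfl⟩,
    ?_, ⟨x, subset_closure hx, ?_⟩, ?_⟩
  · rintro Z ⟨hZ, hZb⟩
    rw [mem_ofPred_eq] at hZ
    rw [mem_ball] at hZb
    have e : dist Z (Z - (ε / 2 * t) • N) = ε / 2 * t := by
      rw [dist_eq_norm, sub_sub_cancel, norm_smul, hN, mul_one, Real.norm_of_nonneg (by positivity)]
    have h3 := h2 (Z - (ε / 2 * t) • N) (by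
      have := dist_triangle4_left (Z - (ε / 2 * t) • N) x Z (D.center Q)
      have := dist_triangle (Z - (ε / 2 * t) • N) Z x
      have := dist_triangle Z (D.center Q) x
      rw [dist_comm] at e
      nlinarith) (by simp [inner_sub_right, inner_smul_right, hN, hZ])
    have := infDist_le_infDist_add_dist (s := E) (x := Z) (y := Z - (ε / 2 * t) • N)
    linarith
  · refine (infDist_hyperplane_le hN _ x).trans ?_
    have h3 := h1 x (D.subset_of_mem hQ hx) (by rw [dist_self]; nlinarith)
    rw [abs_le] at h3 ⊢
    simp only [Real.one_rpow, one_mul]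
    constructor <;> nlinarith
  · rw [Set.eq_empty_iff_forall_notMem]
    rintro y ⟨⟨hy, hyb⟩, hyE⟩
    rw [mem_ofPred_eq] at hy
    rw [mem_ball] at hyb
    have h3 := h1 y hyE (by have := dist_triangle y (D.center Q) x; nlinarith)
    rw [abs_le] at h3
    linarith

theorem exists_unit_normal {n : ℕ} (L : EuclideanSpace ℝ (Fin n) →ₗ[ℝ] ES n)
    (hL : Function.Injective L) :
    ∃ N : ES n, ‖N‖ = 1 ∧ (∀ h, ⟪N, L h⟫_ℝ = 0) ∧ ∀ p, ⟪N, p⟫_ℝ = 0 → ∃ h, L h = p := by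
  have h1 : Module.finrank ℝ (LinearMap.range L) = n := by
    rw [LinearMap.finrank_range_of_inj hL]; simp
  have h2 := Submodule.finrank_add_finrank_orthogonal (LinearMap.range L)
  rw [h1, finrank_euclideanSpace_fin] at h2
  have h3 : (LinearMap.range L)ᗮ ≠ ⊥ := by
    intro h; rw [h, finrank_bot] at h2; omega
  obtain ⟨w, hw, hw0⟩ := Submodule.exists_mem_ne_zero_of_ne_bot h3
  have hw1 : ‖w‖ ≠ 0 := norm_ne_zero_iff.2 hw0
  have hN : ‖(‖w‖⁻¹ • w)‖ = 1 := by rw [norm_smul, norm_inv, norm_norm, inv_mul_cancel₀ hw1]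
  set N := ‖w‖⁻¹ • w
  have hNo : N ∈ (LinearMap.range L)ᗮ := Submodule.smul_mem _ _ hw
  have h5 : ∀ h, ⟪N, L h⟫_ℝ = 0 := fun h =>
    Submodule.inner_left_of_mem_orthogonal (LinearMap.mem_range_self L h) hNo
  have h6 : LinearMap.range L ≤ (Submodule.span ℝ {N})ᗮ := by
    rintro _ ⟨h, rfl⟩
    rw [Submodule.mem_orthogonal_singleton_iff_inner_right]; exact h5 h
  have h7 : LinearMap.range L = (Submodule.span ℝ {N})ᗮ := by
    refine Submodule.eq_of_le_of_finrank_eq h6 ?_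
    have h8 := Submodule.finrank_add_finrank_orthogonal (Submodule.span ℝ {N})
    rw [finrank_span_singleton (norm_ne_zero_iff.1 (by rw [hN]; norm_num)),
      finrank_euclideanSpace_fin] at h8
    omega
  refine ⟨N, hN, h5, fun p hp => ?_⟩
  have : p ∈ LinearMap.range L := by
    rw [h7, Submodule.mem_orthogonal_singleton_iff_inner_right]; exact hp
  exact this

/-- If a nondegenerate affine map approximates `ρ` near `u`, and both `K` near `u` and its image in
`E` near `ρ u` are dense at scale `t`, then `E` is flat at `ρ u`. -/
theorem flatAt_of_affine {n : ℕ} {E : Set (ES n)} {M : ℝ≥0} {ρ : EuclideanSpace ℝ (Fin n) → ES n}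
    (hρ : LipschitzWith M ρ) {K : Set (EuclideanSpace ℝ (Fin n))} (hK : ρ '' K ⊆ E)
    {u : EuclideanSpace ℝ (Fin n)} (hu : u ∈ K) {L : EuclideanSpace ℝ (Fin n) →ₗ[ℝ] ES n}
    {δ τ t Λ Λ₁ η : ℝ} (hδ : 0 < δ) (hδ1 : δ ≤ 1) (hτ : 0 < τ) (hτ1 : τ ≤ 1 / 2) (ht : 0 < t) (hΛ : 0 < Λ)
    (hΛ₁ : 2 * (Λ + 1) / δ < Λ₁) (hη : (3 + 2 * M) * τ ≤ η)
    (haff : ∀ v, dist v u ≤ Λ₁ * t → ‖ρ v - ρ u - L (v - u)‖ ≤ τ * t)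
    (hL : ∀ h, ‖h‖ = 1 → δ < ‖L h‖)
    (hbi : ∀ v ∈ K, ∀ w ∈ K, δ / 2 * dist v w ≤ dist (ρ v) (ρ w))
    (hV : ∀ v, dist u v < Λ₁ * t → infDist v K ≤ τ * t)
    (hEd : ∀ y ∈ E, dist (ρ u) y < Λ₁ * t → infDist y (ρ '' K) ≤ τ * t) :
    FlatAt E Λ η (ρ u) t := by
  have hL' : ∀ h, δ * ‖h‖ ≤ ‖L h‖ := by
    intro h
    rcases eq_or_ne h 0 with rfl | hh
    · simp
    have hh0 : 0 < ‖h‖ := norm_pos_iff.2 hh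
    have := hL (‖h‖⁻¹ • h) (by rw [norm_smul, norm_inv, norm_norm, inv_mul_cancel₀ hh0.ne'])
    rw [map_smul, norm_smul, norm_inv, norm_norm, inv_mul_eq_div, lt_div_iff₀ hh0] at this
    exact this.le
  have hinj : Function.Injective L := by
    rw [injective_iff_map_eq_zero]
    intro h h0
    have := hL' h
    rw [h0, norm_zero] at this
    have : ‖h‖ ≤ 0 := by by_contra hc; push Not at hc; nlinarith
    exact norm_le_zero_iff.1 this
  obtain ⟨N, hN, hN1, hN2⟩ := exists_unit_normal L hinj
  have hM : (0 : ℝ) ≤ M := M.2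
  have hτt : 0 < τ * t := by positivity
  have hΛδ : Λ + 1 ≤ Λ₁ * δ / 2 := by
    rw [div_lt_iff₀ hδ] at hΛ₁; linarith
  have hΛΛ : Λ + 1 ≤ Λ₁ := by
    have : 0 < Λ₁ := by
      by_contra hc; push Not at hc; nlinarith
    nlinarith
  refine ⟨N, ⟪N, ρ u⟫_ℝ, hN, fun y hy hyx => ?_, fun p hp hpN => ?_⟩
  · have h1 : infDist y (ρ '' K) < 2 * (τ * t) :=
      lt_of_le_of_lt (hEd y hy (by rw [dist_comm]; nlinarith)) (by linarith)
    obtain ⟨_, ⟨v, hv, rfl⟩, hvy⟩ := (infDist_lt_iff (s := ρ '' K) ⟨ρ u, u, hu, rfl⟩).1 h1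
    have h2 : dist v u ≤ Λ₁ * t := by
      have h3 := hbi v hv u hu
      have h4 := dist_triangle_left (ρ v) (ρ u) y
      have h5 : δ / 2 * dist v u ≤ δ / 2 * (Λ₁ * t) := by nlinarith
      exact le_of_mul_le_mul_left h5 (by positivity)
    have h3 := haff v h2
    have h4 : ⟪N, y⟫_ℝ - ⟪N, ρ u⟫_ℝ =
        ⟪N, y - ρ v⟫_ℝ + ⟪N, ρ v - ρ u - L (v - u)⟫_ℝ := by
      simp only [inner_sub_right, hN1]; ring
    rw [h4]
    refine (abs_add_le _ _).trans ?_
    have h5 := abs_real_inner_le_norm N (y - ρ v)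
    have h6 := abs_real_inner_le_norm N (ρ v - ρ u - L (v - u))
    rw [hN, one_mul] at h5 h6
    rw [← dist_eq_norm] at h5
    nlinarith
  · obtain ⟨h, hh⟩ := hN2 (p - ρ u) (by rw [inner_sub_right, hpN, sub_self])
    have h1 := hL' h
    rw [hh, ← dist_eq_norm] at h1
    have h2 : dist (u + h) u < Λ₁ * t := by
      rw [dist_eq_norm, add_sub_cancel_left]
      have h5 : δ * ‖h‖ < δ * (Λ₁ * t) := by nlinarith
      exact lt_of_mul_lt_mul_left h5 hδ.le
    have h3 : infDist (u + h) K < 2 * (τ * t) :=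
      lt_of_le_of_lt (hV _ (by rwa [dist_comm])) (by linarith)
    obtain ⟨v, hv, hvy⟩ := (infDist_lt_iff ⟨u, hu⟩).1 h3
    have h4 := haff (u + h) h2.le
    rw [add_sub_cancel_left, hh, sub_sub_sub_cancel_right, ← dist_eq_norm] at h4
    have h5 := hρ.dist_le_mul (u + h) v
    refine (infDist_le_dist_of_mem (hK ⟨v, hv, rfl⟩)).trans ?_
    have h6 := dist_triangle_left p (ρ v) (ρ (u + h))
    nlinarith

/-- Truncation of a Lipschitz map to a compactly supported one. -/
theorem exists_cutoff {V Y : Type*} [NormedAddCommGroup V] [NormedAddCommGroup Y]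
    [NormedSpace ℝ Y] {M : ℝ≥0} {ρ : V → Y} (hρ : LipschitzWith M ρ) {R : ℝ} (hR : 0 < R) :
    ∃ f : V → Y, LipschitzWith (3 * M) f ∧ (∀ x, 2 * R ≤ ‖x‖ → f x = 0) ∧
      ∀ x, ‖x‖ ≤ R → f x = ρ x - ρ 0 := by
  set φ : V → ℝ := fun v => max 0 (min 1 (2 - ‖v‖ / R)) with hφ
  have hφ0 : ∀ v, 0 ≤ φ v := fun v => le_max_left _ _
  have hφ1 : ∀ v, φ v ≤ 1 := fun v => max_le zero_le_one (min_le_left _ _)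
  have hφL : ∀ v w, |φ v - φ w| ≤ dist v w / R := by
    intro v w
    have h1 : |φ v - φ w| ≤ |(2 - ‖v‖ / R) - (2 - ‖w‖ / R)| := by
      refine (abs_max_sub_max_le_max _ _ _ _).trans (max_le (by simp) ?_)
      exact (abs_min_sub_min_le_max _ _ _ _).trans (max_le (by simp) le_rfl)
    refine h1.trans ?_
    have : (2 - ‖v‖ / R) - (2 - ‖w‖ / R) = (‖w‖ - ‖v‖) / R := by ring
    rw [this, abs_div, abs_of_pos hR, dist_comm, dist_eq_norm]
    gcongr
    exact abs_norm_sub_norm_le _ _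
  have hφz : ∀ v, 2 * R ≤ ‖v‖ → φ v = 0 := by
    intro v hv
    have : 2 ≤ ‖v‖ / R := by rwa [le_div_iff₀ hR]
    exact max_eq_left ((min_le_right _ _).trans (by linarith))
  have hz : ∀ v, 2 * R ≤ ‖v‖ → φ v • (ρ v - ρ 0) = 0 := fun v hv => by rw [hφz v hv, zero_smul]
  have main : ∀ v w, ‖w‖ ≤ 2 * R →
      dist (φ v • (ρ v - ρ 0)) (φ w • (ρ w - ρ 0)) ≤ 3 * M * dist v w := by
    intro v w hw
    have e : φ v • (ρ v - ρ 0) - φ w • (ρ w - ρ 0) =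
        φ v • (ρ v - ρ w) + (φ v - φ w) • (ρ w - ρ 0) := by module
    rw [dist_eq_norm, e]
    refine (norm_add_le _ _).trans ?_
    rw [norm_smul, norm_smul, Real.norm_of_nonneg (hφ0 v), Real.norm_eq_abs, ← dist_eq_norm,
      ← dist_eq_norm]
    have h1 := hρ.dist_le_mul v w
    have h2 := hρ.dist_le_mul w 0
    rw [dist_zero_right] at h2
    have h3 : dist (ρ w) (ρ 0) ≤ M * (2 * R) := h2.trans (by gcongr)
    calc φ v * dist (ρ v) (ρ w) + |φ v - φ w| * dist (ρ w) (ρ 0)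
        ≤ 1 * (M * dist v w) + dist v w / R * (M * (2 * R)) := by
          gcongr
          · exact hφ1 v
          · exact hφL v w
      _ = _ := by field_simp; ring
  refine ⟨fun v => φ v • (ρ v - ρ 0), LipschitzWith.of_dist_le_mul fun v w => ?_, hz, ?_⟩
  · push_cast
    rcases le_total ‖w‖ (2 * R) with hw | hw
    · exact main v w hw
    rcases le_total ‖v‖ (2 * R) with hv | hv
    · rw [dist_comm, dist_comm v]; exact main w v hv
    · rw [hz v hv, hz w hw, dist_self]; positivity
  · intro v hv
    have : ‖v‖ / R ≤ 1 := by rwa [div_le_one hR]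
    have : φ v = 1 := by
      simp only [hφ]
      rw [min_eq_left (by linarith), max_eq_right zero_le_one]
    simp only [this, one_smul]

theorem exists_pos_mul_ofReal_le {A : ℝ≥0∞} (hA : A ≠ ⊤) {c : ℝ} (hc : 0 < c) :
    ∃ δ : ℝ, 0 < δ ∧ δ ≤ 1 ∧ A * ENNReal.ofReal δ ≤ ENNReal.ofReal c := by
  have hA0 : 0 ≤ A.toReal := ENNReal.toReal_nonneg
  refine ⟨min 1 (c / (A.toReal + 1)), lt_min one_pos (by positivity), min_le_left _ _, ?_⟩
  set δ := min 1 (c / (A.toReal + 1)) with hδ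
  have e : A * ENNReal.ofReal δ = ENNReal.ofReal (A.toReal * δ) := by
    rw [ENNReal.ofReal_mul hA0, ENNReal.ofReal_toReal hA]
  rw [e]
  refine ENNReal.ofReal_le_ofReal ?_
  calc A.toReal * δ ≤ (A.toReal + 1) * (c / (A.toReal + 1)) := by
        gcongr
        · linarith
        · exact min_le_right _ _
    _ = c := by field_simp

theorem exists_nat_le_of_mul_le {A : ℝ≥0∞} (hA : A ≠ ⊤) {c : ℝ} (hc : 0 < c) :
    ∃ N : ℕ, ∀ m s : ℝ≥0∞, N * m ≤ A * s → m ≤ ENNReal.ofReal c * s := by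
  have hc0 : ENNReal.ofReal c ≠ 0 := (ENNReal.ofReal_pos.2 hc).ne'
  obtain ⟨N, hN⟩ := ENNReal.exists_nat_gt (ENNReal.div_ne_top hA hc0)
  have hN0 : (N : ℝ≥0∞) ≠ 0 := fun h => by simp [h] at hN
  refine ⟨N, fun m s h => ?_⟩
  rw [← ENNReal.mul_le_mul_iff_right hN0 (ENNReal.natCast_ne_top N)]
  refine h.trans ?_
  rw [← mul_assoc]
  gcongr
  rw [ENNReal.div_lt_iff (Or.inl hc0) (Or.inl ENNReal.ofReal_ne_top)] at hN
  exact hN.le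

theorem le_of_quarters {θ : ℝ} (hθ : 0 < θ) {s a b m m' : ℝ≥0∞} (hs : s ≠ ⊤)
    (hm : ENNReal.ofReal θ * s ≤ m) (h : m ≤ a + b + m')
    (ha : a ≤ ENNReal.ofReal (θ / 4) * s) (hb : b ≤ ENNReal.ofReal (θ / 4) * s) :
    ENNReal.ofReal (θ / 2) * s ≤ m' := by
  have h1 : ENNReal.ofReal θ * s = ENNReal.ofReal (θ / 4) * s + ENNReal.ofReal (θ / 4) * s +
      ENNReal.ofReal (θ / 2) * s := by
    rw [← add_mul, ← add_mul, ← ENNReal.ofReal_add (by positivity) (by positivity),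
      ← ENNReal.ofReal_add (by positivity) (by positivity)]
    congr 2; ring
  have h2 : ENNReal.ofReal (θ / 4) * s + ENNReal.ofReal (θ / 4) * s + ENNReal.ofReal (θ / 2) * s ≤
      ENNReal.ofReal (θ / 4) * s + ENNReal.ofReal (θ / 4) * s + m' := by
    rw [← h1]
    refine (hm.trans h).trans ?_
    gcongr
  exact (ENNReal.add_le_add_iff_left (by finiteness)).1 h2

/-- A bilipschitz piece inside a big Lipschitz image. -/
theorem exists_bilipschitz_piece {n : ℕ} {C : ℝ} {E : Set (ES n)} (hE : Regular n C E) (M : ℝ≥0)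
    {θ B : ℝ} (hθ : 0 < θ) (hB : 0 < B) :
    ∃ δ : ℝ, 0 < δ ∧ δ ≤ 1 ∧ ∀ τ Λ : ℝ, 0 < τ → τ ≤ δ / 4 → 10 ≤ Λ → ∃ (N : ℕ) (c : ℝ), 0 < c ∧
      ∀ (ρ : EuclideanSpace ℝ (Fin n) → ES n) (r : ℝ) (j : ℤ), LipschitzWith M ρ → 0 < r →
      2 * r ≤ 2 ^ (-j) → (2 : ℝ) ^ (-j) ≤ B * r → ∀ S ⊆ E, S ⊆ ρ '' ball 0 r →
      ENNReal.ofReal (θ * r ^ n) ≤ surfMeasure n E S →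
      ∃ K ⊆ ball (0 : EuclideanSpace ℝ (Fin n)) r, ∃ U : ℤ → Set (EuclideanSpace ℝ (Fin n)),
        ρ '' K ⊆ S ∧ ENNReal.ofReal (c * r ^ n) ≤ surfMeasure n E (ρ '' K) ∧
        (∀ u ∈ K, scaleCount U j u ≤ N) ∧
        (∀ u ∈ K, ∀ k, j ≤ k → u ∉ U k → ∃ L : EuclideanSpace ℝ (Fin n) →ₗ[ℝ] ES n,
          (∀ v, dist v u ≤ Λ * 2 ^ (-k) → ‖ρ v - ρ u - L (v - u)‖ ≤ τ * 2 ^ (-k)) ∧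
          ∀ h, ‖h‖ = 1 → δ < ‖L h‖) ∧
        ∀ u ∈ K, ∀ v ∈ K, δ / 2 * dist u v ≤ dist (ρ u) (ρ v) := by
  obtain ⟨Ad, hAd, hdeg⟩ := exists_degenerate_image_le hE M
  obtain ⟨Av, hAv, hvit⟩ := exists_vitali_image_le hE
  obtain ⟨cH, hcH, hH⟩ := exists_hausdorff_image_le n
  obtain ⟨cV, hcV, hV⟩ := exists_volume_le_hausdorff_image n
  obtain ⟨δ, hδ, hδ1, hδA⟩ := exists_pos_mul_ofReal_le
    (A := Av * Ad * ENNReal.ofReal (B ^ n)) (by finiteness) (c := θ / 4) (by positivity)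
  refine ⟨δ, hδ, hδ1, fun τ Λ hτ hτδ hΛ => ?_⟩
  obtain ⟨AU, hAU, hUp⟩ := exists_nonaffine_packing (Y := ES n) n τ Λ (3 * M) hτ
  obtain ⟨N, hN⟩ := exists_nat_le_of_mul_le
    (A := cH * M ^ n * (AU * ENNReal.ofReal ((2 * (1 + Λ) * B) ^ n))) (by finiteness)
    (c := θ / 4) (by positivity)
  obtain ⟨ct, hct, hthin⟩ := exists_thinning n N (s := 1 / 2) (L := 1) (by norm_num) one_pos
  set Mb : ℝ≥0 := (2 / δ).toNNReal with hMb
  set T : ℝ≥0∞ := cH * M ^ n * (cV * Mb ^ n) with hT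
  have hT' : T ≠ ⊤ := by finiteness
  set c₀ : ℝ≥0∞ := ENNReal.ofReal (θ / 2) * min ct 1 / (T + 1) with hc₀
  have hc₀0 : c₀ ≠ 0 := by
    have : min ct 1 ≠ 0 := by simp [hct]
    rw [hc₀, ne_eq, ENNReal.div_eq_zero_iff]
    push Not
    exact ⟨mul_ne_zero (ENNReal.ofReal_pos.2 (by positivity)).ne' this, by finiteness⟩
  have hc₀t : c₀ ≠ ⊤ := by
    refine ENNReal.div_ne_top (ENNReal.mul_ne_top ENNReal.ofReal_ne_top ?_) (by simp)
    exact ne_top_of_le_ne_top ENNReal.one_ne_top (min_le_right _ _)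
  refine ⟨N, c₀.toReal, ENNReal.toReal_pos hc₀0 hc₀t, ?_⟩
  intro ρ r j hρ hr hrj hjr S hSE hSρ hSθ
  set t₀ : ℝ := 2 ^ (-j) with ht₀
  have ht₀0 : 0 < t₀ := by positivity
  set s : ℝ≥0∞ := ENNReal.ofReal (r ^ n) with hs
  have hs' : s ≠ ⊤ := ENNReal.ofReal_ne_top
  have hpow : ∀ a : ℝ, 0 ≤ a → ENNReal.ofReal ((a * r) ^ n) = ENNReal.ofReal (a ^ n) * s := by
    intro a ha; rw [mul_pow, ENNReal.ofReal_mul (by positivity)]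
  set R : ℝ := (1 + Λ) * t₀ with hR
  have hR0 : 0 < R := by positivity
  obtain ⟨f, hf, hfz, hfe⟩ := exists_cutoff hρ hR0
  obtain ⟨U, hUm, hUa, hUs⟩ := hUp f (2 * R) j hf hfz (by nlinarith)
  have haff : ∀ u ∈ ball (0 : EuclideanSpace ℝ (Fin n)) r, ∀ k, j ≤ k → u ∉ U k →
      ∃ L : EuclideanSpace ℝ (Fin n) →ₗ[ℝ] ES n,
        ∀ v, dist v u ≤ Λ * 2 ^ (-k) → ‖ρ v - ρ u - L (v - u)‖ ≤ τ * 2 ^ (-k) := by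
    intro u hu k hk huU
    obtain ⟨L, hL⟩ := hUa k u huU
    refine ⟨L, fun v hv => ?_⟩
    have h1 := hL v hv
    rw [mem_ball_zero_iff] at hu
    have h2 : (2 : ℝ) ^ (-k) ≤ t₀ := zpow_neg_le_of_le hk
    have h3 : Λ * 2 ^ (-k) ≤ Λ * t₀ := by gcongr
    have h4 : ‖v‖ ≤ ‖u‖ + dist v u := by
      rw [dist_eq_norm]; have := norm_add_le u (v - u); rwa [add_sub_cancel] at this
    rwa [hfe v (by linarith), hfe u (by nlinarith), sub_sub_sub_cancel_right] at h1
  set K₀ : Set (EuclideanSpace ℝ (Fin n)) := ball 0 r ∩ ρ ⁻¹' S with hK₀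
  set Dg : Set (EuclideanSpace ℝ (Fin n)) := {u ∈ K₀ | ∃ k, j ≤ k ∧
    ∃ L : EuclideanSpace ℝ (Fin n) →ₗ[ℝ] ES n,
      (∀ v, dist v u ≤ Λ * 2 ^ (-k) → ‖ρ v - ρ u - L (v - u)‖ ≤ τ * 2 ^ (-k)) ∧
      ∃ h, ‖h‖ = 1 ∧ ‖L h‖ ≤ δ} with hDg
  have hDg' : surfMeasure n E (ρ '' Dg) ≤ ENNReal.ofReal (θ / 4) * s := by
    have hk : ∀ u : EuclideanSpace ℝ (Fin n), ∃ k : ℤ, u ∈ Dg → j ≤ k ∧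
        surfMeasure n E (ρ '' closedBall u (5 * 2 ^ (-k))) ≤
          Ad * ENNReal.ofReal δ * ENNReal.ofReal ((2 ^ (-k)) ^ n) := by
      intro u
      by_cases hu : u ∈ Dg
      · obtain ⟨-, k, hk, L, hL, h, hh, hLh⟩ := id hu
        refine ⟨k, fun _ => ⟨hk, ?_⟩⟩
        rw [mul_assoc, ← ENNReal.ofReal_mul hδ.le]
        have h2 : (0 : ℝ) < 2 ^ (-k) := by positivity
        refine hdeg δ ρ u _ L h hδ hδ1 hρ h2 hh hLh fun v hv => ?_
        refine (hL v (hv.trans (by gcongr))).trans ?_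
        gcongr; linarith
      · exact ⟨0, fun h => absurd h hu⟩
    choose k hk using hk
    refine (hvit ρ Dg 0 t₀ (Ad * ENNReal.ofReal δ) (fun u => 2 ^ (-(k u))) ht₀0
      (fun u hu => ball_subset_ball (by linarith) hu.1.1)
      (fun u hu => ⟨by positivity, zpow_neg_le_of_le (hk u hu).1⟩)
      (fun u hu => (hk u hu).2)).trans ?_
    calc Av * (Ad * ENNReal.ofReal δ) * ENNReal.ofReal (t₀ ^ n)
        ≤ Av * (Ad * ENNReal.ofReal δ) * ENNReal.ofReal ((B * r) ^ n) := by gcongr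
      _ = (Av * Ad * ENNReal.ofReal (B ^ n) * ENNReal.ofReal δ) * s := by
          rw [hpow B hB.le]; ring
      _ ≤ _ := by gcongr
  have hσH : ∀ A : Set (EuclideanSpace ℝ (Fin n)),
      surfMeasure n E (ρ '' A) ≤ cH * M ^ n * volume A := fun A =>
    (Measure.restrict_apply_le _ _).trans (hH _ M ρ hρ A)
  set Kb : Set (EuclideanSpace ℝ (Fin n)) := {u ∈ K₀ | N ≤ scaleCount U j u} with hKb
  have hKb' : surfMeasure n E (ρ '' Kb) ≤ ENNReal.ofReal (θ / 4) * s := by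
    refine hN _ _ ?_
    have h1 := measure_scaleCount_gt hUm j (volume : Measure (EuclideanSpace ℝ (Fin n))) K₀
      (N := N) ((ENNReal.tsum_le_tsum fun i : ℕ => measure_mono inter_subset_left).trans hUs)
    have h2 : ENNReal.ofReal ((2 * R) ^ n) ≤ ENNReal.ofReal ((2 * (1 + Λ) * B) ^ n) * s := by
      rw [← hpow _ (by positivity)]
      refine ENNReal.ofReal_le_ofReal (pow_le_pow_left₀ (by positivity) ?_ n)
      have : (1 + Λ) * t₀ ≤ (1 + Λ) * (B * r) := by gcongr
      rw [hR]; linarith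
    calc (N : ℝ≥0∞) * surfMeasure n E (ρ '' Kb)
        ≤ N * (cH * M ^ n * volume Kb) := by gcongr; exact hσH _
      _ = cH * M ^ n * (N * volume Kb) := by ring
      _ ≤ cH * M ^ n * (AU * (ENNReal.ofReal ((2 * (1 + Λ) * B) ^ n) * s)) := by
          refine mul_le_mul_right (h1.trans ?_) _
          gcongr
      _ = _ := by ring
  set K₁ : Set (EuclideanSpace ℝ (Fin n)) := {u ∈ K₀ | u ∉ Dg ∧ scaleCount U j u ≤ N} with hK₁
  have hK₁S : surfMeasure n E S ≤ surfMeasure n E (ρ '' Dg) + surfMeasure n E (ρ '' Kb) +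
      surfMeasure n E (ρ '' K₁) := by
    refine (measure_mono (t := ρ '' Dg ∪ ρ '' Kb ∪ ρ '' K₁) ?_).trans
      ((measure_union_le _ _).trans (add_le_add_left (measure_union_le _ _) _))
    intro x hx
    obtain ⟨u, hu, rfl⟩ := hSρ hx
    have hu0 : u ∈ K₀ := ⟨hu, hx⟩
    by_cases h1 : u ∈ Dg
    · exact Or.inl (Or.inl ⟨u, h1, rfl⟩)
    by_cases h2 : (N : ℝ≥0∞) ≤ scaleCount U j u
    · exact Or.inl (Or.inr ⟨u, ⟨hu0, h2⟩, rfl⟩)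
    · exact Or.inr ⟨u, ⟨hu0, h1, (not_le.1 h2).le⟩, rfl⟩
  rw [ENNReal.ofReal_mul hθ.le] at hSθ
  have hK₁θ := le_of_quarters hθ hs' hSθ hK₁S hDg' hKb'
  have hfin : IsFiniteMeasure ((volume : Measure (EuclideanSpace ℝ (Fin n))).restrict (ball 0 r)) :=
    ⟨by rw [Measure.restrict_apply_univ]; exact measure_ball_lt_top⟩
  obtain ⟨K, hKK, hKc, -, hKt⟩ := hthin (volume.restrict (ball 0 r)) U hUm j K₁ fun u hu => hu.2.2
  have hKr : K ⊆ ball 0 r := fun u hu => (hKK hu).1.1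
  rw [Measure.restrict_eq_self _ (fun u hu => hu.1.1 : K₁ ⊆ ball 0 r),
    Measure.restrict_eq_self _ hKr] at hKc
  have hKS : ρ '' K ⊆ S := by rintro _ ⟨u, hu, rfl⟩; exact (hKK hu).1.2
  have hLp : ∀ u ∈ K, ∀ k, j ≤ k → u ∉ U k → ∃ L : EuclideanSpace ℝ (Fin n) →ₗ[ℝ] ES n,
      (∀ v, dist v u ≤ Λ * 2 ^ (-k) → ‖ρ v - ρ u - L (v - u)‖ ≤ τ * 2 ^ (-k)) ∧
      ∀ h, ‖h‖ = 1 → δ < ‖L h‖ := by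
    intro u hu k hk huU
    obtain ⟨L, hL⟩ := haff u (hKr hu) k hk huU
    refine ⟨L, hL, fun h hh => ?_⟩
    by_contra hc
    exact (hKK hu).2.1 ⟨(hKK hu).1, k, hk, L, hL, h, hh, not_lt.1 hc⟩
  have hone : ∀ u ∈ K, ∀ v, ∀ k, j ≤ k → u ∉ U k → dist v u ≤ 2 ^ (-k) →
      1 / 2 * 2 ^ (-k) < dist v u → δ / 2 * dist v u ≤ dist (ρ v) (ρ u) := by
    intro u hu v k hk huU h1 h2
    obtain ⟨L, hL, hL2⟩ := hLp u hu k hk huU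
    have h0 : (0 : ℝ) < 2 ^ (-k) := by positivity
    have h3 := hL v (h1.trans (by nlinarith))
    have hd : 0 < ‖v - u‖ := by rw [← dist_eq_norm]; linarith
    have h4 := hL2 (‖v - u‖⁻¹ • (v - u)) (by
      rw [norm_smul, norm_inv, norm_norm, inv_mul_cancel₀ hd.ne'])
    rw [map_smul, norm_smul, norm_inv, norm_norm, inv_mul_eq_div, lt_div_iff₀ hd,
      ← dist_eq_norm] at h4
    have h5 := norm_sub_norm_le (L (v - u)) (L (v - u) - (ρ v - ρ u))
    rw [sub_sub_cancel, norm_sub_rev, ← dist_eq_norm (ρ v)] at h5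
    have h6 : τ * 2 ^ (-k) ≤ δ / 4 * (2 * dist v u) := by gcongr; linarith
    linarith
  have hbi : ∀ u ∈ K, ∀ v ∈ K, δ / 2 * dist u v ≤ dist (ρ u) (ρ v) := by
    intro u hu v hv
    rcases eq_or_ne u v with rfl | huv
    · simp
    have hd : 0 < dist u v := dist_pos.2 huv
    obtain ⟨m, hm1, hm2⟩ := exists_mem_Ioc_zpow hd (one_lt_two : (1 : ℝ) < 2)
    have hk2 : dist u v ≤ 2 ^ (-(-(m + 1))) := by rwa [neg_neg]
    have hk1 : 1 / 2 * 2 ^ (-(-(m + 1))) < dist u v := by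
      rw [neg_neg, zpow_add_one₀ two_ne_zero]; linarith
    have hjk : j ≤ -(m + 1) := by
      by_contra hc
      push Not at hc
      have h1 : (2 : ℝ) ^ (-j) ≤ 2 ^ m := zpow_le_zpow_right₀ one_le_two (by omega)
      have h2 := hKr hu
      have h3 := hKr hv
      rw [mem_ball] at h2 h3
      linarith [dist_triangle_right u v 0]
    by_cases h1 : u ∈ U (-(m + 1))
    · by_cases h2 : v ∈ U (-(m + 1))
      · exact absurd (hKt _ hjk u hu v hv h1 h2 (by rwa [one_mul])) (not_le.2 hk1)
      · exact hone v hv u _ hjk h2 hk2 hk1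
    · rw [dist_comm, dist_comm (ρ u)]
      exact hone u hu v _ hjk h1 (by rwa [dist_comm]) (by rwa [dist_comm])
  refine ⟨K, hKr, U, hKS, ?_, fun u hu => (hKK hu).2.2, hLp, hbi⟩
  have h1 : volume K ≤ cV * Mb ^ n * surfMeasure n E (ρ '' K) := by
    rw [surfMeasure_apply hE.closed, inter_eq_self_of_subset_left (hKS.trans hSE)]
    refine hV _ Mb ρ K fun u hu v hv => ?_
    have := hbi u hu v hv
    rw [hMb, Real.coe_toNNReal _ (by positivity), div_mul_eq_mul_div, le_div_iff₀ hδ]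
    linarith
  rw [ENNReal.ofReal_mul ENNReal.toReal_nonneg, ENNReal.ofReal_toReal hc₀t]
  have h2 : ENNReal.ofReal (θ / 2) * min ct 1 * s ≤ (T + 1) * surfMeasure n E (ρ '' K) := by
    calc ENNReal.ofReal (θ / 2) * min ct 1 * s = min ct 1 * (ENNReal.ofReal (θ / 2) * s) := by ring
      _ ≤ ct * (cH * M ^ n * volume K₁) := by
          exact mul_le_mul' (min_le_left _ _) (hK₁θ.trans (hσH _))
      _ = cH * M ^ n * (ct * volume K₁) := by ring
      _ ≤ cH * M ^ n * (cV * Mb ^ n * surfMeasure n E (ρ '' K)) := by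
          exact mul_le_mul_right (hKc.trans h1) _
      _ = T * surfMeasure n E (ρ '' K) := by ring
      _ ≤ _ := by gcongr; exact le_self_add
  rw [hc₀, ENNReal.div_eq_inv_mul, mul_assoc]
  calc (T + 1)⁻¹ * (ENNReal.ofReal (θ / 2) * min ct 1 * s)
      ≤ (T + 1)⁻¹ * ((T + 1) * surfMeasure n E (ρ '' K)) := by gcongr
    _ = _ := by rw [← mul_assoc, ENNReal.inv_mul_cancel (by simp) (by finiteness), one_mul]

theorem isOpen_setOf_exists_dist_lt {S : Type*} [PseudoMetricSpace S] (P : S → Prop) (a : ℝ) :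
    IsOpen {x : S | ∃ y, P y ∧ dist x y < a} := by
  have : {x : S | ∃ y, P y ∧ dist x y < a} = ⋃ y ∈ {y | P y}, ball y a := by
    ext x; simp
  rw [this]
  exact isOpen_biUnion fun _ _ => isOpen_ball

/-- A big Lipschitz image contains a big set of points at which `E` is flat at all but boundedly
many scales. -/
theorem exists_flat_bigPiece {n : ℕ} {C : ℝ} {E : Set (ES n)} (hE : Regular n C E) (M : ℝ≥0)
    {Λ η θ B : ℝ} (hΛ : 0 < Λ) (hη : 0 < η) (hθ : 0 < θ) (hB : 0 < B) :
    ∃ (N : ℕ) (c : ℝ), 0 < c ∧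
      ∀ (ρ : EuclideanSpace ℝ (Fin n) → ES n) (r : ℝ) (j : ℤ), LipschitzWith M ρ → 0 < r →
      2 * r ≤ 2 ^ (-j) → (2 : ℝ) ^ (-j) ≤ B * r → ∀ S ⊆ E, S ⊆ ρ '' ball 0 r →
      ENNReal.ofReal (θ * r ^ n) ≤ surfMeasure n E S →
      ENNReal.ofReal (c * r ^ n) ≤ surfMeasure n E {x ∈ S |
        scaleCount (fun k => {x | ¬ FlatAt E Λ η x (2 ^ (-k))}) j x ≤ N} := by
  obtain ⟨δ, hδ, hδ1, hbip⟩ := exists_bilipschitz_piece hE M hθ hB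
  have hM : (0 : ℝ) ≤ M := M.2
  set τ : ℝ := min (δ / 4) (η / (3 + 2 * M)) with hτ
  have hτ0 : 0 < τ := lt_min (by positivity) (by positivity)
  have hτδ : τ ≤ δ / 4 := min_le_left _ _
  have hτη : (3 + 2 * M) * τ ≤ η := by
    have : τ ≤ η / (3 + 2 * M) := min_le_right _ _
    rwa [le_div_iff₀ (by positivity), mul_comm] at this
  set Λ₁ : ℝ := max 10 (2 * (Λ + 1) / δ + 1) with hΛ₁
  have hΛ₁0 : 0 < Λ₁ := lt_of_lt_of_le (by norm_num) (le_max_left _ _)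
  obtain ⟨N₁, c, hc, hpiece⟩ := hbip τ Λ₁ hτ0 hτδ (le_max_left _ _)
  obtain ⟨cH, hcH, hH⟩ := exists_hausdorff_image_le n
  obtain ⟨CV, hCV⟩ := exists_adMeas_volume n
  obtain ⟨AV, hAV, hdV⟩ := hCV.density hτ0 hΛ₁0
  obtain ⟨AE, hAE, hdE⟩ := hE.ad.density hτ0 hΛ₁0
  obtain ⟨N₂, hN₂⟩ := exists_nat_le_of_mul_le
    (A := cH * M ^ n * (AV * ENNReal.ofReal (B ^ n))) (by finiteness) (c := c / 4) (by positivity)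
  obtain ⟨N₃, hN₃⟩ := exists_nat_le_of_mul_le
    (A := AE * ENNReal.ofReal (((M + 1) * B) ^ n)) (by finiteness) (c := c / 4) (by positivity)
  refine ⟨N₁ + N₂ + N₃, c / 2, by positivity, ?_⟩
  intro ρ r j hρ hr hrj hjr S hSE hSρ hSθ
  obtain ⟨K, hKr, U, hKS, hKc, hKN, hKL, hbi⟩ := hpiece ρ r j hρ hr hrj hjr S hSE hSρ hSθ
  have := hE.ad.sigmaFinite
  set t₀ : ℝ := 2 ^ (-j) with ht₀
  have ht₀0 : 0 < t₀ := by positivity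
  set s : ℝ≥0∞ := ENNReal.ofReal (r ^ n) with hs
  have hs' : s ≠ ⊤ := ENNReal.ofReal_ne_top
  have hpow : ∀ a : ℝ, 0 ≤ a → ENNReal.ofReal ((a * r) ^ n) = ENNReal.ofReal (a ^ n) * s := by
    intro a ha; rw [mul_pow, ENNReal.ofReal_mul (by positivity)]
  set Vd : ℤ → Set (EuclideanSpace ℝ (Fin n)) := fun k =>
    {v | ∃ w, τ * 2 ^ (-k) < infDist w K ∧ dist v w < Λ₁ * 2 ^ (-k)} with hVd
  set Ed : ℤ → Set (ES n) := fun k =>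
    {x | ∃ y, (y ∈ E ∧ τ * 2 ^ (-k) < infDist y (ρ '' K)) ∧ dist x y < Λ₁ * 2 ^ (-k)} with hEd
  have hVm : ∀ k, MeasurableSet (Vd k) := fun k => (isOpen_setOf_exists_dist_lt _ _).measurableSet
  have hEm : ∀ k, MeasurableSet (Ed k) := fun k => (isOpen_setOf_exists_dist_lt _ _).measurableSet
  set Kb : Set (EuclideanSpace ℝ (Fin n)) := {u ∈ K | N₂ ≤ scaleCount Vd j u} with hKb
  set Gb : Set (ES n) := {x ∈ ρ '' K | N₃ ≤ scaleCount Ed j x} with hGb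
  have hKb' : surfMeasure n E (ρ '' Kb) ≤ ENNReal.ofReal (c / 4) * s := by
    refine hN₂ _ _ ?_
    have h1 := measure_scaleCount_gt hVm j (volume : Measure (EuclideanSpace ℝ (Fin n))) K
      (N := N₂) (T := AV * (ENNReal.ofReal (B ^ n) * s)) (by
        refine le_trans (le_of_eq (tsum_congr fun i : ℕ => congrArg _ ?_))
          ((hdV K 0 t₀ j le_rfl (hKr.trans (ball_subset_ball (by linarith)))).trans ?_)
        · ext u
          simp only [hVd, mem_inter_iff, mem_ofPred_eq, mem_univ, true_and]
          exact ⟨fun ⟨⟨w, h1, h2⟩, h3⟩ => ⟨h3, w, h2, h1⟩, fun ⟨h3, w, h2, h1⟩ => ⟨⟨w, h1, h2⟩, h3⟩⟩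
        · rw [← hpow B hB.le]
          gcongr)
    calc (N₂ : ℝ≥0∞) * surfMeasure n E (ρ '' Kb)
        ≤ N₂ * (cH * M ^ n * volume Kb) := by
          gcongr; exact (Measure.restrict_apply_le _ _).trans (hH _ M ρ hρ _)
      _ = cH * M ^ n * (N₂ * volume Kb) := by ring
      _ ≤ cH * M ^ n * (AV * (ENNReal.ofReal (B ^ n) * s)) := mul_le_mul_right h1 _
      _ = _ := by ring
  have hGb' : surfMeasure n E Gb ≤ ENNReal.ofReal (c / 4) * s := by
    refine hN₃ _ _ ?_
    refine measure_scaleCount_gt hEm j (surfMeasure n E) (ρ '' K) ?_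
    refine le_trans (le_of_eq (tsum_congr fun i : ℕ => congrArg _ ?_))
      ((hdE (ρ '' K) (ρ 0) ((M + 1) * t₀) j (by nlinarith) ?_).trans ?_)
    · ext u
      simp only [hEd, mem_inter_iff, mem_ofPred_eq]
      exact ⟨fun ⟨⟨w, h1, h2⟩, h3⟩ => ⟨h3, w, h1.1, h2, h1.2⟩,
        fun ⟨h3, w, h1, h2, h4⟩ => ⟨⟨w, ⟨h1, h4⟩, h2⟩, h3⟩⟩
    · rintro _ ⟨u, hu, rfl⟩
      have h1 := hKr hu
      rw [mem_ball] at h1 ⊢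
      have h2 := hρ.dist_le_mul u 0
      have h3 : M * dist u 0 ≤ M * t₀ := by gcongr; linarith
      linarith
    · rw [mul_assoc, ← hpow _ (by positivity), mul_assoc]
      gcongr
  have hsub : surfMeasure n E (ρ '' K) ≤ surfMeasure n E (ρ '' Kb) + surfMeasure n E Gb +
      surfMeasure n E {x ∈ ρ '' K | x ∉ ρ '' Kb ∧ x ∉ Gb} := by
    refine (measure_mono (t := ρ '' Kb ∪ Gb ∪ {x ∈ ρ '' K | x ∉ ρ '' Kb ∧ x ∉ Gb}) ?_).trans
      ((measure_union_le _ _).trans (add_le_add_left (measure_union_le _ _) _))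
    intro x hx
    by_cases h1 : x ∈ ρ '' Kb
    · exact Or.inl (Or.inl h1)
    by_cases h2 : x ∈ Gb
    · exact Or.inl (Or.inr h2)
    · exact Or.inr ⟨hx, h1, h2⟩
  rw [ENNReal.ofReal_mul hc.le] at hKc
  have key := le_of_quarters hc hs' hKc hsub hKb' hGb'
  rw [ENNReal.ofReal_mul (by positivity)]
  refine key.trans (measure_mono ?_)
  rintro _ ⟨⟨u, hu, rfl⟩, h1, h2⟩
  refine ⟨hKS ⟨u, hu, rfl⟩, ?_⟩
  have hV : scaleCount Vd j u ≤ N₂ := by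
    by_contra hc
    exact h1 ⟨u, ⟨hu, (not_le.1 hc).le⟩, rfl⟩
  have hE' : scaleCount Ed j (ρ u) ≤ N₃ := by
    by_contra hc
    exact h2 ⟨⟨u, hu, rfl⟩, (not_le.1 hc).le⟩
  push_cast
  refine le_trans ?_ (add_le_add (add_le_add (hKN u hu) hV) hE')
  unfold scaleCount
  rw [← ENNReal.tsum_add, ← ENNReal.tsum_add]
  refine ENNReal.tsum_le_tsum fun i : ℕ => ?_
  by_cases hf : FlatAt E Λ η (ρ u) (2 ^ (-(j + i : ℤ)))
  · rw [indicator_of_notMem (by simpa using hf)]; exact zero_le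
  by_cases a1 : u ∈ U (j + i)
  · rw [indicator_of_mem a1, add_assoc]
    exact (indicator_le_self' (by simp) _).trans le_self_add
  by_cases a2 : u ∈ Vd (j + i)
  · rw [indicator_of_mem a2, add_right_comm]
    exact (indicator_le_self' (by simp) _).trans le_add_self
  by_cases a3 : ρ u ∈ Ed (j + i)
  · rw [indicator_of_mem a3]
    exact (indicator_le_self' (by simp) _).trans le_add_self
  exfalso
  apply hf
  obtain ⟨L, hL, hL2⟩ := hKL u hu (j + i) (by omega) a1
  refine flatAt_of_affine hρ (hKS.trans hSE) hu hδ hδ1 hτ0 (by linarith) (by positivity) hΛ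
    (Λ₁ := Λ₁) ?_ hτη hL hL2 hbi ?_ ?_
  · exact lt_of_lt_of_le (by linarith) (le_max_right _ _)
  · intro v hv
    by_contra hc
    exact a2 ⟨v, not_le.1 hc, hv⟩
  · intro y hy hv
    by_contra hc
    exact a3 ⟨y, ⟨hy, not_le.1 hc⟩, hv⟩

/-- Uniform rectifiability implies the weak half-space approximation property. -/
theorem packed_not_localWHSA {n : ℕ} {C : ℝ} {E : Set (ES n)} (hE : Regular n C E)
    (D : DyadicSystem n E) {θ M₀ : ℝ} (hUR : IsUR n θ M₀ E) {ε : ℝ} (hε : 0 < ε) (hε1 : ε ≤ 1) :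
    ∃ A : ℝ, PackedBy E D (fun k Q => ¬ LocalWHSA E D 1 ε k Q) A := by
  obtain ⟨hθ, -, hUR⟩ := hUR
  have ha := D.a₀_pos
  have hCs := D.Cstar_pos
  have hC := hE.ad.pos
  obtain ⟨m, hm⟩ := pow_unbounded_of_one_lt (2 * D.a₀) (one_lt_two : (1 : ℝ) < 2)
  set Λ : ℝ := ε ^ (-2 : ℤ) + D.Cstar + 1 with hΛ
  obtain ⟨N, c, hc, hN⟩ := exists_flat_bigPiece hE M₀.toNNReal (Λ := Λ) (η := ε / 2) (θ := θ)
    (B := 2 ^ m / D.a₀) (by positivity) (by positivity) hθ (by positivity)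
  have hdiam : EMetric.diam E = ⊤ := by
    by_contra h
    exact hE.unbdd (Metric.isBounded_iff_ediam_ne_top.2 h)
  suffices hyp : ∀ k, ∀ Q ∈ D.cubes k,
      ENNReal.ofReal (c * D.a₀ ^ n / (C * (2 * D.Cstar) ^ n)) * surfMeasure n E Q ≤
        surfMeasure n E {x ∈ Q |
          scaleCount (D.family fun k Q => ¬ LocalWHSA E D 1 ε k Q) k x ≤ N} by
    obtain ⟨A, hA, hcarl⟩ := DyadicSystem.carleson_of_bigPieces (D := D)
      (P := fun k Q => ¬ LocalWHSA E D 1 ε k Q) hE (N := N)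
      (ENNReal.ofReal_pos.2 (by positivity)).ne' hyp
    exact D.packedBy_of_carleson hE hA hcarl
  intro j Q hQ
  have ht : (0 : ℝ) < 2 ^ (-j) := by positivity
  set r : ℝ := D.a₀ * 2 ^ (-j) with hr
  have hr0 : 0 < r := by positivity
  obtain ⟨ρ, hρ, hρm⟩ := hUR (D.center Q) (D.center_mem_E hQ) r hr0 (by rw [hdiam]; simp)
  have e : (2 : ℝ) ^ (-(j - m)) = 2 ^ m * 2 ^ (-j) := by
    rw [neg_sub, sub_eq_add_neg, zpow_add₀ two_ne_zero, zpow_natCast]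
  have key := hN ρ r (j - m) hρ hr0 (by rw [e, hr]; nlinarith)
    (by rw [e, hr]; apply le_of_eq; field_simp)
    (E ∩ ball (D.center Q) r ∩ ρ '' ball 0 r) (fun x hx => hx.1.1) (fun x hx => hx.2) (by
      rw [surfMeasure_apply hE.closed, inter_eq_self_of_subset_left fun x hx => hx.1.1]
      exact hρm)
  calc ENNReal.ofReal (c * D.a₀ ^ n / (C * (2 * D.Cstar) ^ n)) * surfMeasure n E Q
      ≤ ENNReal.ofReal (c * D.a₀ ^ n / (C * (2 * D.Cstar) ^ n)) *
        ENNReal.ofReal (C * (2 * D.Cstar * 2 ^ (-j)) ^ n) := by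
        gcongr
        exact D.measure_le hE hQ
    _ = ENNReal.ofReal (c * r ^ n) := by
        rw [← ENNReal.ofReal_mul (by positivity)]
        congr 1
        rw [hr]; simp only [mul_pow]; field_simp
    _ ≤ _ := key
    _ ≤ _ := by
        refine measure_mono fun x hx => ⟨D.contains_ball j Q hQ hx.1.1, ?_⟩
        have h1 := scaleCount_add_nat (fun k => {x | ¬ FlatAt E Λ (ε / 2) x (2 ^ (-k))}) (j - m) m x
        rw [sub_add_cancel] at h1
        refine le_trans ?_ (h1.trans hx.2)
        refine scaleCount_mono (fun k => ?_) j x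
        rintro y ⟨hyE, hy⟩ hf
        exact hy (localWHSA_of_flat D hε hε1 le_rfl (D.cubeAt_mem k hyE) (D.mem_cubeAt k hyE) hf)

/-- The sine of the angle between the lines spanned by two unit vectors. -/
def tilt {n : ℕ} (N N' : ES n) : ℝ := ‖N' - ⟪N, N'⟫_ℝ • N‖

section tilt
variable {n : ℕ} {N N' N'' : ES n}

theorem tilt_nonneg : 0 ≤ tilt N N' := norm_nonneg _

theorem tilt_sq (hN : ‖N‖ = 1) (hN' : ‖N'‖ = 1) : tilt N N' ^ 2 = 1 - ⟪N, N'⟫_ℝ ^ 2 := by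
  rw [tilt, norm_sub_sq_real, norm_smul, hN, hN', inner_smul_right, real_inner_comm,
    Real.norm_eq_abs, mul_one, sq_abs]
  ring

theorem tilt_comm (hN : ‖N‖ = 1) (hN' : ‖N'‖ = 1) : tilt N N' = tilt N' N := by
  rw [← sq_eq_sq₀ tilt_nonneg tilt_nonneg, tilt_sq hN hN', tilt_sq hN' hN, real_inner_comm]

theorem tilt_self (hN : ‖N‖ = 1) : tilt N N = 0 := by
  simp [tilt, hN]

theorem norm_sub_inner_smul_le (hN : ‖N‖ = 1) (w : ES n) : ‖w - ⟪N, w⟫_ℝ • N‖ ≤ ‖w‖ := by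
  rw [← sq_le_sq₀ (norm_nonneg _) (norm_nonneg _), norm_sub_sq_real, norm_smul, hN,
    inner_smul_right, real_inner_comm, Real.norm_eq_abs, mul_one, sq_abs]
  nlinarith [sq_nonneg ⟪N, w⟫_ℝ]

theorem tilt_triangle (hN : ‖N‖ = 1) (hN' : ‖N'‖ = 1) (hN'' : ‖N''‖ = 1) :
    tilt N N'' ≤ tilt N N' + tilt N' N'' := by
  have e : N'' - ⟪N, N''⟫_ℝ • N = ⟪N', N''⟫_ℝ • (N' - ⟪N, N'⟫_ℝ • N) +
      ((N'' - ⟪N', N''⟫_ℝ • N') - ⟪N, N'' - ⟪N', N''⟫_ℝ • N'⟫_ℝ • N) := by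
    rw [inner_sub_right, inner_smul_right]; module
  unfold tilt
  rw [e]
  refine (norm_add_le _ _).trans (add_le_add ?_ (norm_sub_inner_smul_le hN _))
  rw [norm_smul]
  refine mul_le_of_le_one_left (norm_nonneg _) ?_
  have := norm_inner_le_norm (𝕜 := ℝ) N' N''
  rwa [hN', hN'', mul_one] at this

theorem abs_inner_le_add_tilt (hN : ‖N‖ = 1) (hN' : ‖N'‖ = 1) (w : ES n) :
    |⟪N', w⟫_ℝ| ≤ |⟪N, w⟫_ℝ| + tilt N N' * ‖w‖ := by
  have e : ⟪N', w⟫_ℝ = ⟪N, N'⟫_ℝ * ⟪N, w⟫_ℝ + ⟪N' - ⟪N, N'⟫_ℝ • N, w⟫_ℝ := by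
    rw [inner_sub_left, inner_smul_left]; simp
  rw [e]
  refine (abs_add_le _ _).trans (add_le_add ?_ (abs_real_inner_le_norm _ _))
  rw [abs_mul]
  refine mul_le_of_le_one_left (abs_nonneg _) ?_
  have := abs_real_inner_le_norm N N'
  rwa [hN, hN', mul_one] at this

theorem tilt_mul_le (hN : ‖N‖ = 1) {ρ e : ℝ} (hρ : 0 ≤ ρ)
    (he : 0 ≤ e) (h : ∀ v : ES n, ⟪N, v⟫_ℝ = 0 → ‖v‖ ≤ ρ → ⟪N', v⟫_ℝ ≤ e) : tilt N N' * ρ ≤ e := by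
  rcases (tilt_nonneg (N := N) (N' := N')).eq_or_lt with h0 | h0
  · rw [← h0, zero_mul]; exact he
  set b := N' - ⟪N, N'⟫_ℝ • N with hb
  have hb0 : 0 < ‖b‖ := h0
  have hNb : ⟪N, b⟫_ℝ = 0 := by
    rw [hb, inner_sub_right, inner_smul_right, real_inner_self_eq_norm_sq, hN]; ring
  have h1 := h ((ρ / ‖b‖) • b) (by rw [inner_smul_right, hNb, mul_zero]) (by
    rw [norm_smul, Real.norm_of_nonneg (by positivity)]
    exact (div_mul_cancel₀ _ hb0.ne').le)
  have h2 : ⟪N', b⟫_ℝ = ‖b‖ ^ 2 := by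
    rw [← real_inner_self_eq_norm_sq]
    conv_rhs => rw [hb, inner_sub_left, inner_smul_left, ← hb, hNb]
    simp
  rw [inner_smul_right, h2] at h1
  calc tilt N N' * ρ = ρ / ‖b‖ * ‖b‖ ^ 2 := by
        change ‖b‖ * ρ = _
        field_simp
    _ ≤ e := h1

theorem one_half_le_abs_inner (hN : ‖N‖ = 1) (hN' : ‖N'‖ = 1) (h : tilt N N' ≤ 3 / 4) :
    1 / 2 ≤ |⟪N, N'⟫_ℝ| := by
  have h1 := tilt_sq hN hN'
  rw [← sq_abs ⟪N, N'⟫_ℝ] at h1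
  nlinarith [tilt_nonneg (N := N) (N' := N'), abs_nonneg ⟪N, N'⟫_ℝ]

theorem exists_proj_lift (hN : ‖N‖ = 1) :
    ∃ p : (ES n →ₗ[ℝ] EuclideanSpace ℝ (Fin n)) × (EuclideanSpace ℝ (Fin n) →ₗ[ℝ] ES n),
      (∀ v, p.1 (p.2 v) = v) ∧ (∀ x, p.2 (p.1 x) = x - ⟪N, x⟫_ℝ • N) ∧ ∀ v, ‖p.2 v‖ = ‖v‖ := by
  have hN0 : N ≠ 0 := by rintro rfl; simp at hN
  have hfin : Module.finrank ℝ (Submodule.span ℝ {N})ᗮ = n := by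
    have h8 := Submodule.finrank_add_finrank_orthogonal (Submodule.span ℝ {N})
    rw [finrank_span_singleton hN0, finrank_euclideanSpace_fin] at h8
    omega
  let b := stdOrthonormalBasis ℝ (Submodule.span ℝ {N})ᗮ
  let e : (Submodule.span ℝ {N})ᗮ ≃ₗᵢ[ℝ] EuclideanSpace ℝ (Fin n) :=
    (b.reindex (finCongr hfin)).repr
  let P := (Submodule.span ℝ {N})ᗮ.orthogonalProjection
  refine ⟨(e.toLinearEquiv.toLinearMap ∘ₗ P.toLinearMap,
    (Submodule.subtype _) ∘ₗ e.symm.toLinearEquiv.toLinearMap), fun v => ?_, fun x => ?_, fun v => ?_⟩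
  · simp [P]
  · have : ((P x : (Submodule.span ℝ {N})ᗮ) : ES n) = x - ⟪N, x⟫_ℝ • N := by
      have h1 := Submodule.starProjection_orthogonal_val (K := Submodule.span ℝ {N}) x
      rw [Submodule.starProjection_unit_singleton ℝ hN] at h1
      exact h1
    simpa using this
  · exact e.symm.norm_map v

/-- A linear map onto `ℝⁿ` which is isometric on the orthogonal complement of `N` and kills `N`. -/
def proj (N : ES n) : ES n →ₗ[ℝ] EuclideanSpace ℝ (Fin n) :=
  if h : ‖N‖ = 1 then (exists_proj_lift h).choose.1 else 0

/-- The isometric section of `proj N`. -/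
def lift (N : ES n) : EuclideanSpace ℝ (Fin n) →ₗ[ℝ] ES n :=
  if h : ‖N‖ = 1 then (exists_proj_lift h).choose.2 else 0

theorem proj_lift (hN : ‖N‖ = 1) (v : EuclideanSpace ℝ (Fin n)) : proj N (lift N v) = v := by
  simp only [proj, lift, hN, dif_pos]
  exact (exists_proj_lift hN).choose_spec.1 v

theorem lift_proj (hN : ‖N‖ = 1) (x : ES n) : lift N (proj N x) = x - ⟪N, x⟫_ℝ • N := by
  simp only [proj, lift, hN, dif_pos]
  exact (exists_proj_lift hN).choose_spec.2.1 x

theorem norm_lift (hN : ‖N‖ = 1) (v : EuclideanSpace ℝ (Fin n)) : ‖lift N v‖ = ‖v‖ := by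
  simp only [lift, hN, dif_pos]
  exact (exists_proj_lift hN).choose_spec.2.2 v

theorem norm_proj_sq (hN : ‖N‖ = 1) (x : ES n) : ‖proj N x‖ ^ 2 = ‖x‖ ^ 2 - ⟪N, x⟫_ℝ ^ 2 := by
  rw [← norm_lift hN, lift_proj hN, norm_sub_sq_real, norm_smul, hN,
    inner_smul_right, real_inner_comm, Real.norm_eq_abs, mul_one, sq_abs]
  ring

theorem norm_proj_le (hN : ‖N‖ = 1) (x : ES n) : ‖proj N x‖ ≤ ‖x‖ := by
  rw [← sq_le_sq₀ (norm_nonneg _) (norm_nonneg _), norm_proj_sq hN]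
  nlinarith [sq_nonneg ⟪N, x⟫_ℝ]

theorem dist_proj_le (hN : ‖N‖ = 1) (x y : ES n) : dist (proj N x) (proj N y) ≤ dist x y := by
  rw [dist_eq_norm, dist_eq_norm, ← map_sub]; exact norm_proj_le hN _

theorem proj_self (hN : ‖N‖ = 1) : proj N N = 0 := by
  have := norm_proj_sq hN N
  rw [real_inner_self_eq_norm_sq, hN] at this
  simpa using this

theorem abs_det_le_prod {F : Type*} [NormedAddCommGroup F] [InnerProductSpace ℝ F]
    [FiniteDimensional ℝ F] {m : ℕ} (b : OrthonormalBasis (Fin m) ℝ F) (f : F →ₗ[ℝ] F) :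
    |LinearMap.det f| ≤ ∏ i, ‖f (b i)‖ := by
  have hfact : Fact (Module.finrank ℝ F = m) := ⟨by
    rw [Module.finrank_eq_card_basis b.toBasis, Fintype.card_fin]⟩
  have hv1 : b.toBasis.orientation.volumeForm = b.toBasis.det :=
    b.toBasis.orientation.volumeForm_robust b rfl
  have h1 := b.toBasis.orientation.abs_volumeForm_apply_le fun i => f (b.toBasis i)
  have h2 : b.toBasis.det (fun i => f (b.toBasis i)) = LinearMap.det f * b.toBasis.det b.toBasis :=
    Module.Basis.det_comp b.toBasis f b.toBasis
  rw [Module.Basis.det_self, mul_one] at h2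
  rw [hv1, h2] at h1
  simpa using h1

theorem abs_det_proj_lift_le (hn : 0 < n) (hN : ‖N‖ = 1) (hN' : ‖N'‖ = 1) :
    |LinearMap.det (proj N ∘ₗ lift N')| ≤ |⟪N, N'⟫_ℝ| := by
  set f : EuclideanSpace ℝ (Fin n) →ₗ[ℝ] EuclideanSpace ℝ (Fin n) := proj N ∘ₗ lift N' with hf
  have hf1 : ∀ v, ‖f v‖ ≤ ‖v‖ := fun v => (norm_proj_le hN _).trans (norm_lift hN' v).le
  obtain ⟨v, hv, hfv⟩ : ∃ v, ‖v‖ = 1 ∧ ‖f v‖ ≤ |⟪N, N'⟫_ℝ| := by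
    have hs := tilt_sq hN' hN
    rw [real_inner_comm] at hs
    rcases (tilt_nonneg (N := N') (N' := N)).eq_or_lt with h0 | h0
    · refine ⟨EuclideanSpace.single ⟨0, hn⟩ 1, by simp, (hf1 _).trans ?_⟩
      have : |⟪N, N'⟫_ℝ| ^ 2 = 1 := by rw [sq_abs]; rw [← h0] at hs; linarith
      rw [(pow_eq_one_iff_of_nonneg (abs_nonneg _) two_ne_zero).1 this]; simp
    · have hb0 : 0 < ‖N - ⟪N', N⟫_ℝ • N'‖ := h0
      have hb1 : ‖N - ⟪N', N⟫_ℝ • N'‖ ^ 2 = 1 - ⟪N, N'⟫_ℝ ^ 2 := hs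
      set b := N - ⟪N', N⟫_ℝ • N' with hb
      have hlb : lift N' (proj N' b) = b := by
        rw [lift_proj hN', hb, inner_sub_right, inner_smul_right, real_inner_self_eq_norm_sq, hN']
        simp
      have hNb : ⟪N, b⟫_ℝ = ‖b‖ ^ 2 := by
        rw [hb1, hb, inner_sub_right, inner_smul_right, real_inner_self_eq_norm_sq, hN,
          real_inner_comm]
        ring
      have hpb : ‖proj N b‖ = |⟪N, N'⟫_ℝ| * ‖b‖ := by
        rw [← sq_eq_sq₀ (norm_nonneg _) (by positivity), norm_proj_sq hN, hNb, mul_pow, sq_abs]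
        have : ⟪N, N'⟫_ℝ ^ 2 = 1 - ‖b‖ ^ 2 := by rw [hb1]; ring
        rw [this]; ring
      refine ⟨‖b‖⁻¹ • proj N' b, ?_, ?_⟩
      · rw [norm_smul, ← norm_lift hN' (proj N' b), hlb, norm_inv, norm_norm,
          inv_mul_cancel₀ hb0.ne']
      · rw [map_smul, hf, LinearMap.comp_apply, hlb, norm_smul, hpb, norm_inv, norm_norm,
          mul_comm, mul_assoc, mul_inv_cancel₀ hb0.ne', mul_one]
  have hcard : Module.finrank ℝ (EuclideanSpace ℝ (Fin n)) = Fintype.card (Fin n) := by simp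
  have hort : Orthonormal ℝ (({⟨0, hn⟩} : Set (Fin n)).restrict fun _ => v) := by
    constructor
    · intro i; exact hv
    · intro i j hij; exact absurd (Subsingleton.elim i j) hij
  obtain ⟨b, hb⟩ := Orthonormal.exists_orthonormalBasis_extension_of_card_eq (𝕜 := ℝ) (v := fun _ => v) hcard hort
  have h1 := abs_det_le_prod b f
  refine h1.trans ?_
  rw [← Finset.mul_prod_erase _ _ (Finset.mem_univ (⟨0, hn⟩ : Fin n))]
  have h2 : ‖f (b ⟨0, hn⟩)‖ ≤ |⟪N, N'⟫_ℝ| := by rw [hb ⟨0, hn⟩ rfl]; exact hfv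
  have h3 : ∏ i ∈ Finset.univ.erase (⟨0, hn⟩ : Fin n), ‖f (b i)‖ ≤ 1 :=
    Finset.prod_le_one (fun _ _ => norm_nonneg _) fun i _ => (hf1 _).trans (b.norm_eq_one i).le
  exact (mul_le_of_le_one_right (norm_nonneg _) h3).trans h2

theorem volume_image_proj_lift_le (hn : 0 < n) (hN : ‖N‖ = 1) (hN' : ‖N'‖ = 1)
    (a : EuclideanSpace ℝ (Fin n)) (A : Set (EuclideanSpace ℝ (Fin n))) :
    volume ((fun v => a + proj N (lift N' v)) '' A) ≤
      ENNReal.ofReal |⟪N, N'⟫_ℝ| * volume A := by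
  have h1 := Measure.addHaar_image_linearMap volume (proj N ∘ₗ lift N') A
  have h2 : (fun v => a + proj N (lift N' v)) '' A = (fun v => a + v) '' ((proj N ∘ₗ lift N') '' A) := by
    rw [image_image]; rfl
  rw [h2, image_add_left, measure_preimage_add, h1]
  exact mul_le_mul_left (ENNReal.ofReal_le_ofReal (abs_det_proj_lift_le hn hN hN')) _

end tilt

theorem scaleCount_eq_add {S : Type*} (A : ℤ → Set S) (j : ℤ) (x : S) :
    scaleCount A j x = (A j).indicator 1 x + scaleCount A (j + 1) x := by
  unfold scaleCount
  rw [tsum_eq_zero_add' ENNReal.summable]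
  congr 1
  · simp
  · refine tsum_congr fun i => ?_
    push_cast
    rw [show j + ((i : ℤ) + 1) = j + 1 + i by ring]

theorem scaleCount_succ_le {S : Type*} (A : ℤ → Set S) (j : ℤ) (x : S) :
    scaleCount A (j + 1) x ≤ scaleCount A j x :=
  scaleCount_eq_add A j x ▸ le_add_self

theorem ENNReal.le_of_add_le_add_of_le {x y d e : ℝ≥0∞} (h : x + d ≤ y + e) (hed : e ≤ d)
    (hd : d ≠ ⊤) : x ≤ y :=
  (ENNReal.add_le_add_iff_right hd).1 (h.trans (add_le_add_right hed _))

/-- The states of a stopping time process running down the dyadic cubes. -/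
inductive StopState (V : Type*)
  | tree (v : V)
  | wait (i : ℕ)

/-- Stopping time rules: `Flat` cubes `Q` start a tree labelled `nrm k Q`, which continues
through the `good` cubes; the process pauses for `M` generations after a non-flat cube. -/
structure StopRule (n : ℕ) (V : Type*) where
  Flat : ℤ → Set (ES n) → Prop
  good : V → ℤ → Set (ES n) → Prop
  nrm : ℤ → Set (ES n) → V
  M : ℕ

namespace StopRule
variable {n : ℕ} {V : Type*} (r : StopRule n V) {E : Set (ES n)} (D : DyadicSystem n E)

open Classical in
/-- The state in which the process is started at a cube. -/
def root (k : ℤ) (Q : Set (ES n)) : StopState V :=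
  if r.Flat k Q then .tree (r.nrm k Q) else .wait r.M

/-- The process continues the present tree in the cube `Q`. -/
def Quiet (s : StopState V) (k : ℤ) (Q : Set (ES n)) : Prop :=
  match s with
  | .tree v => r.good v k Q
  | .wait _ => False

open Classical in
/-- The state of the process after entering the cube `Q`. -/
def step (s : StopState V) (k : ℤ) (Q : Set (ES n)) : StopState V :=
  match s with
  | .tree v => if r.good v k Q then .tree v else r.root k Q
  | .wait 0 => r.root k Q
  | .wait (i + 1) => .wait i

open Classical in
/-- The number of generations among the `m` ones following `k` which are not quiet. -/
def cnt : ℕ → StopState V → ℤ → ES n → ℝ≥0∞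
  | 0, _, _, _ => 0
  | m + 1, s, k, x => (if r.Quiet s (k + 1) (D.cubeAt (k + 1) x) then 0 else 1) +
      cnt m (r.step s (k + 1) (D.cubeAt (k + 1) x)) (k + 1) x

theorem cnt_wait_le (m i : ℕ) (k : ℤ) (x : ES n) : r.cnt D m (.wait i) k x ≤ (i + 1 : ℕ) +
    r.cnt D (m - (i + 1)) (r.root (k + i + 1) (D.cubeAt (k + i + 1) x)) (k + i + 1) x := by
  induction i generalizing m k with
  | zero =>
    cases m with
    | zero => simp [cnt]
    | succ m => simp [cnt, Quiet, step]
  | succ i ih =>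
    cases m with
    | zero => simp [cnt]
    | succ m =>
      have h1 := ih m (k + 1)
      rw [cnt, if_neg (by simp [Quiet]), step, show k + ((i + 1 : ℕ) : ℤ) + 1 = k + 1 + i + 1 by push_cast; ring,
        show m + 1 - (i + 1 + 1) = m - (i + 1) by omega]
      calc _ ≤ 1 + _ := add_le_add_right h1 _
        _ = _ := by rw [← add_assoc]; congr 1; push_cast; ring

/-- The hypotheses under which the number of non quiet generations is controlled. -/
structure Controlled (Bad : ℤ → Set (ES n) → Prop) (a : ℤ → Set (ES n) → ℝ≥0∞)
    (sh : V → ℤ → Set (ES n) → ℝ≥0∞) (cov : V → ℕ → ℤ → Set (ES n) → ℝ≥0∞)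
    (δ κ C₃ : ℝ≥0∞) : Prop where
  lt : κ < δ
  ne_top : C₃ ≠ ⊤
  ne_top' : δ ≠ ⊤
  good_nrm : ∀ k, ∀ Q ∈ D.cubes k, r.Flat k Q → r.good (r.nrm k Q) k Q
  a_zero : ∀ k, ∀ Q ∈ D.cubes k, ¬ r.Flat k Q → a k Q = 0
  le_a : ∀ k, ∀ Q ∈ D.cubes k, r.Flat k Q → δ * surfMeasure n E Q ≤ a k Q
  sh_le : ∀ v k, ∀ Q ∈ D.cubes k, r.good v k Q → cov v 0 k Q ≤ C₃ * surfMeasure n E Q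
  sh_le' : ∀ v k, ∀ Q ∈ D.cubes k, r.good v k Q → ∀ R ∈ D.cubes (k + 1), R ⊆ Q →
    sh v (k + 1) R ≤ C₃ * surfMeasure n E R
  a_le_cov : ∀ m k, ∀ Q ∈ D.cubes k, r.Flat k Q →
    a k Q ≤ cov (r.nrm k Q) m k Q + κ * surfMeasure n E Q
  cov_succ : ∀ v m k, ∀ Q ∈ D.cubes k, r.good v k Q →
    ∃ w : Set (ES n) → ℝ≥0∞, cov v (m + 1) k Q ≤
      ∑' R : {R | R ∈ D.cubes (k + 1) ∧ R ⊆ Q}, w R.1 ∧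
    ∀ R, (r.good v (k + 1) R → w R ≤ cov v m (k + 1) R) ∧
      (¬ r.good v (k + 1) R → w R ≤ sh v (k + 1) R)
  leave : ∀ v k, ∀ Q ∈ D.cubes k, r.good v k Q → ∀ R ∈ D.cubes (k + 1), R ⊆ Q →
    r.Flat (k + 1) R → ¬ r.good v (k + 1) R →
    sh v (k + 1) R + δ * surfMeasure n E R ≤ a (k + 1) R
  descend : ∀ k, ∀ Q ∈ D.cubes k, ¬ r.Flat k Q → ¬ Bad k Q →
    ∀ R ∈ D.cubes (k + r.M + 1), R ⊆ Q → r.Flat (k + r.M + 1) R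
  leave_mid : ∀ v k, ∀ Q ∈ D.cubes k, r.good v k Q → ∀ R ∈ D.cubes (k + 1), R ⊆ Q →
    ¬ r.Flat (k + 1) R → ¬ Bad (k + 1) R →
    sh v (k + 1) R + δ * surfMeasure n E R ≤
      ∑' T : {T | T ∈ D.cubes (k + 1 + r.M + 1) ∧ T ⊆ R}, a (k + 1 + r.M + 1) T.1

variable {r D} {Bad : ℤ → Set (ES n) → Prop} {a : ℤ → Set (ES n) → ℝ≥0∞}
    {sh : V → ℤ → Set (ES n) → ℝ≥0∞} {cov : V → ℕ → ℤ → Set (ES n) → ℝ≥0∞} {δ κ C₃ : ℝ≥0∞}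

theorem Controlled.wait_le (h : r.Controlled D Bad a sh cov δ κ C₃) {c C₄ : ℝ≥0∞} (m : ℕ)
    (k : ℤ) {Q : Set (ES n)} (hQ : Q ∈ D.cubes k)
    (ih : ∀ R ∈ D.cubes (k + r.M + 1), c * ∫⁻ x in R, r.cnt D (m - (r.M + 1))
        (r.root (k + r.M + 1) R) (k + r.M + 1) x ∂(surfMeasure n E) + a (k + r.M + 1) R ≤
      (C₃ + κ) * surfMeasure n E R + C₄ * ∫⁻ x in R, scaleCount (D.family Bad) (k + r.M + 1) x
        ∂(surfMeasure n E)) :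
    c * ∫⁻ x in Q, r.cnt D m (.wait r.M) k x ∂(surfMeasure n E) +
      ∑' T : {T | T ∈ D.cubes (k + r.M + 1) ∧ T ⊆ Q}, a (k + r.M + 1) T.1 ≤
    (c * (r.M + 1) + C₃ + κ) * surfMeasure n E Q +
      C₄ * ∫⁻ x in Q, scaleCount (D.family Bad) (k + 1) x ∂(surfMeasure n E) := by
  set σ := surfMeasure n E
  have hk : k ≤ k + r.M + 1 := by omega
  have hsum : ∀ c' : ℝ≥0∞, c' * σ Q = ∑' T : {T | T ∈ D.cubes (k + r.M + 1) ∧ T ⊆ Q}, c' * σ T.1 := by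
    intro c'
    have := D.lintegral_eq_tsum hk hQ σ fun _ => c'
    simpa using this
  have hs1 : ∫⁻ x in Q, scaleCount (D.family Bad) (k + r.M + 1) x ∂σ ≤
      ∫⁻ x in Q, scaleCount (D.family Bad) (k + 1) x ∂σ := by
    refine lintegral_mono fun x => ?_
    rw [show k + (r.M : ℤ) + 1 = k + 1 + (r.M : ℕ) by ring]
    exact scaleCount_add_nat _ _ _ _
  calc _ ≤ ∑' T : {T | T ∈ D.cubes (k + r.M + 1) ∧ T ⊆ Q},
        ((c * (r.M + 1)) * σ T.1 + ((C₃ + κ) * σ T.1 +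
          C₄ * ∫⁻ x in T.1, scaleCount (D.family Bad) (k + r.M + 1) x ∂σ)) := by
        rw [D.lintegral_eq_tsum hk hQ, ← ENNReal.tsum_mul_left, ← ENNReal.tsum_add]
        refine ENNReal.tsum_le_tsum fun T => ?_
        have h1 : ∫⁻ x in T.1, r.cnt D m (.wait r.M) k x ∂σ ≤ ∫⁻ x in T.1, ((r.M + 1 : ℝ≥0∞) +
            r.cnt D (m - (r.M + 1)) (r.root (k + r.M + 1) T.1) (k + r.M + 1) x) ∂σ := by
          refine setLIntegral_mono' (D.borel _ _ T.2.1) fun x hx => ?_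
          have := r.cnt_wait_le D m r.M k x
          rw [D.cubeAt_eq T.2.1 hx] at this
          simpa using this
        rw [lintegral_add_left measurable_const, setLIntegral_const] at h1
        calc _ ≤ c * ((r.M + 1) * σ T.1 + _) + a (k + r.M + 1) T.1 :=
              add_le_add_left (mul_le_mul_right h1 _) _
          _ = c * (r.M + 1) * σ T.1 + (c * _ + a (k + r.M + 1) T.1) := by ring
          _ ≤ _ := add_le_add_right (ih T.1 T.2.1) _
    _ = (c * (r.M + 1) + C₃ + κ) * σ Q +
        C₄ * ∫⁻ x in Q, scaleCount (D.family Bad) (k + r.M + 1) x ∂σ := by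
        rw [ENNReal.tsum_add, ENNReal.tsum_add, ← hsum, ← hsum, ENNReal.tsum_mul_left,
          ← D.lintegral_eq_tsum hk hQ]
        ring
    _ ≤ _ := add_le_add_right (mul_le_mul_right hs1 _) _

theorem Controlled.main {C : ℝ} (hE : Regular n C E) (h : r.Controlled D Bad a sh cov δ κ C₃) {c : ℝ≥0∞}
    (hc : c * (r.M + 2) + κ ≤ δ) (m : ℕ) :
    (∀ v k, ∀ Q ∈ D.cubes k, r.good v k Q →
      c * ∫⁻ x in Q, r.cnt D m (.tree v) k x ∂(surfMeasure n E) + cov v m k Q ≤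
      C₃ * surfMeasure n E Q + (C₃ + δ) * ∫⁻ x in Q, scaleCount (D.family Bad) k x
        ∂(surfMeasure n E)) ∧
    ∀ k, ∀ Q ∈ D.cubes k,
      c * ∫⁻ x in Q, r.cnt D m (r.root k Q) k x ∂(surfMeasure n E) + a k Q ≤
      (C₃ + κ) * surfMeasure n E Q + (C₃ + δ) * ∫⁻ x in Q, scaleCount (D.family Bad) k x
        ∂(surfMeasure n E) := by
  induction m using Nat.strong_induction_on with
  | _ m ih =>
  set σ := surfMeasure n E with hσ
  have hc1 : c * (r.M + 1) ≤ δ := by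
    refine le_trans ?_ (le_self_add.trans hc)
    gcongr; norm_num
  have bad_sc : ∀ k, ∀ Q ∈ D.cubes k, Bad k Q → ∫⁻ x in Q, scaleCount (D.family Bad) k x ∂σ =
      σ Q + ∫⁻ x in Q, scaleCount (D.family Bad) (k + 1) x ∂σ := by
    intro k Q hQ hb
    rw [← setLIntegral_one, ← lintegral_add_left measurable_const]
    refine setLIntegral_congr_fun (D.borel _ _ hQ) fun x hx => ?_
    rw [scaleCount_eq_add, indicator_of_mem ((D.mem_family_of_mem hQ hx).2 hb)]
    rfl
  have sc_mono : ∀ k (Q : Set (ES n)), ∫⁻ x in Q, scaleCount (D.family Bad) (k + 1) x ∂σ ≤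
      ∫⁻ x in Q, scaleCount (D.family Bad) k x ∂σ := fun k Q =>
    lintegral_mono fun x => scaleCount_succ_le _ _ _
  have hP : ∀ v k, ∀ Q ∈ D.cubes k, r.good v k Q →
      c * ∫⁻ x in Q, r.cnt D m (.tree v) k x ∂σ + cov v m k Q ≤
      C₃ * σ Q + (C₃ + δ) * ∫⁻ x in Q, scaleCount (D.family Bad) k x ∂σ := by
    intro v k Q hQ hg
    cases m with
    | zero =>
      simp only [cnt, lintegral_zero, mul_zero, zero_add]
      exact (h.sh_le v k Q hQ hg).trans le_self_add
    | succ m =>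
      obtain ⟨w, hw, hw'⟩ := h.cov_succ v m k Q hQ hg
      have hk : k ≤ k + 1 := by omega
      have hsum : ∀ c' : ℝ≥0∞, c' * σ Q = ∑' T : {T | T ∈ D.cubes (k + 1) ∧ T ⊆ Q}, c' * σ T.1 := by
        intro c'
        have := D.lintegral_eq_tsum hk hQ σ fun _ => c'
        simpa using this
      have key : ∀ R ∈ D.cubes (k + 1), R ⊆ Q →
          c * ∫⁻ x in R, r.cnt D (m + 1) (.tree v) k x ∂σ + w R ≤
          C₃ * σ R + (C₃ + δ) * ∫⁻ x in R, scaleCount (D.family Bad) (k + 1) x ∂σ := by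
        intro R hR hRQ
        by_cases hgR : r.good v (k + 1) R
        · have e : ∫⁻ x in R, r.cnt D (m + 1) (.tree v) k x ∂σ =
              ∫⁻ x in R, r.cnt D m (.tree v) (k + 1) x ∂σ := by
            refine setLIntegral_congr_fun (D.borel _ _ hR) fun x hx => ?_
            simp [cnt, Quiet, step, D.cubeAt_eq hR hx, hgR]
          rw [e]
          exact (add_le_add_right ((hw' R).1 hgR) _).trans
            ((ih m (Nat.lt_succ_self m)).1 v (k + 1) R hR hgR)
        · have e : ∫⁻ x in R, r.cnt D (m + 1) (.tree v) k x ∂σ =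
              σ R + ∫⁻ x in R, r.cnt D m (r.root (k + 1) R) (k + 1) x ∂σ := by
            rw [← setLIntegral_one, ← lintegral_add_left measurable_const]
            refine setLIntegral_congr_fun (D.borel _ _ hR) fun x hx => ?_
            simp [cnt, Quiet, step, D.cubeAt_eq hR hx, hgR]
          rw [e]
          refine (add_le_add_right ((hw' R).2 hgR) _).trans ?_
          have hfin : δ * σ R ≠ ⊤ := ENNReal.mul_ne_top h.ne_top' (D.measure_ne_top hE hR)
          by_cases hfl : r.Flat (k + 1) R
          · have h1 := (ih m (Nat.lt_succ_self m)).2 (k + 1) R hR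
            have h2 := h.leave v k Q hQ hg R hR hRQ hfl hgR
            refine ENNReal.le_of_add_le_add_of_le (d := δ * σ R) (e := (c + κ) * σ R) ?_
              (mul_le_mul_left (le_trans (add_le_add_left (le_mul_of_one_le_right (zero_le)
                (le_trans one_le_two le_add_self)) _) hc) _) hfin
            calc _ = c * σ R + (c * ∫⁻ x in R, r.cnt D m (r.root (k + 1) R) (k + 1) x ∂σ +
                  (sh v (k + 1) R + δ * σ R)) := by ring
              _ ≤ c * σ R + _ := add_le_add_right ((add_le_add_right h2 _).trans h1) _
              _ = _ := by ring
          · have h1 := h.wait_le (c := c) (C₄ := C₃ + δ) m (k + 1) hR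
              ((ih (m - (r.M + 1)) (by omega)).2 _)
            rw [root, if_neg hfl]
            by_cases hb : Bad (k + 1) R
            · have h2 := h.sh_le' v k Q hQ hg R hR hRQ
              rw [bad_sc _ _ hR hb]
              calc _ = c * σ R + c * (∫⁻ x in R, r.cnt D m (.wait r.M) (k + 1) x ∂σ) +
                    sh v (k + 1) R := by ring
                _ ≤ c * σ R + ((c * (r.M + 1) + C₃ + κ) * σ R + (C₃ + δ) *
                    ∫⁻ x in R, scaleCount (D.family Bad) (k + 1 + 1) x ∂σ) + C₃ * σ R :=
                  add_le_add (add_le_add_right (le_self_add.trans h1) _) h2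
                _ = (c * (r.M + 2) + κ) * σ R + ((C₃ + C₃) * σ R + (C₃ + δ) *
                    ∫⁻ x in R, scaleCount (D.family Bad) (k + 1 + 1) x ∂σ) := by ring
                _ ≤ δ * σ R + _ := add_le_add_left (mul_le_mul_left hc _) _
                _ = _ := by ring
            · have h2 := h.leave_mid v k Q hQ hg R hR hRQ hfl hb
              refine ENNReal.le_of_add_le_add_of_le (d := δ * σ R)
                (e := (c * (r.M + 2) + κ) * σ R) ?_ (mul_le_mul_left hc _) hfin
              calc _ = c * σ R + (c * (∫⁻ x in R, r.cnt D m (.wait r.M) (k + 1) x ∂σ) +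
                    (sh v (k + 1) R + δ * σ R)) := by ring
                _ ≤ c * σ R + ((c * (r.M + 1) + C₃ + κ) * σ R + (C₃ + δ) *
                    ∫⁻ x in R, scaleCount (D.family Bad) (k + 1 + 1) x ∂σ) :=
                  add_le_add_right ((add_le_add_right h2 _).trans h1) _
                _ ≤ c * σ R + ((c * (r.M + 1) + C₃ + κ) * σ R + (C₃ + δ) *
                    ∫⁻ x in R, scaleCount (D.family Bad) (k + 1) x ∂σ) := by
                  gcongr c * σ R + (_ + _ * ?_)
                  exact sc_mono _ _
                _ = _ := by ring
      calc _ ≤ ∑' R : {R | R ∈ D.cubes (k + 1) ∧ R ⊆ Q}, (c * ∫⁻ x in R.1, r.cnt D (m + 1) (.tree v) k x ∂σ + w R.1) := by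
            rw [ENNReal.tsum_add, ENNReal.tsum_mul_left, ← D.lintegral_eq_tsum hk hQ]
            exact add_le_add_right hw _
        _ ≤ ∑' R : {R | R ∈ D.cubes (k + 1) ∧ R ⊆ Q}, (C₃ * σ R.1 + (C₃ + δ) *
            ∫⁻ x in R.1, scaleCount (D.family Bad) (k + 1) x ∂σ) :=
            ENNReal.tsum_le_tsum fun R => key R.1 R.2.1 R.2.2
        _ = C₃ * σ Q + (C₃ + δ) * ∫⁻ x in Q, scaleCount (D.family Bad) (k + 1) x ∂σ := by
            rw [ENNReal.tsum_add, ENNReal.tsum_mul_left, ENNReal.tsum_mul_left, ← D.lintegral_eq_tsum hk hQ, hsum,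
              ENNReal.tsum_mul_left]
        _ ≤ _ := add_le_add_right (mul_le_mul_right (sc_mono k Q) _) _
  refine ⟨hP, fun k Q hQ => ?_⟩
  by_cases hfl : r.Flat k Q
  · have h1 := hP (r.nrm k Q) k Q hQ (h.good_nrm k Q hQ hfl)
    have h2 := h.a_le_cov m k Q hQ hfl
    rw [root, if_pos hfl]
    calc _ ≤ c * ∫⁻ x in Q, r.cnt D m (.tree (r.nrm k Q)) k x ∂σ +
          (cov (r.nrm k Q) m k Q + κ * σ Q) := add_le_add_right h2 _
      _ = (c * ∫⁻ x in Q, r.cnt D m (.tree (r.nrm k Q)) k x ∂σ + cov (r.nrm k Q) m k Q) +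
          κ * σ Q := by ring
      _ ≤ _ := add_le_add_left h1 _
      _ = _ := by ring
  · rw [h.a_zero k Q hQ hfl, add_zero, root, if_neg hfl]
    cases m with
    | zero => simp [cnt]
    | succ m =>
      have h1 := h.wait_le (c := c) (C₄ := C₃ + δ) (m + 1) k hQ
        ((ih (m + 1 - (r.M + 1)) (by omega)).2 _)
      by_cases hb : Bad k Q
      · rw [bad_sc _ _ hQ hb]
        refine (le_self_add.trans h1).trans ?_
        calc _ ≤ (δ + C₃ + κ) * σ Q + (C₃ + δ) *
              ∫⁻ x in Q, scaleCount (D.family Bad) (k + 1) x ∂σ := by gcongr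
          _ ≤ ((δ + C₃ + κ) * σ Q + (C₃ + δ) *
              ∫⁻ x in Q, scaleCount (D.family Bad) (k + 1) x ∂σ) + C₃ * σ Q := le_self_add
          _ = _ := by ring
      · have hT := h.descend k Q hQ hfl hb
        have h3 : δ * σ Q ≤ ∑' T : {T | T ∈ D.cubes (k + r.M + 1) ∧ T ⊆ Q},
            a (k + r.M + 1) T.1 := by
          have := D.lintegral_eq_tsum (show k ≤ k + r.M + 1 by omega) hQ σ fun _ => δ
          simp only [lintegral_const, Measure.restrict_apply MeasurableSet.univ, univ_inter] at this
          rw [this]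
          exact ENNReal.tsum_le_tsum fun T => h.le_a _ _ T.2.1 (hT _ T.2.1 T.2.2)
        refine ENNReal.le_of_add_le_add_of_le (d := δ * σ Q) (e := c * (r.M + 1) * σ Q) ?_
          (mul_le_mul_left hc1 _) (ENNReal.mul_ne_top h.ne_top' (D.measure_ne_top hE hQ))
        refine ((add_le_add_right h3 _).trans h1).trans ?_
        calc _ ≤ (c * (r.M + 1) + C₃ + κ) * σ Q + (C₃ + δ) *
              ∫⁻ x in Q, scaleCount (D.family Bad) k x ∂σ :=
              add_le_add_right (mul_le_mul_right (sc_mono k Q) _) _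
          _ = _ := by ring

theorem Controlled.exists_bound {C : ℝ} (hE : Regular n C E)
    (h : r.Controlled D Bad a sh cov δ κ C₃) {A : ℝ≥0∞} (hA : A ≠ ⊤)
    (hBad : D.Carleson (D.family Bad) A) : ∃ A' : ℝ≥0∞, A' ≠ ⊤ ∧ ∀ m k, ∀ Q ∈ D.cubes k,
      ∫⁻ x in Q, r.cnt D m (r.root k Q) k x ∂(surfMeasure n E) ≤ A' * surfMeasure n E Q := by
  have hκ : κ ≠ ⊤ := (h.lt.trans (lt_top_iff_ne_top.2 h.ne_top')).ne
  set c : ℝ≥0∞ := (δ - κ) / (r.M + 2) with hc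
  have hM : (r.M + 2 : ℝ≥0∞) ≠ ⊤ := by finiteness
  have hc0 : c ≠ 0 := ENNReal.div_ne_zero.2 ⟨(tsub_pos_of_lt h.lt).ne', hM⟩
  have hcT : c ≠ ⊤ := ENNReal.div_ne_top (by simp [h.ne_top']) (by simp)
  have hcm : c * (r.M + 2) + κ ≤ δ := by
    rw [hc, ENNReal.div_mul_cancel (by simp) hM, tsub_add_cancel_of_le h.lt.le]
  refine ⟨c⁻¹ * (C₃ + κ + (C₃ + δ) * A), ?_, fun m k Q hQ => ?_⟩
  · have := h.ne_top; have := h.ne_top'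
    finiteness
  · have h1 := le_self_add.trans ((h.main hE hcm m).2 k Q hQ)
    have h2 : ∫⁻ x in Q, scaleCount (D.family Bad) k x ∂(surfMeasure n E) ≤
        A * surfMeasure n E Q := by
      rw [lintegral_scaleCount D.measurableSet_family]
      refine le_trans (ENNReal.tsum_le_tsum fun i : ℕ => ?_) (hBad k Q hQ)
      rw [Measure.restrict_apply (D.measurableSet_family _)]
    rw [mul_assoc, ← ENNReal.div_eq_inv_mul, ENNReal.le_div_iff_mul_le (.inl hc0) (.inl hcT), mul_comm]
    refine h1.trans ?_
    rw [add_mul (C₃ + κ), mul_assoc]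
    exact add_le_add_right (mul_le_mul_right h2 _) _

end StopRule

section planes
variable {n : ℕ} {E : Set (ES n)} {N N' : ES n}

theorem abs_inner_le_of_unit (hN : ‖N‖ = 1) (v : ES n) : |⟪N, v⟫_ℝ| ≤ ‖v‖ := by
  simpa [hN] using abs_real_inner_le_norm N v

theorem abs_inner_sub_le_dist (hN : ‖N‖ = 1) (v w : ES n) : |⟪N, v⟫_ℝ - ⟪N, w⟫_ℝ| ≤ dist v w := by
  rw [← inner_sub_right, dist_eq_norm]; exact abs_inner_le_of_unit hN _

theorem exists_mem_dist_lt_of_infDist_le (hE : E.Nonempty) {p : ES n} {h : ℝ} (hh : 0 < h)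
    (hp : infDist p E ≤ h) : ∃ y ∈ E, dist p y < 2 * h :=
  (infDist_lt_iff hE).1 (by linarith)

/-- If a disc in the hyperplane orthogonal to `N` is close to `E`, and `E` lies below a hyperplane
orthogonal to `N'` passing near the centre of the disc, then `N` and `N'` are almost parallel. -/
theorem tilt_mul_le_of_approx (hE : E.Nonempty) (hN : ‖N‖ = 1) (hN' : ‖N'‖ = 1) {p₀ : ES n}
    {ρ h e : ℝ} (hρ : 0 ≤ ρ) (hh : 0 < h) (he : 0 ≤ e)
    (h1 : ∀ p, dist p p₀ ≤ ρ → ⟪N, p⟫_ℝ = ⟪N, p₀⟫_ℝ → infDist p E ≤ h)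
    (h2 : ∀ y ∈ E, dist y p₀ ≤ ρ + 2 * h → ⟪N', y⟫_ℝ ≤ ⟪N', p₀⟫_ℝ + e) :
    tilt N N' * ρ ≤ e + 2 * h := by
  refine tilt_mul_le hN hρ (by linarith) fun v hv hvρ => ?_
  obtain ⟨y, hy, hyd⟩ := exists_mem_dist_lt_of_infDist_le hE hh
    (h1 (p₀ + v) (by simpa [dist_eq_norm] using hvρ) (by rw [inner_add_right, hv, add_zero]))
  have h3 := h2 y hy (by
    calc dist y p₀ ≤ dist y (p₀ + v) + dist (p₀ + v) p₀ := dist_triangle _ _ _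
      _ ≤ 2 * h + ρ := add_le_add (by rw [dist_comm]; exact hyd.le)
          (by simpa [dist_eq_norm] using hvρ)
      _ = _ := by ring)
  have h4 := (abs_le.1 (abs_inner_sub_le_dist hN' (p₀ + v) y)).2
  rw [inner_add_right] at h4
  linarith

theorem tilt_mul_le_of_approx_two_sided (hE : E.Nonempty) (hN : ‖N‖ = 1) (hN' : ‖N'‖ = 1)
    {p₀ : ES n} {ρ h e c' : ℝ} (hρ : 0 ≤ ρ) (hh : 0 < h) (he : 0 ≤ e)
    (h1 : ∀ p, dist p p₀ ≤ ρ → ⟪N, p⟫_ℝ = ⟪N, p₀⟫_ℝ → infDist p E ≤ h)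
    (h2 : ∀ y ∈ E, dist y p₀ ≤ ρ + 2 * h → |⟪N', y⟫_ℝ - c'| ≤ e) :
    tilt N N' * ρ ≤ 2 * e + 4 * h := by
  obtain ⟨y, hy, hyd⟩ := exists_mem_dist_lt_of_infDist_le hE hh (h1 p₀ (by simpa using hρ) rfl)
  have h3 := (abs_le.1 (h2 y hy (by rw [dist_comm]; linarith))).1
  have h4 := (abs_le.1 (abs_inner_sub_le_dist hN' p₀ y)).1
  have := tilt_mul_le_of_approx hE hN hN' (e := 2 * e + 2 * h) hρ hh (by linarith) h1
    fun w hw hwd => by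
      have := (abs_le.1 (h2 w hw hwd)).2
      linarith
  linarith

/-- Near `y` and at scale `t` the set `E` lies below a hyperplane near `y` which is close
to `E`. -/
def HalfPlane (E : Set (ES n)) (Λ τ : ℝ) (y : ES n) (t : ℝ) (ν : ES n) (c : ℝ) : Prop :=
  ‖ν‖ = 1 ∧ |⟪ν, y⟫_ℝ - c| ≤ τ * t ∧ (∀ p, dist p y ≤ Λ * t → ⟪ν, p⟫_ℝ = c → infDist p E ≤ τ * t) ∧
    ∀ w ∈ E, dist w y ≤ Λ * t → ⟪ν, w⟫_ℝ ≤ c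

/-- Near `x` and at scale `t` the set `E` is close to a union of two parallel hyperplanes. -/
def TwoPlane (E : Set (ES n)) (Λ η : ℝ) (x : ES n) (t : ℝ) (N : ES n) (c₁ c₂ : ℝ) : Prop :=
  ‖N‖ = 1 ∧ (∀ y ∈ E, dist y x ≤ Λ * t → |⟪N, y⟫_ℝ - c₁| ≤ η * t ∨ |⟪N, y⟫_ℝ - c₂| ≤ η * t) ∧
    ∀ p, dist p x ≤ Λ * t → (⟪N, p⟫_ℝ = c₁ ∨ ⟪N, p⟫_ℝ = c₂) → infDist p E ≤ η * t

theorem exists_halfPlane_of_localWHSA (D : DyadicSystem n E) (K₀ : ℝ) {Λ τ : ℝ} (hτ : 0 < τ) :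
    ∃ m : ℕ, ∃ ε₁ > 0, ∀ ε, 0 < ε → ε < ε₁ → ∀ k : ℤ, ∀ Q ∈ D.cubes (k + m),
      LocalWHSA E D K₀ ε (k + m) Q → ∀ y ∈ Q, ∃ ν c, HalfPlane E Λ τ y (2 ^ (-k)) ν c := by
  have hK : ∃ B, 0 ≤ B ∧ K₀ ^ ((3 : ℝ) / 2) ≤ B := ⟨|K₀ ^ ((3 : ℝ) / 2)|, abs_nonneg _, le_abs_self _⟩
  obtain ⟨B, hB, hKB⟩ := hK
  have hC := D.Cstar_pos
  obtain ⟨m, hm⟩ := exists_pow_lt_of_lt_one (show 0 < τ / (B + D.Cstar) by positivity)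
    (show (1 / 2 : ℝ) < 1 by norm_num)
  obtain ⟨M, hM0, hM⟩ : ∃ M : ℝ, 0 < M ∧ |Λ| * 2 ^ m + D.Cstar < M ^ 2 := by
    refine ⟨|Λ| * 2 ^ m + D.Cstar + 1, by positivity, ?_⟩
    have : 0 ≤ |Λ| * 2 ^ m := by positivity
    nlinarith
  refine ⟨m, min τ M⁻¹, by positivity, fun ε hε hε1 k Q hQ hW y hy => ?_⟩
  set t : ℝ := 2 ^ (-k) with ht
  have ht0 : 0 < t := by positivity
  set t₀ : ℝ := 2 ^ (-(k + m : ℤ)) with ht₀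
  have ht00 : 0 < t₀ := by positivity
  have htt : t₀ = (1 / 2) ^ m * t := by
    rw [ht₀, zpow_neg_add, zpow_neg, zpow_natCast, one_div, inv_pow]
  have htt' : t = 2 ^ m * t₀ := by rw [htt, ← mul_assoc, ← mul_pow]; norm_num
  have ht₀t : t₀ ≤ t := by
    rw [htt]; exact mul_le_of_le_one_left ht0.le (pow_le_one₀ (by norm_num) (by norm_num))
  have hετ : ε * t₀ ≤ τ * t := by
    have := (hε1.trans_le (min_le_left _ _)).le
    gcongr
  have hbig : |Λ| * t + D.Cstar * t₀ < ε ^ (-2 : ℤ) * t₀ := by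
    rw [htt', ← mul_assoc, ← add_mul]
    refine mul_lt_mul_of_pos_right (hM.trans_le ?_) ht00
    have h1 : M < ε⁻¹ := by
      rw [lt_inv_comm₀ hM0 hε]; exact hε1.trans_le (min_le_right _ _)
    rw [zpow_neg, show (2 : ℤ) = ((2 : ℕ) : ℤ) by rfl, zpow_natCast, ← inv_pow]
    gcongr
  obtain ⟨Hs, P, ⟨ν, c, hν, rfl, rfl⟩, hp, ⟨z, hz, hzP⟩, hH⟩ := hW
  have hcen : ∀ w, dist w y ≤ Λ * t → dist w (D.center Q) < ε ^ (-2 : ℤ) * t₀ := by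
    intro w hw
    have h1 : dist y (D.center Q) ≤ D.Cstar * t₀ := D.dist_le hQ hy (D.center_mem _ Q hQ)
    have h2 : Λ * t ≤ |Λ| * t := by gcongr; exact le_abs_self _
    linarith [dist_triangle w y (D.center Q)]
  refine ⟨ν, c, hν, ?_, fun p hpy hpc => (hp p ⟨hpc, hcen p hpy⟩).trans hετ, fun w hw hwy => ?_⟩
  · have h1 : dist y z ≤ D.Cstar * t₀ := by
      have : closure Q ⊆ closedBall y (D.Cstar * t₀) := by
        refine closure_minimal (fun w hw => ?_) isClosed_closedBall
        exact D.dist_le hQ hw hy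
      rw [dist_comm]; exact this hz
    have h2 : |⟪ν, z⟫_ℝ - c| ≤ infDist z {Z | ⟪ν, Z⟫_ℝ = c} := by
      refine (le_infDist ⟨c • ν, ?_⟩).2 fun w hw => ?_
      · change ⟪ν, c • ν⟫_ℝ = c
        rw [inner_smul_right, real_inner_self_eq_norm_sq, hν]; ring
      · rw [← show ⟪ν, w⟫_ℝ = c from hw]; exact abs_inner_sub_le_dist hν _ _
    have h3 : K₀ ^ ((3 : ℝ) / 2) * t₀ ≤ B * t₀ := by gcongr
    have h4 : (B + D.Cstar) * t₀ ≤ τ * t := by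
      rw [htt, ← mul_assoc]
      refine mul_le_mul_of_nonneg_right ?_ ht0.le
      rw [lt_div_iff₀ (by positivity)] at hm
      linarith
    have h5 := abs_inner_sub_le_dist hν y z
    have h6 := abs_sub_le ⟪ν, y⟫_ℝ ⟪ν, z⟫_ℝ c
    linarith
  · by_contra! hlt
    have : w ∈ ({Z | c < ⟪ν, Z⟫_ℝ} ∩ ball (D.center Q) (ε ^ (-2 : ℤ) * t₀) ∩ E) :=
      ⟨⟨hlt, hcen w hwy⟩, hw⟩
    rw [hH] at this
    exact this

theorem norm_sub_le_two_mul_tilt (hN : ‖N‖ = 1) (hN' : ‖N'‖ = 1) (h : 0 ≤ ⟪N, N'⟫_ℝ) :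
    ‖N' - N‖ ≤ 2 * tilt N N' := by
  rw [← sq_le_sq₀ (norm_nonneg _) (mul_nonneg zero_le_two tilt_nonneg), norm_sub_sq_real, hN, hN', mul_pow, tilt_sq hN hN',
    real_inner_comm]
  have := (abs_le.1 (abs_inner_le_of_unit hN N')).2
  rw [hN'] at this
  nlinarith

theorem HalfPlane.tilt_le {Λ Λ₂ τ t : ℝ} (ht : 0 < t) (hτ : 0 < τ) (hτ1 : τ ≤ 1 / 4)
    (hΛ₂ : 1 ≤ Λ₂) (hΛ : 4 * Λ₂ + 2 ≤ Λ) {y y' ν ν' : ES n} {c c' : ℝ} (hy' : y' ∈ E)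
    (h : HalfPlane E Λ τ y t ν c) (h' : HalfPlane E Λ τ y' t ν' c')
    (hd : dist y y' ≤ 2 * Λ₂ * t) : tilt ν' ν ≤ (4 * Λ₂ + 2) / Λ := by
  obtain ⟨hν, hc, -, h3⟩ := h
  obtain ⟨hν', hc', h2', -⟩ := h'
  set p₀ := y' + (c' - ⟪ν', y'⟫_ℝ) • ν' with hp₀
  have hp₀c : ⟪ν', p₀⟫_ℝ = c' := by
    rw [hp₀, inner_add_right, inner_smul_right, real_inner_self_eq_norm_sq, hν']; ring
  have hp₀d : dist p₀ y' ≤ τ * t := by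
    rw [hp₀, dist_eq_norm, add_sub_cancel_left, norm_smul, hν', mul_one, Real.norm_eq_abs, abs_sub_comm]
    exact hc'
  have hτt : τ * t ≤ 1 / 4 * t := by gcongr
  have hp₀y : dist p₀ y ≤ (2 * Λ₂ + τ) * t := by
    have := dist_triangle p₀ y' y
    rw [dist_comm y' y] at this; linarith
  have hΛt : (4 * Λ₂ + 2) * t ≤ Λ * t := by gcongr
  have hΛ₂t : 1 * t ≤ Λ₂ * t := by gcongr
  have key := tilt_mul_le_of_approx (E := E) ⟨y', hy'⟩ hν' hν (p₀ := p₀) (ρ := Λ / 2 * t)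
    (h := τ * t) (e := (2 * Λ₂ + 2 * τ) * t) (by nlinarith) (by positivity) (by positivity)
    (fun p hp hpc => h2' p (by linarith [dist_triangle p p₀ y']) (hpc.trans hp₀c))
    (fun w hw hwd => by
      have h4 := h3 w hw (by linarith [dist_triangle w p₀ y])
      have h5 := (abs_le.1 hc).1
      have h6 := (abs_le.1 (abs_inner_sub_le_dist hν p₀ y)).1
      linarith)
  rw [le_div_iff₀ (by linarith)]
  have : tilt ν' ν * (Λ / 2) ≤ 2 * Λ₂ + 2 * τ + 2 * τ := by
    refine le_of_mul_le_mul_right ?_ ht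
    linarith
  linarith

theorem HalfPlane.abs_inner_sub_le {Λ Λ₂ τ t s : ℝ} (hΛ : 2 * Λ₂ ≤ Λ) (ht : 0 < t)
    {y y' ν ν' : ES n} {c c' : ℝ} (hy : y ∈ E) (hy' : y' ∈ E)
    (h : HalfPlane E Λ τ y t ν c) (h' : HalfPlane E Λ τ y' t ν' c')
    (hd : dist y y' ≤ 2 * Λ₂ * t) (hs : ‖ν - N‖ ≤ 2 * s) (hs' : ‖ν' - N‖ ≤ 2 * s) :
    |⟪N, y⟫_ℝ - ⟪N, y'⟫_ℝ| ≤ (τ + 4 * s * Λ₂) * t := by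
  have aux : ∀ {y y' ν : ES n} {c : ℝ}, y' ∈ E → HalfPlane E Λ τ y t ν c →
      dist y y' ≤ 2 * Λ₂ * t → ‖ν - N‖ ≤ 2 * s → ⟪N, y'⟫_ℝ - ⟪N, y⟫_ℝ ≤ (τ + 4 * s * Λ₂) * t := by
    intro y y' ν c hy' h hd hs
    have hdΛ : 2 * Λ₂ * t ≤ Λ * t := by gcongr
    have h1 := h.2.2.2 y' hy' (by rw [dist_comm]; linarith)
    have h2 := (abs_le.1 h.2.1).1
    have h3 := (abs_le.1 (abs_real_inner_le_norm (ν - N) (y' - y))).1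
    rw [← dist_eq_norm y' y, dist_comm y' y, inner_sub_left, inner_sub_right, inner_sub_right] at h3
    have h4 : ‖ν - N‖ * dist y y' ≤ 2 * s * (2 * Λ₂ * t) :=
      mul_le_mul hs hd dist_nonneg ((norm_nonneg _).trans hs)
    linarith
  rw [abs_sub_le_iff]
  exact ⟨aux hy h' (by rwa [dist_comm]) hs', aux hy' h hd hs⟩

theorem HalfPlane.infDist_le {Λ Λ₂ τ t s : ℝ} (hτ : 0 < τ) (hτ1 : τ ≤ 1) (hs : 0 ≤ s) (hs1 : s ≤ 1)
    (hΛ₂ : 1 ≤ Λ₂) (hΛ : 8 * Λ₂ ≤ Λ) (ht : 0 < t)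
    {y ν p : ES n} {c : ℝ} (h : HalfPlane E Λ τ y t ν c)
    (hd : dist p y ≤ 2 * Λ₂ * t) (hν : ‖ν - N‖ ≤ 2 * s) (hp : ⟪N, p⟫_ℝ = ⟪N, y⟫_ℝ) :
    infDist p E ≤ (2 * τ + 4 * s * Λ₂) * t := by
  obtain ⟨hν1, hc, h2, -⟩ := h
  set p' := p + (c - ⟪ν, p⟫_ℝ) • ν with hp'
  have hp'c : ⟪ν, p'⟫_ℝ = c := by
    rw [hp', inner_add_right, inner_smul_right, real_inner_self_eq_norm_sq, hν1]; ring
  have hp'd : dist p' p ≤ (τ + 4 * s * Λ₂) * t := by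
    rw [hp', dist_eq_norm, add_sub_cancel_left, norm_smul, hν1, mul_one, Real.norm_eq_abs]
    have h3 := abs_real_inner_le_norm (ν - N) (y - p)
    rw [← dist_eq_norm y p, dist_comm y p, inner_sub_left, inner_sub_right, inner_sub_right, hp,
      sub_self, sub_zero] at h3
    have h4 : ‖ν - N‖ * dist p y ≤ 2 * s * (2 * Λ₂ * t) :=
      mul_le_mul hν hd dist_nonneg ((norm_nonneg _).trans hν)
    have h5 := abs_sub_le c ⟪ν, y⟫_ℝ ⟪ν, p⟫_ℝ
    rw [abs_sub_comm c ⟪ν, y⟫_ℝ] at h5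
    linarith
  have h6 := h2 p' (by
    have h7 : (τ + 4 * s * Λ₂) * t ≤ (1 + 4 * 1 * Λ₂) * t := by gcongr
    have h8 : 8 * Λ₂ * t ≤ Λ * t := by gcongr
    have h9 : 1 * t ≤ Λ₂ * t := by gcongr
    linarith [dist_triangle p' p y]) hp'c
  have h7 := infDist_le_infDist_add_dist (s := E) (x := p) (y := p')
  rw [dist_comm] at h7
  linarith

theorem exists_twoPlane_of_halfPlane {Λ η : ℝ} (hΛ : 1 ≤ Λ) (hη : 0 < η) : ∃ Λ₃ τ : ℝ, 0 < τ ∧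
    ∀ (E : Set (ES n)) (x : ES n) (t : ℝ), 0 < t → x ∈ E →
    (∀ y ∈ E, dist y x ≤ Λ * t → ∃ ν c, HalfPlane E Λ₃ τ y t ν c) →
    ∃ N c₁ c₂, TwoPlane E Λ η x t N c₁ c₂ := by
  set τ := min (1 / 4) (η / 8) with hτdef
  have hτ : 0 < τ := by positivity
  have hτ1 : τ ≤ 1 / 4 := min_le_left _ _
  have hτη : τ ≤ η / 8 := min_le_right _ _
  set Λ₃ := 8 * Λ + 2 + 16 * Λ * (4 * Λ + 2) / η with hΛ₃
  have hΛ₃p : 0 < Λ₃ := by positivity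
  have hΛ₃8 : 8 * Λ + 2 ≤ Λ₃ := le_add_of_nonneg_right (by positivity)
  set s := (4 * Λ + 2) / Λ₃ with hs
  have hs0 : 0 ≤ s := by positivity
  have hs1 : s ≤ 1 := by rw [hs, div_le_one hΛ₃p]; linarith
  have hsη : 4 * s * Λ ≤ η / 4 := by
    rw [hs, show 4 * ((4 * Λ + 2) / Λ₃) * Λ = (4 * Λ * (4 * Λ + 2)) / Λ₃ by ring, div_le_iff₀ hΛ₃p]
    have h1 : η * (16 * Λ * (4 * Λ + 2) / η) = 16 * Λ * (4 * Λ + 2) := by field_simp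
    have h2 : 0 ≤ η * (8 * Λ + 2) := by positivity
    rw [hΛ₃]; linarith
  refine ⟨Λ₃, τ, hτ, fun E x t ht hx H => ?_⟩
  have hxx : dist x x ≤ Λ * t := by rw [dist_self]; positivity
  obtain ⟨N, c₀, hN⟩ := H x hx hxx
  have hΛt : 0 ≤ Λ * t := by positivity
  have hηt : 0 < η * t := by positivity
  have alt : ∀ y ∈ E, dist y x ≤ Λ * t → ∃ ν c, HalfPlane E Λ₃ τ y t ν c ∧
      (‖ν - N‖ ≤ 2 * s ∨ ‖ν - -N‖ ≤ 2 * s) := by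
    intro y hy hyx
    obtain ⟨ν, c, h⟩ := H y hy hyx
    refine ⟨ν, c, h, ?_⟩
    have h1 : tilt N ν ≤ s := HalfPlane.tilt_le ht hτ hτ1 hΛ (by linarith) hx h hN (by linarith)
    rcases le_total 0 ⟪N, ν⟫_ℝ with h2 | h2
    · exact .inl ((norm_sub_le_two_mul_tilt hN.1 h.1 h2).trans (by linarith))
    · have h3 : tilt (-N) ν = tilt N ν := by simp [tilt]
      refine .inr ((norm_sub_le_two_mul_tilt (by rw [norm_neg, hN.1]) h.1
        (by rw [inner_neg_left]; linarith)).trans (by linarith))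
  have hNN : ‖N - N‖ ≤ 2 * s := by simpa using hs0
  have hfin1 : ∀ a : ℝ, a ≤ (τ + 4 * s * Λ) * t → a ≤ η * t := fun a ha =>
    ha.trans (by gcongr; linarith)
  have hfin2 : ∀ a : ℝ, a ≤ (2 * τ + 4 * s * Λ) * t → a ≤ η * t := fun a ha =>
    ha.trans (by gcongr; linarith)
  have plus : ∀ y ∈ E, dist y x ≤ Λ * t → ∀ ν c, HalfPlane E Λ₃ τ y t ν c → ‖ν - N‖ ≤ 2 * s →
      |⟪N, y⟫_ℝ - ⟪N, x⟫_ℝ| ≤ η * t := fun y hy hyx ν c h hν =>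
    hfin1 _ (HalfPlane.abs_inner_sub_le (Λ₂ := Λ) (by linarith) ht hy hx h hN (by linarith) hν hNN)
  have near : ∀ p, dist p x ≤ Λ * t → ⟪N, p⟫_ℝ = ⟪N, x⟫_ℝ → infDist p E ≤ η * t :=
    fun p hp hpc => hfin2 _ (HalfPlane.infDist_le (Λ₂ := Λ) hτ (by linarith) hs0 hs1 hΛ
      (by linarith) ht hN (by linarith) hNN hpc)
  by_cases hmin : ∃ z ∈ E, dist z x ≤ Λ * t ∧ ∃ ν c, HalfPlane E Λ₃ τ z t ν c ∧ ‖ν - -N‖ ≤ 2 * s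
  · obtain ⟨z, hz, hzx, ν₀, d₀, hz0, hν₀⟩ := hmin
    refine ⟨N, ⟪N, x⟫_ℝ, ⟪N, z⟫_ℝ, hN.1, fun y hy hyx => ?_, fun p hp hpc => ?_⟩
    · obtain ⟨ν, c, h, hν | hν⟩ := alt y hy hyx
      · exact .inl (plus y hy hyx ν c h hν)
      · refine .inr (hfin1 _ ?_)
        have := HalfPlane.abs_inner_sub_le (Λ₂ := Λ) (by linarith) ht hy hz h hz0 (by
          have := dist_triangle y x z
          rw [dist_comm x z] at this; linarith) hν hν₀
        rwa [inner_neg_left, inner_neg_left, neg_sub_neg, abs_sub_comm] at this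
    · rcases hpc with hpc | hpc
      · exact near p hp hpc
      · refine hfin2 _ (HalfPlane.infDist_le (Λ₂ := Λ) hτ (by linarith) hs0 hs1 hΛ
          (by linarith) ht hz0 ?_ hν₀ (by rw [inner_neg_left, inner_neg_left, hpc]))
        have := dist_triangle p x z
        rw [dist_comm x z] at this; linarith
  · refine ⟨N, ⟪N, x⟫_ℝ, ⟪N, x⟫_ℝ, hN.1, fun y hy hyx => ?_, fun p hp hpc => near p hp ?_⟩
    · obtain ⟨ν, c, h, hν | hν⟩ := alt y hy hyx
      · exact .inl (plus y hy hyx ν c h hν)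
      · exact absurd ⟨y, hy, hyx, ν, c, h, hν⟩ hmin
    · exact hpc.elim id id

end planes

theorem exists_carleson_not_twoPlane {n : ℕ} {E : Set (ES n)} {C : ℝ} (hE : Regular n C E)
    (D : DyadicSystem n E) {K₀ ε₀ : ℝ} (hε₀ : 0 < ε₀)
    (hW : ∀ ε : ℝ, 0 < ε → ε < ε₀ →
      ∃ C : ℝ, PackedBy E D (fun k Q => ¬ LocalWHSA E D K₀ ε k Q) C) {Λ η : ℝ} (hΛ : 1 ≤ Λ)
    (hη : 0 < η) : ∃ A : ℝ≥0∞, A ≠ ⊤ ∧ D.Carleson (D.family fun k Q =>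
      ¬ ∃ N c₁ c₂, TwoPlane E Λ η (D.center Q) (2 ^ (-k)) N c₁ c₂) A := by
  obtain ⟨Λ₃, τ, hτ, H⟩ := exists_twoPlane_of_halfPlane (n := n) hΛ hη
  obtain ⟨m, ε₁, hε₁, Hm⟩ := exists_halfPlane_of_localWHSA D K₀ (Λ := Λ₃) hτ
  set ε := min ε₀ ε₁ / 2 with hε
  have hε0 : 0 < ε := by positivity
  have hmin : 0 < min ε₀ ε₁ := by positivity
  obtain ⟨A, hA⟩ := hW ε hε0 (by linarith [min_le_left ε₀ ε₁])
  have hC := D.Cstar_pos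
  obtain ⟨A', hA', hAc⟩ := (DyadicSystem.Carleson.of_packedBy D hE hA).window hE ENNReal.ofReal_ne_top
    (L := Λ + D.Cstar) (by linarith) m
  refine ⟨A', hA', hAc.mono fun k x hx => ?_⟩
  obtain ⟨hxE, hx⟩ := hx
  refine ⟨hxE, m, by simp, ?_⟩
  by_contra! hcon
  have hQ := D.cubeAt_mem k hxE
  have hcE := D.center_mem_E hQ
  refine hx (H E _ _ (by positivity) hcE fun y hy hyd => ?_)
  by_contra hno
  have hyR := D.cubeAt_mem (k + m) hy
  have h1 := hcon y ⟨hy, fun hW => hno (Hm ε hε0 (by linarith [min_le_right ε₀ ε₁]) k _ hyR hW y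
    (D.mem_cubeAt _ hy))⟩
  have h2 := D.dist_le hQ (D.mem_cubeAt k hxE) (D.center_mem k _ hQ)
  have h3 := dist_triangle x (D.center (D.cubeAt k x)) y
  rw [dist_comm (D.center (D.cubeAt k x)) y] at h3
  linarith

section shadows
variable {n : ℕ} {E : Set (ES n)} {N N' : ES n}

theorem exists_over_point (hN : ‖N‖ = 1) (hN' : ‖N'‖ = 1) (hNN : 1 / 2 ≤ |⟪N, N'⟫_ℝ|) {x : ES n}
    {c e δ : ℝ} {p : EuclideanSpace ℝ (Fin n)} (hx : |⟪N', x⟫_ℝ - c| ≤ e)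
    (hp : dist p (proj N x) ≤ δ) :
    ∃ q, ⟪N', q⟫_ℝ = c ∧ proj N q = p ∧ dist q x ≤ 2 * e + 3 * δ := by
  set v := lift N (p - proj N x) with hv
  have hvn : ‖v‖ ≤ δ := by rw [hv, norm_lift hN, ← dist_eq_norm]; exact hp
  have hNN0 : 0 < |⟪N, N'⟫_ℝ| := by linarith
  have hNN1 : ⟪N', N⟫_ℝ ≠ 0 := by rw [real_inner_comm N N']; exact abs_pos.1 hNN0
  set s := (c - ⟪N', x⟫_ℝ - ⟪N', v⟫_ℝ) / ⟪N', N⟫_ℝ with hs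
  have hsn : |s| ≤ 2 * (e + δ) := by
    rw [hs, abs_div, real_inner_comm N N', div_le_iff₀ hNN0]
    have h1 := abs_inner_le_of_unit hN' v
    have h2 : |c - ⟪N', x⟫_ℝ - ⟪N', v⟫_ℝ| ≤ e + δ := by
      refine (abs_sub _ _).trans (add_le_add ?_ (h1.trans hvn))
      rwa [abs_sub_comm]
    have h3 : 0 ≤ e + δ := (abs_nonneg _).trans h2
    nlinarith
  refine ⟨x + v + s • N, ?_, ?_, ?_⟩
  · rw [inner_add_right, inner_add_right, inner_smul_right, hs, div_mul_cancel₀ _ hNN1]; ring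
  · rw [map_add, map_add, map_smul, proj_self hN, smul_zero, add_zero, hv, proj_lift hN]; abel
  · rw [dist_eq_norm, show x + v + s • N - x = v + s • N by abel]
    refine (norm_add_le _ _).trans ?_
    rw [norm_smul, hN, Real.norm_eq_abs, mul_one]
    linarith

theorem volume_shadow_le (hn : 0 < n) (hN : ‖N‖ = 1) (hN' : ‖N'‖ = 1) (hNN : 1 / 2 ≤ |⟪N, N'⟫_ℝ|)
    {R : Set (ES n)} {c e δ δ' : ℝ} (hR : ∀ x ∈ R, |⟪N', x⟫_ℝ - c| ≤ e) (hδ : 2 * e + 3 * δ < δ') :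
    volume (thickening δ (proj N '' R)) ≤
      ENNReal.ofReal |⟪N, N'⟫_ℝ| * volume (thickening δ' (proj N' '' R)) := by
  refine le_trans (measure_mono fun p hp => ?_)
    (volume_image_proj_lift_le hn hN hN' (c • proj N N') _)
  obtain ⟨_, ⟨x, hx, rfl⟩, hpx⟩ := mem_thickening_iff.1 hp
  obtain ⟨q, hqc, hqp, hqd⟩ := exists_over_point hN hN' hNN (hR x hx) hpx.le
  refine ⟨proj N' q, mem_thickening_iff.2 ⟨_, ⟨x, hx, rfl⟩,
    (dist_proj_le hN' _ _).trans_lt (hqd.trans_lt hδ)⟩, ?_⟩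
  change c • proj N N' + proj N (lift N' (proj N' q)) = p
  rw [lift_proj hN', hqc, map_sub, map_smul, add_sub_cancel, hqp]

theorem exists_volume_thickening_le {C : ℝ} (hE : Regular n C E) (D : DyadicSystem n E) :
    ∃ B : ℝ, 0 < B ∧ ∀ N : ES n, ‖N‖ = 1 → ∀ (d : ℝ), 0 < d → ∀ (m : ℤ) (A Z : Set (ES n)),
      (∀ y ∈ A, ∃ R ∈ D.cubes m, y ∈ R ∧ R ⊆ Z) →
      volume (thickening (d * 2 ^ (-m)) (proj N '' A)) ≤
        ENNReal.ofReal (B * ((d + D.Cstar) / D.a₀) ^ n) * surfMeasure n E Z := by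
  obtain ⟨Cv, hCv⟩ := exists_adMeas_volume n
  have hC := hE.ad.pos
  have hCv0 := hCv.pos
  have hCs := D.Cstar_pos
  have ha := D.a₀_pos
  have := hE.ad.sigmaFinite
  refine ⟨Cv * C, by positivity, fun N hN d hd m A Z h => ?_⟩
  have ht : (0 : ℝ) < 2 ^ (-m) := by positivity
  have hcont : Continuous (proj N) := LinearMap.continuous_of_finiteDimensional _
  have key := double_counting (volume : Measure (EuclideanSpace ℝ (Fin n))) (surfMeasure n E)
    (W := {q | dist q.1 (proj N q.2) < (d + D.Cstar) * 2 ^ (-m)})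
    (A := thickening (d * 2 ^ (-m)) (proj N '' A)) (Z := Z)
    (m := ENNReal.ofReal (C⁻¹ * (D.a₀ * 2 ^ (-m)) ^ n))
    (M := ENNReal.ofReal (Cv * ((d + D.Cstar) * 2 ^ (-m)) ^ n)) ?_ ?_ ?_
  · rw [mul_comm, ← ENNReal.le_div_iff_mul_le (.inl (by positivity)) (.inl ENNReal.ofReal_ne_top),
      div_eq_mul_inv, mul_right_comm, ← div_eq_mul_inv,
      ← ENNReal.ofReal_div_of_pos (by positivity)] at key
    refine key.trans (mul_le_mul_left (ENNReal.ofReal_le_ofReal (le_of_eq ?_)) _)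
    rw [mul_pow, mul_pow, div_pow]
    field_simp
  · exact (isOpen_lt (by fun_prop) (by fun_prop)).measurableSet
  · intro p hp
    obtain ⟨_, ⟨y, hy, rfl⟩, hpy⟩ := mem_thickening_iff.1 hp
    obtain ⟨R, hR, hyR, hRZ⟩ := h y hy
    refine (D.le_measure hE hR).trans (measure_mono fun z hz => ⟨hRZ hz, ?_⟩)
    change dist p (proj N z) < _
    have h1 := dist_proj_le hN y z
    have h2 := D.dist_le hR hyR hz
    linarith [dist_triangle p (proj N y) (proj N z)]
  · intro z _
    exact hCv.upper (proj N z) _ (by positivity)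

theorem FlatPlane.tilt_le {Λ η t t' : ℝ} (ht : 0 < t) (hη : 0 < η) (hη1 : η ≤ 1 / 4)
    (hΛ : 2 ≤ Λ) {x x' : ES n} {c c' : ℝ} (hx : x ∈ E)
    (h : FlatPlane E Λ η x t N c) (h' : FlatPlane E Λ η x' t' N' c')
    (hd : dist x x' + 2 * t ≤ Λ * t') : tilt N N' * t ≤ 2 * η * t' + 4 * η * t := by
  obtain ⟨hN, h1, h2⟩ := h
  obtain ⟨hN', h1', -⟩ := h'
  have hxc := h1 x hx (by rw [dist_self]; positivity)
  obtain ⟨p₀, hp₀, -, hp₀d⟩ := exists_over_point (p := proj N x) hN hN (by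
    rw [real_inner_self_eq_norm_sq, hN]; norm_num) (δ := 0) hxc (by simp)
  have hηt : η * t ≤ 1 / 4 * t := by gcongr
  have hΛt : 2 * t ≤ Λ * t := by gcongr
  have key := tilt_mul_le_of_approx_two_sided ⟨x, hx⟩ hN hN' (p₀ := p₀) (ρ := t) (h := η * t)
    (e := η * t') (c' := c') ht.le (by positivity)
    ((abs_nonneg _).trans (h1' x hx (by linarith))) (fun p hp hpc => h2 p ?_ (hpc.trans hp₀))
    fun y hy hyp => h1' y hy ?_
  · linarith
  · linarith [dist_triangle p p₀ x]
  · linarith [dist_triangle y p₀ x', dist_triangle p₀ x x']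

end shadows

/-- The parameters of the flatness conditions used in the stopping time argument. -/
structure FlatScales {n : ℕ} {E : Set (ES n)} (D : DyadicSystem n E) where
  Λ : ℝ
  η : ℝ
  η₁ : ℝ
  i : ℕ
  M : ℕ
  η_eq : η = D.Cstar * 2 ^ (-(i : ℤ))
  η_le : η ≤ 1 / 200
  η_lt : 101 * η < D.a₀
  Λ_ge : 4 * D.Cstar + 10 + D.a₀ ≤ Λ
  M_le : 16 * Λ * 2 ^ (-((M : ℤ) + 1)) ≤ η
  η₁_pos : 0 < η₁
  η₁_le : 4 * η₁ ≤ η * 2 ^ (-((M : ℤ) + 1))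

namespace FlatScales
variable {n : ℕ} {E : Set (ES n)} {D : DyadicSystem n E} (s : FlatScales D) {C : ℝ}

theorem η_pos : 0 < s.η := by
  have := D.Cstar_pos
  rw [s.η_eq]; positivity

open Classical in
/-- The stopping time rule: a tree continues as long as the cubes are flat with a normal
close to that of the top cube. -/
def rule : StopRule n (ES n) where
  Flat k Q := FlatAt E s.Λ s.η (D.center Q) (2 ^ (-k))
  nrm k Q := if h : FlatAt E s.Λ s.η (D.center Q) (2 ^ (-k)) then h.choose else 0
  good N k Q := ‖N‖ = 1 ∧ FlatAt E s.Λ s.η (D.center Q) (2 ^ (-k)) ∧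
    tilt N (if h : FlatAt E s.Λ s.η (D.center Q) (2 ^ (-k)) then h.choose else 0) ≤ 1 / 8
  M := s.M

theorem flatPlane_nrm {k : ℤ} {Q : Set (ES n)} (h : s.rule.Flat k Q) :
    ∃ c, FlatPlane E s.Λ s.η (D.center Q) (2 ^ (-k)) (s.rule.nrm k Q) c := by
  have h' : FlatAt E s.Λ s.η (D.center Q) (2 ^ (-k)) := h
  have := h'.choose_spec
  simpa only [rule, dif_pos h'] using this

theorem good_iff {N : ES n} {k : ℤ} {Q : Set (ES n)} : s.rule.good N k Q ↔
    ‖N‖ = 1 ∧ s.rule.Flat k Q ∧ tilt N (s.rule.nrm k Q) ≤ 1 / 8 := Iff.rfl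

/-- The shadow of a cube in the direction `N`. -/
def shadow (N : ES n) (k : ℤ) (Q : Set (ES n)) : Set (EuclideanSpace ℝ (Fin n)) :=
  thickening (4 * s.η * 2 ^ (-k)) (proj N '' Q)

open Classical in
/-- The area of the shadow of a flat cube in its own normal direction. -/
def area (k : ℤ) (Q : Set (ES n)) : ℝ≥0∞ :=
  if s.rule.Flat k Q then volume (thickening (20 * s.η * 2 ^ (-k)) (proj (s.rule.nrm k Q) '' Q))
  else 0

/-- The part of the shadow of a cube which is covered by the shadows of the cubes stopping a tree
within `m` generations and the ones remaining after `m` generations. -/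
def covered (N : ES n) (m : ℕ) (k : ℤ) (Q : Set (ES n)) : Set (EuclideanSpace ℝ (Fin n)) :=
  {p | ∃ x ∈ Q, ∃ i ≤ m, (i = m ∨ 1 ≤ i ∧ ¬ s.rule.good N (k + i) (D.cubeAt (k + i) x)) ∧
    dist p (proj N x) < 4 * s.η * 2 ^ (-(k + i))}

variable {s} {k : ℤ} {Q R : Set (ES n)} {N : ES n}

theorem covered_zero : s.covered N 0 k Q = s.shadow N k Q := by
  ext p
  simp only [covered, shadow, mem_thickening_iff, mem_ofPred_eq]
  constructor
  · rintro ⟨x, hx, i, hi, -, hp⟩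
    obtain rfl : i = 0 := by omega
    exact ⟨_, ⟨x, hx, rfl⟩, by simpa using hp⟩
  · rintro ⟨_, ⟨x, hx, rfl⟩, hp⟩
    exact ⟨x, hx, 0, le_rfl, .inl rfl, by simpa using hp⟩

theorem exists_covered_succ_le (m : ℕ) (hQ : Q ∈ D.cubes k) :
    ∃ w : Set (ES n) → ℝ≥0∞, volume (s.covered N (m + 1) k Q) ≤
      ∑' R : {R | R ∈ D.cubes (k + 1) ∧ R ⊆ Q}, w R.1 ∧
    ∀ R, (s.rule.good N (k + 1) R → w R ≤ volume (s.covered N m (k + 1) R)) ∧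
      (¬ s.rule.good N (k + 1) R → w R ≤ volume (s.shadow N (k + 1) R)) := by
  classical
  let W : Set (ES n) → Set (EuclideanSpace ℝ (Fin n)) := fun R =>
    if s.rule.good N (k + 1) R then s.covered N m (k + 1) R else s.shadow N (k + 1) R
  refine ⟨fun R => volume (W R), ?_, fun R => ⟨fun h => by simp only [W, if_pos h, le_refl],
    fun h => by simp only [W, if_neg h, le_refl]⟩⟩
  have hc : Countable {R | R ∈ D.cubes (k + 1) ∧ R ⊆ Q} :=
    ((D.countable (k + 1)).mono fun R hR => hR.1).to_subtype
  refine (measure_mono ?_).trans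
    (measure_iUnion_le fun R : {R | R ∈ D.cubes (k + 1) ∧ R ⊆ Q} => W R.1)
  rintro p ⟨x, hx, i, hi, hor, hp⟩
  have hxE := D.subset_of_mem hQ hx
  have hi1 : 1 ≤ i := by
    rcases hor with h | h
    · omega
    · exact h.1
  obtain ⟨i, rfl⟩ := Nat.exists_eq_add_of_le' hi1
  refine mem_iUnion.2 ⟨⟨D.cubeAt (k + 1) x, D.cubeAt_mem _ hxE,
    D.cubeAt_subset (by omega) hQ hx⟩, ?_⟩
  have hxR := D.mem_cubeAt (k + 1) hxE
  have hki : k + ((i + 1 : ℕ) : ℤ) = k + 1 + i := by push_cast; ring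
  rw [hki] at hor hp
  by_cases hg : s.rule.good N (k + 1) (D.cubeAt (k + 1) x)
  · simp only [W, if_pos hg]
    refine ⟨x, hxR, i, by omega, ?_, hp⟩
    rcases hor with h | h
    · exact .inl (by omega)
    · refine .inr ⟨Nat.one_le_iff_ne_zero.2 fun h0 => h.2 ?_, h.2⟩
      subst h0
      simpa using hg
  · simp only [W, if_neg hg]
    refine mem_thickening_iff.2 ⟨_, ⟨x, hxR, rfl⟩, hp.trans_le ?_⟩
    have := s.η_pos
    exact mul_le_mul_of_nonneg_left (zpow_neg_le_of_le (by omega)) (by positivity)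

theorem dist_center_le (hQ : Q ∈ D.cubes k) {x : ES n} (hx : x ∈ Q) :
    dist x (D.center Q) ≤ D.Cstar * 2 ^ (-k) := D.dist_le hQ hx (D.center_mem k Q hQ)

theorem exists_volume_le (hE : Regular n C E) (D : DyadicSystem n E) : ∃ B : ℝ, 0 < B ∧
    ∀ (s : FlatScales D) (N : ES n), ‖N‖ = 1 → ∀ k, ∀ Q ∈ D.cubes k,
      volume (s.shadow N k Q) ≤ ENNReal.ofReal B * surfMeasure n E Q ∧
      volume (thickening (20 * s.η * 2 ^ (-k)) (proj N '' Q)) ≤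
        ENNReal.ofReal B * surfMeasure n E Q ∧
      volume (thickening (20 * s.η * 2 ^ (-k)) (proj N ''
        {y ∈ Q | infDist y (E \ Q) ≤ 100 * s.η * 2 ^ (-k)})) ≤
        ENNReal.ofReal (B * s.η ^ D.γ) * surfMeasure n E Q := by
  obtain ⟨B, hB, h⟩ := exists_volume_thickening_le hE D
  have hCs := D.Cstar_pos
  have ha := D.a₀_pos
  set B₁ := B * ((20 + D.Cstar) / D.a₀) ^ n
  set B₂ := B * ((20 * D.Cstar + D.Cstar) / D.a₀) ^ n * (D.Cstar * 101 ^ D.γ)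
  refine ⟨B₁ + B₂, by positivity, fun s N hN k Q hQ => ?_⟩
  have hη := s.η_pos
  have hη1 := s.η_le
  have hgen : ∀ d : ℝ, 0 < d → d ≤ 20 * s.η → volume (thickening (d * 2 ^ (-k)) (proj N '' Q)) ≤
      ENNReal.ofReal (B₁ + B₂) * surfMeasure n E Q := by
    intro d hd hd1
    refine (h N hN d hd k Q Q fun y hy => ⟨Q, hQ, hy, subset_rfl⟩).trans
      (mul_le_mul_left (ENNReal.ofReal_le_ofReal ?_) _)
    have : B * ((d + D.Cstar) / D.a₀) ^ n ≤ B₁ := by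
      have : d ≤ 20 := by linarith
      simp only [B₁]
      gcongr
    have : 0 ≤ B₂ := by positivity
    linarith
  refine ⟨hgen _ (by positivity) (by linarith), hgen _ (by positivity) le_rfl, ?_⟩
  have hki : (2 : ℝ) ^ (-(k + s.i)) = 2 ^ (-(s.i : ℤ)) * 2 ^ (-k) := zpow_neg_add k s.i
  have h1 := h N hN (20 * D.Cstar) (by positivity) (k + s.i)
    {y ∈ Q | infDist y (E \ Q) ≤ 100 * s.η * 2 ^ (-k)}
    {y ∈ Q | infDist y (E \ Q) ≤ 101 * s.η * 2 ^ (-k)} ?_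
  · rw [hki, ← mul_assoc, mul_assoc 20, ← s.η_eq] at h1
    refine h1.trans ?_
    have h2 := D.small_boundary k Q hQ (101 * s.η) (by positivity) s.η_lt
    rw [D.hausdorff_eq hE.closed hQ subset_rfl, D.hausdorff_eq hE.closed hQ (sep_subset _ _)] at h2
    refine (mul_le_mul_right h2 _).trans ?_
    rw [← mul_assoc, ← ENNReal.ofReal_mul (by positivity)]
    refine mul_le_mul_left (ENNReal.ofReal_le_ofReal ?_) _
    rw [Real.mul_rpow (by norm_num) hη.le, add_mul]
    have : B * ((20 * D.Cstar + D.Cstar) / D.a₀) ^ n * (D.Cstar * (101 ^ D.γ * s.η ^ D.γ)) =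
      B₂ * s.η ^ D.γ := by simp only [B₂]; ring
    rw [this]
    have : 0 ≤ B₁ * s.η ^ D.γ := by positivity
    linarith
  · rintro y ⟨hy, hyd⟩
    have hyE := D.subset_of_mem hQ hy
    refine ⟨D.cubeAt (k + s.i) y, D.cubeAt_mem _ hyE, D.mem_cubeAt _ hyE, fun z hz =>
      ⟨D.cubeAt_subset (by omega) hQ hy hz, ?_⟩⟩
    have h2 := D.dist_le (D.cubeAt_mem _ hyE) hz (D.mem_cubeAt (k + s.i) hyE)
    rw [hki, ← mul_assoc, ← s.η_eq] at h2
    linarith [infDist_le_infDist_add_dist (s := E \ Q) (x := z) (y := y)]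

theorem exists_le_area (hE : Regular n C E) (D : DyadicSystem n E) : ∃ c₁ : ℝ, 0 < c₁ ∧
    ∀ (s : FlatScales D) (k), ∀ Q ∈ D.cubes k, s.rule.Flat k Q →
      ENNReal.ofReal c₁ * surfMeasure n E Q ≤ s.area k Q := by
  obtain ⟨Cv, hCv⟩ := exists_adMeas_volume n
  have hC := hE.ad.pos
  have hCv0 := hCv.pos
  have hCs := D.Cstar_pos
  have ha := D.a₀_pos
  refine ⟨Cv⁻¹ * (D.a₀ / 8) ^ n / (C * (2 * D.Cstar) ^ n), by positivity,
    fun s k Q hQ hF => ?_⟩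
  have ht : (0 : ℝ) < 2 ^ (-k) := by positivity
  have hη := s.η_pos
  have hηt : 0 < s.η * 2 ^ (-k) := by positivity
  have hη1 : s.η * 2 ^ (-k) ≤ 1 / 200 * 2 ^ (-k) := by gcongr; exact s.η_le
  have hη2 : 101 * s.η * 2 ^ (-k) ≤ D.a₀ * 2 ^ (-k) := by gcongr; exact s.η_lt.le
  have hΛ : (4 * D.Cstar + 10 + D.a₀) * 2 ^ (-k) ≤ s.Λ * 2 ^ (-k) := by gcongr; exact s.Λ_ge
  have hCt : 0 < D.Cstar * 2 ^ (-k) := by positivity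
  obtain ⟨c, hN, h1, h2⟩ := s.flatPlane_nrm hF
  set N := s.rule.nrm k Q
  set z := D.center Q
  have hzE : z ∈ E := D.center_mem_E hQ
  rw [area, if_pos hF]
  calc _ ≤ ENNReal.ofReal (Cv⁻¹ * (D.a₀ / 8 * 2 ^ (-k)) ^ n) := by
        refine (mul_le_mul_right (D.measure_le hE hQ) _).trans ?_
        rw [← ENNReal.ofReal_mul (by positivity)]
        refine ENNReal.ofReal_le_ofReal (le_of_eq ?_)
        rw [mul_pow (2 * D.Cstar), mul_pow (D.a₀ / 8)]
        field_simp
    _ ≤ volume (ball (proj N z) (D.a₀ / 8 * 2 ^ (-k))) := by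
        simpa using hCv.lower (proj N z) (mem_univ _) (D.a₀ / 8 * 2 ^ (-k)) (by positivity)
    _ ≤ _ := measure_mono fun p hp => ?_
  obtain ⟨q, hq, hqp, hqd⟩ := exists_over_point (p := p) hN hN (by
    rw [real_inner_self_eq_norm_sq, hN]; norm_num) (δ := D.a₀ / 8 * 2 ^ (-k))
    (h1 z hzE (by rw [dist_self]; linarith)) (mem_ball.1 hp).le
  obtain ⟨y, hy, hqy⟩ := exists_mem_dist_lt_of_infDist_le ⟨z, hzE⟩ hηt (h2 q (by linarith) hq)
  have hyz := dist_triangle_left y z q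
  refine mem_thickening_iff.2 ⟨_, ⟨y, D.contains_ball k Q hQ ⟨hy, mem_ball.2 ?_⟩, rfl⟩, ?_⟩
  · linarith
  · rw [← hqp]
    linarith [dist_proj_le hN q y]

end FlatScales

namespace FlatScales
variable {n : ℕ} {E : Set (ES n)} {D : DyadicSystem n E} {s : FlatScales D} {k : ℤ}
  {Q R : Set (ES n)} {N : ES n}

theorem tilt_nrm_le_of_flatPlane {t t' : ℝ} (ht : 0 < t) {N' x x' : ES n} {c c' : ℝ} (hx : x ∈ E)
    (h : FlatPlane E s.Λ s.η x t N c) (h' : FlatPlane E s.Λ s.η x' t' N' c')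
    (hd : dist x x' + 2 * t ≤ s.Λ * t') : tilt N N' * t ≤ 2 * s.η * t' + 4 * s.η * t :=
  h.tilt_le ht s.η_pos (by linarith [s.η_le])
    (by linarith [s.Λ_ge, D.Cstar_pos, D.a₀_pos]) hx h' hd

/-- A point close to the shadow of a point of a flat cube is even closer to the shadow of some
point of `E` nearby. -/
theorem exists_closer (hR : R ∈ D.cubes k) (hg : s.rule.good N k R) {x : ES n} (hx : x ∈ R)
    {p : EuclideanSpace ℝ (Fin n)} {δ : ℝ} (hδ : δ ≤ 20 * s.η * 2 ^ (-k))
    (hp : dist p (proj N x) ≤ δ) :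
    ∃ y ∈ E, dist p (proj N y) < 4 * s.η * 2 ^ (-(k + 1)) ∧
      dist y x ≤ 4 * s.η * 2 ^ (-k) + 3 * δ := by
  obtain ⟨hN, hF, ht⟩ := s.good_iff.1 hg
  obtain ⟨c, hN', h1, h2⟩ := s.flatPlane_nrm hF
  set N' := s.rule.nrm k R
  have hxE := D.subset_of_mem hR hx
  have hη := s.η_pos
  have hηt : 0 < s.η * 2 ^ (-k) := by positivity
  have hη1 : s.η * 2 ^ (-k) ≤ 1 / 200 * 2 ^ (-k) := by gcongr; exact s.η_le
  have hΛ : (4 * D.Cstar + 10 + D.a₀) * 2 ^ (-k) ≤ s.Λ * 2 ^ (-k) := by gcongr; exact s.Λ_ge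
  have hCt : 0 < D.Cstar * 2 ^ (-k) := mul_pos D.Cstar_pos (by positivity)
  have hat : 0 < D.a₀ * 2 ^ (-k) := mul_pos D.a₀_pos (by positivity)
  have hxc := dist_center_le hR hx
  obtain ⟨q, hq, hqp, hqd⟩ := exists_over_point hN hN' (one_half_le_abs_inner hN hN' (by linarith))
    (h1 x hxE (by linarith)) hp
  obtain ⟨y, hy, hqy⟩ := exists_mem_dist_lt_of_infDist_le ⟨x, hxE⟩ hηt
    (h2 q (by linarith [dist_triangle q x (D.center R)]) hq)
  refine ⟨y, hy, ?_, ?_⟩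
  · rw [zpow_neg_add, ← hqp]
    norm_num
    norm_num at hqy
    linarith [dist_proj_le hN q y]
  · linarith [dist_triangle_left y x q]

theorem mem_of_dist_lt {y₀ y : ES n} (hy : y ∈ E)
    (hd : dist y y₀ < infDist y₀ (E \ Q)) : y ∈ Q := by
  by_contra h
  linarith [infDist_le_dist_of_mem (x := y₀) (show y ∈ E \ Q from ⟨hy, h⟩), dist_comm y y₀]

theorem mem_covered (m : ℕ) (hQ : Q ∈ D.cubes k) (hg : s.rule.good N k Q) {y₀ : ES n}
    (hy₀ : y₀ ∈ Q) (hd : 100 * s.η * 2 ^ (-k) < infDist y₀ (E \ Q))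
    {p : EuclideanSpace ℝ (Fin n)} (hp : dist p (proj N y₀) < 20 * s.η * 2 ^ (-k)) :
    p ∈ s.covered N m k Q := by
  have hη := s.η_pos
  have hηt : 0 < s.η * 2 ^ (-k) := by positivity
  suffices H : ∀ i : ℕ, i ≤ m → p ∈ s.covered N m k Q ∨
      ∃ y ∈ Q, dist p (proj N y) < 4 * s.η * 2 ^ (-(k + i + 1)) ∧
        dist y y₀ ≤ (96 - 32 * 2 ^ (-((i : ℤ) + 1))) * (s.η * 2 ^ (-k)) by
    rcases H m le_rfl with h | ⟨y, hy, hpy, -⟩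
    · exact h
    · exact ⟨y, hy, m, le_rfl, .inl rfl, hpy.trans_le
        (mul_le_mul_of_nonneg_left (zpow_neg_le_of_le (by omega)) (by positivity))⟩
  intro i
  induction i with
  | zero =>
    intro _
    obtain ⟨y, hy, hpy, hyd⟩ := exists_closer hQ hg hy₀ le_rfl hp.le
    refine .inr ⟨y, mem_of_dist_lt hy (by linarith), by simpa using hpy, ?_⟩
    norm_num
    norm_num at hyd hηt
    linarith
  | succ i ih =>
    intro him
    rcases ih (by omega) with h | ⟨y, hy, hpy, hyd⟩
    · exact .inl h
    have hyE := D.subset_of_mem hQ hy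
    have hki : k + ((i + 1 : ℕ) : ℤ) = k + i + 1 := by push_cast; ring
    by_cases hgi : s.rule.good N (k + i + 1) (D.cubeAt (k + i + 1) y)
    swap
    · exact .inl ⟨y, hy, i + 1, him, .inr ⟨by omega, by rwa [hki]⟩, by rwa [hki]⟩
    obtain ⟨y', hy', hpy', hyd'⟩ := exists_closer (D.cubeAt_mem _ hyE) hgi (D.mem_cubeAt _ hyE)
      (by gcongr; norm_num) hpy.le
    rw [hki]
    have h1 : (2 : ℝ) ^ (-(k + i + 1)) = 2 ^ (-((i : ℤ) + 1)) * 2 ^ (-k) := by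
      rw [add_assoc, zpow_neg_add]
    have h2 : (2 : ℝ) ^ (-(((i + 1 : ℕ) : ℤ) + 1)) = 2⁻¹ * 2 ^ (-((i : ℤ) + 1)) := by
      push_cast
      rw [zpow_neg_add, zpow_neg_one]
    set u : ℝ := 2 ^ (-((i : ℤ) + 1))
    have hu : 0 < u := by positivity
    rw [h1] at hyd'
    have hd' : dist y' y₀ ≤ (96 - 32 * (2⁻¹ * u)) * (s.η * 2 ^ (-k)) := by
      have := dist_triangle y' y y₀
      nlinarith
    refine .inr ⟨y', mem_of_dist_lt hy' (hd'.trans_lt ?_), hpy', by rwa [h2]⟩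
    nlinarith [mul_pos hu hηt]

theorem volume_le_add_of_deep {δ : ℝ}
    (hδ : δ ≤ 20 * s.η * 2 ^ (-k)) {A : Set (EuclideanSpace ℝ (Fin n))}
    (hA : ∀ p y, y ∈ Q → 100 * s.η * 2 ^ (-k) < infDist y (E \ Q) →
      dist p (proj N y) < δ → p ∈ A) :
    volume (thickening δ (proj N '' Q)) ≤ volume A +
      volume (thickening (20 * s.η * 2 ^ (-k)) (proj N ''
        {y ∈ Q | infDist y (E \ Q) ≤ 100 * s.η * 2 ^ (-k)})) := by
  refine (measure_mono fun p hp => ?_).trans (measure_union_le _ _)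
  obtain ⟨_, ⟨y, hy, rfl⟩, hpy⟩ := mem_thickening_iff.1 hp
  by_cases hd : infDist y (E \ Q) ≤ 100 * s.η * 2 ^ (-k)
  · exact .inr (mem_thickening_iff.2 ⟨_, ⟨y, ⟨hy, hd⟩, rfl⟩, hpy.trans_le hδ⟩)
  · exact .inl (hA p y hy (not_le.1 hd) hpy)

theorem tilt_nrm_le {N : ES n} (hg : s.rule.good N k Q) (hR : R ∈ D.cubes (k + 1)) (hRQ : R ⊆ Q)
    (hQ : Q ∈ D.cubes k) {N' x : ES n} {c : ℝ} (hx : x ∈ R)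
    (h : FlatPlane E s.Λ s.η x (2 ^ (-(k + 1))) N' c) : tilt N N' ≤ 1 / 8 + 8 * s.η := by
  obtain ⟨hN, hF, ht⟩ := s.good_iff.1 hg
  obtain ⟨c', h'⟩ := s.flatPlane_nrm hF
  have htt : (2 : ℝ) ^ (-k) = 2 * 2 ^ (-(k + 1)) := by rw [zpow_neg_add, zpow_neg_one]; ring
  have hΛ : (4 * D.Cstar + 10 + D.a₀) * 2 ^ (-k) ≤ s.Λ * 2 ^ (-k) := by gcongr; exact s.Λ_ge
  have hCt : 0 < D.Cstar * 2 ^ (-k) := mul_pos D.Cstar_pos (by positivity)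
  have hat : 0 < D.a₀ * 2 ^ (-k) := mul_pos D.a₀_pos (by positivity)
  have ht0 : (0 : ℝ) < 2 ^ (-(k + 1)) := by positivity
  have h1 := tilt_nrm_le_of_flatPlane ht0 (D.subset_of_mem hR hx) h h'
    (by linarith [dist_center_le hQ (hRQ hx)])
  have h2 : tilt N' (s.rule.nrm k Q) ≤ 8 * s.η := by
    rw [htt] at h1
    nlinarith
  have h3 := tilt_triangle hN h'.1 h.1
  rw [tilt_comm h'.1 h.1] at h3
  linarith

theorem volume_shadow_le_area (hn : 0 < n) (hN : ‖N‖ = 1) (hR : R ∈ D.cubes k)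
    (hF : s.rule.Flat k R) (ht : tilt N (s.rule.nrm k R) ≤ 3 / 4) :
    volume (s.shadow N k R) ≤ ENNReal.ofReal |⟪N, s.rule.nrm k R⟫_ℝ| * s.area k R := by
  obtain ⟨c, hN', h1, -⟩ := s.flatPlane_nrm hF
  rw [area, if_pos hF]
  have hη := s.η_pos
  have hηt : 0 < s.η * 2 ^ (-k) := by positivity
  refine volume_shadow_le hn hN hN' (one_half_le_abs_inner hN hN' ht) (c := c)
    (e := s.η * 2 ^ (-k)) (fun x hx => h1 x (D.subset_of_mem hR hx) ?_) (by linarith)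
  refine (dist_center_le hR hx).trans ?_
  gcongr
  linarith [s.Λ_ge, D.Cstar_pos, D.a₀_pos]

theorem volume_shadow_add_le (hn : 0 < n) {c₁ : ℝ} (hc₁ : 0 < c₁)
    (hc : ∀ k, ∀ Q ∈ D.cubes k, s.rule.Flat k Q →
      ENNReal.ofReal c₁ * surfMeasure n E Q ≤ s.area k Q)
    (hQ : Q ∈ D.cubes k) (hg : s.rule.good N k Q) (hR : R ∈ D.cubes (k + 1)) (hRQ : R ⊆ Q)
    (hF : s.rule.Flat (k + 1) R) (hng : ¬ s.rule.good N (k + 1) R) :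
    volume (s.shadow N (k + 1) R) + ENNReal.ofReal (c₁ / 256) * surfMeasure n E R ≤
      s.area (k + 1) R := by
  have hN := (s.good_iff.1 hg).1
  obtain ⟨c, h⟩ := s.flatPlane_nrm hF
  have h1 := tilt_nrm_le hg hR hRQ hQ (D.center_mem _ R hR) h
  have h2 : 1 / 8 < tilt N (s.rule.nrm (k + 1) R) := by
    by_contra h3
    exact hng ⟨hN, hF, not_lt.1 h3⟩
  have h3 := volume_shadow_le_area hn hN hR hF (by linarith [s.η_le])
  have h4 : |⟪N, s.rule.nrm (k + 1) R⟫_ℝ| ≤ 127 / 128 := by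
    have := tilt_sq hN h.1
    refine abs_le_of_sq_le_sq (a := ⟪N, s.rule.nrm (k + 1) R⟫_ℝ) ?_ (by norm_num)
    nlinarith
  calc _ ≤ ENNReal.ofReal (127 / 128) * s.area (k + 1) R +
        ENNReal.ofReal (1 / 256) * s.area (k + 1) R := by
        refine add_le_add (h3.trans (mul_le_mul_left (ENNReal.ofReal_le_ofReal h4) _)) ?_
        rw [show c₁ / 256 = 1 / 256 * c₁ by ring, ENNReal.ofReal_mul (by norm_num), mul_assoc]
        exact mul_le_mul_right (hc _ R hR hF) _
    _ ≤ 1 * s.area (k + 1) R := by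
        rw [← add_mul, ← ENNReal.ofReal_add (by norm_num) (by norm_num)]
        refine mul_le_mul_left (ENNReal.ofReal_le_one.2 (by norm_num)) _
    _ = _ := one_mul _

end FlatScales

theorem TwoPlane.swap {n : ℕ} {E : Set (ES n)} {Λ η t : ℝ} {x N : ES n} {c₁ c₂ : ℝ}
    (h : TwoPlane E Λ η x t N c₁ c₂) : TwoPlane E Λ η x t N c₂ c₁ :=
  ⟨h.1, fun y hy hd => (h.2.1 y hy hd).symm, fun p hp hor => h.2.2 p hp hor.symm⟩

namespace FlatScales
variable {n : ℕ} {E : Set (ES n)} {D : DyadicSystem n E} {s : FlatScales D} {k : ℤ}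
  {Q R : Set (ES n)} {N N' : ES n} {c₁ c₂ : ℝ}

variable (s) in
/-- The cube `Q` is approximated by a union of two parallel planes. -/
def Approx (k : ℤ) (Q : Set (ES n)) : Prop :=
  ∃ N c₁ c₂, TwoPlane E (2 * s.Λ) s.η₁ (D.center Q) (2 ^ (-k)) N c₁ c₂

theorem Λ_pos : 0 < s.Λ := by linarith [s.Λ_ge, D.Cstar_pos, D.a₀_pos]

theorem zpow_M_le : (2 : ℝ) ^ (-((s.M : ℤ) + 1)) ≤ 1 / 2 := by
  rw [← zpow_neg_one (2 : ℝ) |>.trans (by norm_num : (2 : ℝ)⁻¹ = 1 / 2)]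
  exact zpow_le_zpow_right₀ (by norm_num) (by omega)

theorem η₁_le_η : 8 * s.η₁ ≤ s.η := by
  have h1 := s.η₁_le
  have h2 := s.zpow_M_le
  nlinarith [s.η_pos]

theorem lt_abs_sub_of_not_flat (hF : ¬ s.rule.Flat k Q)
    (h : TwoPlane E (2 * s.Λ) s.η₁ (D.center Q) (2 ^ (-k)) N c₁ c₂) :
    s.η / 2 * 2 ^ (-k) < |c₁ - c₂| := by
  by_contra! hc
  refine hF ⟨N, c₁, h.1, fun y hy hd => ?_, fun p hp hpc => ?_⟩
  all_goals
    have ht : (0 : ℝ) < 2 ^ (-k) := by positivity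
    have hΛt : 0 < s.Λ * 2 ^ (-k) := mul_pos Λ_pos ht
    have h1 : 8 * s.η₁ * 2 ^ (-k) ≤ s.η * 2 ^ (-k) := by gcongr; exact η₁_le_η
    have h2 : 0 < s.η₁ * 2 ^ (-k) := mul_pos s.η₁_pos ht
  · rcases h.2.1 y hy (by linarith) with h3 | h3
    · linarith
    · have := abs_sub_le ⟪N, y⟫_ℝ c₂ c₁
      rw [abs_sub_comm c₂ c₁] at this
      linarith
  · linarith [h.2.2 p (by linarith) (.inl hpc)]

theorem flatPlane_of_twoPlane (hF : ¬ s.rule.Flat k Q) (hQ : Q ∈ D.cubes k)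
    (h : TwoPlane E (2 * s.Λ) s.η₁ (D.center Q) (2 ^ (-k)) N c₁ c₂) {x : ES n} (hx : x ∈ Q)
    (hxc : |⟪N, x⟫_ℝ - c₁| ≤ s.η₁ * 2 ^ (-k)) :
    FlatPlane E s.Λ s.η x (2 ^ (-(k + s.M + 1))) N c₁ := by
  have hc := lt_abs_sub_of_not_flat hF h
  have ht : (0 : ℝ) < 2 ^ (-k) := by positivity
  have hk : (2 : ℝ) ^ (-(k + s.M + 1)) = 2 ^ (-((s.M : ℤ) + 1)) * 2 ^ (-k) := by
    rw [add_assoc, zpow_neg_add]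
  have h1 : 8 * s.η₁ * 2 ^ (-k) ≤ s.η * 2 ^ (-k) := by gcongr; exact η₁_le_η
  have h2 : 0 < s.η₁ * 2 ^ (-k) := mul_pos s.η₁_pos ht
  have h3 := mul_le_mul_of_nonneg_right s.M_le ht.le
  have h4 := mul_le_mul_of_nonneg_right s.η₁_le ht.le
  have h5 : s.η * 2 ^ (-k) ≤ 1 / 200 * 2 ^ (-k) := by gcongr; exact s.η_le
  have h6 : (4 * D.Cstar + 10 + D.a₀) * 2 ^ (-k) ≤ s.Λ * 2 ^ (-k) := by gcongr; exact s.Λ_ge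
  have h7 : 0 < D.Cstar * 2 ^ (-k) := mul_pos D.Cstar_pos ht
  have h8 : 0 < D.a₀ * 2 ^ (-k) := mul_pos D.a₀_pos ht
  have hxz := dist_center_le hQ hx
  rw [hk]
  refine ⟨h.1, fun y hy hd => ?_, fun p hp hpc => ?_⟩
  · rcases h.2.1 y hy (by linarith [dist_triangle y x (D.center Q)]) with h9 | h9
    · linarith
    · have h10 := abs_sub_le c₁ ⟪N, y⟫_ℝ c₂
      have h11 := abs_sub_le c₁ ⟪N, x⟫_ℝ ⟪N, y⟫_ℝ
      have h12 := abs_inner_sub_le_dist h.1 x y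
      rw [abs_sub_comm c₁ ⟪N, x⟫_ℝ] at h11
      rw [dist_comm] at hd
      linarith
  · linarith [h.2.2 p (by linarith [dist_triangle p x (D.center Q)]) (.inl hpc)]

theorem exists_flatPlane_of_twoPlane (hF : ¬ s.rule.Flat k Q) (hQ : Q ∈ D.cubes k)
    (h : TwoPlane E (2 * s.Λ) s.η₁ (D.center Q) (2 ^ (-k)) N c₁ c₂) {x : ES n} (hx : x ∈ Q) :
    ∃ c, FlatPlane E s.Λ s.η x (2 ^ (-(k + s.M + 1))) N c := by
  have ht : (0 : ℝ) < 2 ^ (-k) := by positivity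
  have h6 : (4 * D.Cstar + 10 + D.a₀) * 2 ^ (-k) ≤ s.Λ * 2 ^ (-k) := by gcongr; exact s.Λ_ge
  have h7 : 0 < D.Cstar * 2 ^ (-k) := mul_pos D.Cstar_pos ht
  have h8 : 0 < D.a₀ * 2 ^ (-k) := mul_pos D.a₀_pos ht
  rcases h.2.1 x (D.subset_of_mem hQ hx) (by linarith [dist_center_le hQ hx]) with h1 | h1
  · exact ⟨c₁, flatPlane_of_twoPlane hF hQ h hx h1⟩
  · exact ⟨c₂, flatPlane_of_twoPlane hF hQ h.swap hx h1⟩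

theorem flat_of_not_flat (hF : ¬ s.rule.Flat k Q) (hA : s.Approx k Q) (hQ : Q ∈ D.cubes k)
    (hR : R ∈ D.cubes (k + s.M + 1)) (hRQ : R ⊆ Q) : s.rule.Flat (k + s.M + 1) R := by
  obtain ⟨N, c₁, c₂, h⟩ := hA
  obtain ⟨c, hc⟩ := exists_flatPlane_of_twoPlane hF hQ h (hRQ (D.center_mem _ R hR))
  exact ⟨N, c, hc⟩

/-- In a non-flat cube with a flat parent, the two approximating planes are close to each other and
their normal is close to the one of the parent. -/
theorem tilt_le_of_parent_flat (hQ : Q ∈ D.cubes k) (hQF : s.rule.Flat k Q)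
    (hR : R ∈ D.cubes (k + 1)) (hRQ : R ⊆ Q) (hF : ¬ s.rule.Flat (k + 1) R)
    (h : TwoPlane E (2 * s.Λ) s.η₁ (D.center R) (2 ^ (-(k + 1))) N c₁ c₂)
    (hz : |⟪N, D.center R⟫_ℝ - c₁| ≤ s.η₁ * 2 ^ (-(k + 1))) :
    tilt (s.rule.nrm k Q) N ≤ 8 * s.η ∧ |c₁ - c₂| ≤ (10 * s.η + s.η₁) * 2 ^ (-(k + 1)) := by
  obtain ⟨c, hN', h1, -⟩ := s.flatPlane_nrm hQF
  set N' := s.rule.nrm k Q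
  set z := D.center R
  set t : ℝ := 2 ^ (-(k + 1)) with ht'
  have hN := h.1
  have htt : (2 : ℝ) ^ (-k) = 2 * t := by rw [ht', zpow_neg_add, zpow_neg_one]; ring
  rw [htt] at h1
  have ht : 0 < t := by positivity
  have hzE : z ∈ E := D.center_mem_E hR
  have h2 : 8 * s.η₁ * t ≤ s.η * t := by gcongr; exact η₁_le_η
  have h3 : 0 < s.η₁ * t := mul_pos s.η₁_pos ht
  have h5 : s.η * t ≤ 1 / 200 * t := by gcongr; exact s.η_le
  have h6 : (4 * D.Cstar + 10 + D.a₀) * t ≤ s.Λ * t := by gcongr; exact s.Λ_ge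
  have h7 : 0 < D.Cstar * t := mul_pos D.Cstar_pos ht
  have h8 : 0 < D.a₀ * t := mul_pos D.a₀_pos ht
  have hzc := dist_center_le hQ (hRQ (D.center_mem _ R hR))
  rw [htt] at hzc
  have htilt : tilt N' N ≤ 8 * s.η := by
    obtain ⟨p₀, hp₀, -, hp₀d⟩ := exists_over_point (p := proj N z) hN hN (by
      rw [real_inner_self_eq_norm_sq, hN]; norm_num) (δ := 0) hz (by simp)
    have key := tilt_mul_le_of_approx_two_sided ⟨z, hzE⟩ hN hN' (p₀ := p₀) (ρ := t)
      (h := s.η₁ * t) (e := s.η * (2 * t)) (c' := c) ht.le h3 (by linarith)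
      (fun p hp hpc => h.2.2 p (by linarith [dist_triangle p p₀ z]) (.inl (hpc.trans hp₀)))
      fun y hy hyp => h1 y hy (by
        linarith [dist_triangle y p₀ (D.center Q), dist_triangle p₀ z (D.center Q)])
    rw [tilt_comm hN' hN]
    nlinarith
  refine ⟨htilt, ?_⟩
  obtain ⟨y, hy, hyz, hyc⟩ : ∃ y ∈ E, dist y z ≤ s.Λ * t ∧ |⟪N, y⟫_ℝ - c₂| ≤ s.η₁ * t := by
    by_contra! hcon
    refine hF ⟨N, c₁, hN, fun y hy hd => ?_, fun p hp hpc => ?_⟩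
    · rcases h.2.1 y hy (by linarith) with h9 | h9
      · linarith
      · exact absurd h9 (not_le.2 (hcon y hy hd))
    · linarith [h.2.2 p (by linarith) (.inl hpc)]
  set a := c₂ - ⟪N, z⟫_ℝ with ha
  have haΛ : |a| ≤ s.η₁ * t + s.Λ * t := by
    have := abs_sub_le c₂ ⟪N, y⟫_ℝ ⟪N, z⟫_ℝ
    rw [abs_sub_comm c₂ ⟪N, y⟫_ℝ] at this
    linarith [abs_inner_sub_le_dist hN y z]
  have hqz : dist (z + a • N) z = |a| := by
    rw [dist_eq_norm, add_sub_cancel_left, norm_smul, hN, mul_one, Real.norm_eq_abs]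
  obtain ⟨w, hw, hqw⟩ := exists_mem_dist_lt_of_infDist_le ⟨z, hzE⟩ h3
    (h.2.2 (z + a • N) (by rw [hqz]; linarith) (.inr (by
      rw [inner_add_right, inner_smul_right, real_inner_self_eq_norm_sq, hN, ha]; ring)))
  have hwz := dist_triangle_left w z (z + a • N)
  have h9 := h1 w hw (by linarith [dist_triangle w z (D.center Q)])
  have h10 := h1 z hzE (by linarith)
  have h11 : |a * ⟪N', N⟫_ℝ| ≤ 5 * s.η * t := by
    have h12 := abs_inner_sub_le_dist hN' (z + a • N) w
    rw [inner_add_right, inner_smul_right] at h12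
    rw [abs_le] at *
    constructor <;> linarith
  have h13 := one_half_le_abs_inner hN' hN (by linarith [s.η_le])
  rw [abs_mul] at h11
  have h14 : |a| ≤ 10 * s.η * t := by nlinarith [abs_nonneg a]
  have h15 := abs_sub_le c₁ ⟪N, z⟫_ℝ c₂
  rw [abs_sub_comm c₁ ⟪N, z⟫_ℝ, abs_sub_comm ⟪N, z⟫_ℝ c₂, ← ha] at h15
  linarith

end FlatScales

theorem two_mul_measure_le_tsum {S ι : Type*} [MeasurableSpace S] [Countable ι] (μ : Measure S)
    {A : Set S} {B : ι → Set S} (hB : ∀ i, MeasurableSet (B i))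
    (h : ∀ x ∈ A, ∃ i j, i ≠ j ∧ x ∈ B i ∧ x ∈ B j) : 2 * μ A ≤ ∑' i, μ (B i) := by
  classical
  have hm : ∀ i, Measurable ((B i).indicator (1 : S → ℝ≥0∞)) := fun i =>
    measurable_one.indicator (hB i)
  calc _ ≤ 2 * μ {x | 2 ≤ ∑' i, (B i).indicator (1 : S → ℝ≥0∞) x} := by
        refine mul_le_mul_right (measure_mono fun x hx => ?_) _
        obtain ⟨i, j, hij, hi, hj⟩ := h x hx
        have := ENNReal.sum_le_tsum {i, j} (f := fun i => (B i).indicator (1 : S → ℝ≥0∞) x)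
        rw [Finset.sum_pair hij, indicator_of_mem hi, indicator_of_mem hj] at this
        simpa [one_add_one_eq_two] using this
    _ ≤ ∫⁻ x, ∑' i, (B i).indicator (1 : S → ℝ≥0∞) x ∂μ :=
        mul_meas_ge_le_lintegral (Measurable.tsum hm) 2
    _ = _ := by
        rw [lintegral_tsum fun i => (hm i).aemeasurable]
        exact tsum_congr fun i => lintegral_indicator_one (hB i)

namespace FlatScales
variable {n : ℕ} {E : Set (ES n)} {D : DyadicSystem n E} {s : FlatScales D} {k : ℤ}
  {Q R : Set (ES n)} {N N' : ES n} {c₁ c₂ : ℝ}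

theorem exists_two_shadows (hQ : Q ∈ D.cubes k) (hg : s.rule.good N k Q)
    (hR : R ∈ D.cubes (k + 1)) (hRQ : R ⊆ Q) (hF : ¬ s.rule.Flat (k + 1) R)
    (h : TwoPlane E (2 * s.Λ) s.η₁ (D.center R) (2 ^ (-(k + 1))) N' c₁ c₂)
    (hz : |⟪N', D.center R⟫_ℝ - c₁| ≤ s.η₁ * 2 ^ (-(k + 1))) {y₀ : ES n} (hy₀ : y₀ ∈ R)
    (hd : 100 * s.η * 2 ^ (-(k + 1)) < infDist y₀ (E \ R)) {p : EuclideanSpace ℝ (Fin n)}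
    (hp : dist p (proj N y₀) < 4 * s.η * 2 ^ (-(k + 1))) :
    ∃ T₁ T₂, T₁ ≠ T₂ ∧ (T₁ ∈ D.cubes (k + 1 + s.M + 1) ∧ T₁ ⊆ R) ∧
      (T₂ ∈ D.cubes (k + 1 + s.M + 1) ∧ T₂ ⊆ R) ∧
      p ∈ s.shadow N (k + 1 + s.M + 1) T₁ ∧ p ∈ s.shadow N (k + 1 + s.M + 1) T₂ := by
  obtain ⟨hN, hQF, ht1⟩ := s.good_iff.1 hg
  obtain ⟨ht2, hcc⟩ := tilt_le_of_parent_flat hQ hQF hR hRQ hF h hz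
  obtain ⟨-, hNQ, -⟩ := s.flatPlane_nrm hQF
  have hN' := h.1
  have hcc' := lt_abs_sub_of_not_flat hF h
  have htilt : tilt N N' ≤ 3 / 4 := by
    linarith [tilt_triangle hN hNQ hN', s.η_le]
  have hNN := one_half_le_abs_inner hN hN' htilt
  have hk : (2 : ℝ) ^ (-(k + 1 + s.M + 1)) = 2 ^ (-((s.M : ℤ) + 1)) * 2 ^ (-(k + 1)) := by
    rw [add_assoc (k + 1), zpow_neg_add]
  set z := D.center R
  set t : ℝ := 2 ^ (-(k + 1)) with ht'
  set u : ℝ := 2 ^ (-((s.M : ℤ) + 1))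
  have ht : 0 < t := by positivity
  have hu : 0 < u := by positivity
  have h2 : 8 * s.η₁ * t ≤ s.η * t := by gcongr; exact η₁_le_η
  have h3 : 0 < s.η₁ * t := mul_pos s.η₁_pos ht
  have h5 : s.η * t ≤ 1 / 200 * t := by gcongr; exact s.η_le
  have h6 : (4 * D.Cstar + 10 + D.a₀) * t ≤ s.Λ * t := by gcongr; exact s.Λ_ge
  have h7 : 0 < D.Cstar * t := mul_pos D.Cstar_pos ht
  have h8 : 0 < D.a₀ * t := mul_pos D.a₀_pos ht
  have h9 := mul_le_mul_of_nonneg_right s.M_le ht.le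
  have h10 := mul_le_mul_of_nonneg_right s.η₁_le ht.le
  have h11 : (4 * D.Cstar + 10 + D.a₀) * t * u ≤ s.Λ * t * u := by gcongr
  have hy₀E := D.subset_of_mem hR hy₀
  have hy₀z := dist_center_le hR hy₀
  have hzE : z ∈ E := D.center_mem_E hR
  have hy₀c : |⟪N', y₀⟫_ℝ - c₁| ≤ 11 * s.η * t ∧ |⟪N', y₀⟫_ℝ - c₂| ≤ 11 * s.η * t := by
    rcases h.2.1 y₀ hy₀E (by linarith) with h12 | h12
    · have := abs_sub_le ⟪N', y₀⟫_ℝ c₁ c₂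
      constructor <;> linarith
    · have := abs_sub_le ⟪N', y₀⟫_ℝ c₂ c₁
      rw [abs_sub_comm c₂ c₁] at this
      constructor <;> linarith
  have key : ∀ c, (c = c₁ ∨ c = c₂) → |⟪N', y₀⟫_ℝ - c| ≤ 11 * s.η * t →
      ∃ y ∈ R, dist p (proj N y) < 2 * s.η₁ * t ∧ |⟪N', y⟫_ℝ - c| < 2 * s.η₁ * t := by
    intro c hc hyc
    obtain ⟨q, hq, hqp, hqd⟩ := exists_over_point hN hN' hNN hyc hp.le
    obtain ⟨y, hy, hqy⟩ := exists_mem_dist_lt_of_infDist_le ⟨z, hzE⟩ h3 (h.2.2 q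
      (by linarith [dist_triangle q y₀ z]) (by rw [hq]; exact hc))
    refine ⟨y, mem_of_dist_lt (y₀ := y₀) hy ?_, ?_, ?_⟩
    · linarith [dist_triangle_left y y₀ q]
    · rw [← hqp]
      linarith [dist_proj_le hN q y]
    · rw [← hq]
      linarith [abs_inner_sub_le_dist hN' y q, dist_comm y q]
  obtain ⟨y₁, hy₁, hpy₁, hyc₁⟩ := key c₁ (.inl rfl) hy₀c.1
  obtain ⟨y₂, hy₂, hpy₂, hyc₂⟩ := key c₂ (.inr rfl) hy₀c.2
  have hin : ∀ y ∈ R, dist p (proj N y) < 2 * s.η₁ * t → p ∈ s.shadow N (k + 1 + s.M + 1)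
      (D.cubeAt (k + 1 + s.M + 1) y) := by
    intro y hy hpy
    refine mem_thickening_iff.2 ⟨_, ⟨y, D.mem_cubeAt _ (D.subset_of_mem hR hy), rfl⟩, ?_⟩
    rw [hk]
    linarith
  have hy₁E := D.subset_of_mem hR hy₁
  have hy₂E := D.subset_of_mem hR hy₂
  refine ⟨D.cubeAt (k + 1 + s.M + 1) y₁, D.cubeAt (k + 1 + s.M + 1) y₂, fun heq => ?_,
    ⟨D.cubeAt_mem _ hy₁E, D.cubeAt_subset (by omega) hR hy₁⟩,
    ⟨D.cubeAt_mem _ hy₂E, D.cubeAt_subset (by omega) hR hy₂⟩, hin _ hy₁ hpy₁, hin _ hy₂ hpy₂⟩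
  have h13 := D.dist_le (D.cubeAt_mem _ hy₁E) (D.mem_cubeAt (k + 1 + s.M + 1) hy₁E)
    (heq ▸ D.mem_cubeAt _ hy₂E)
  rw [hk] at h13
  have h14 := abs_inner_sub_le_dist hN' y₁ y₂
  have h15 := abs_sub_le c₁ ⟪N', y₁⟫_ℝ c₂
  have h16 := abs_sub_le ⟪N', y₁⟫_ℝ ⟪N', y₂⟫_ℝ c₂
  rw [abs_sub_comm c₁ ⟪N', y₁⟫_ℝ] at h15
  have h17 : 0 < t * u := by positivity
  have h18 : 0 < D.a₀ * t * u := by positivity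
  have h19 : 0 < D.Cstar * t * u := by positivity
  have h20 : s.η * (t * u) ≤ 1 / 200 * (t * u) := by gcongr; exact s.η_le
  linarith

theorem volume_shadow_add_le_tsum (hn : 0 < n) {c₀ b : ℝ} (hc₀ : 0 < c₀)
    (hc : ∀ k, ∀ Q ∈ D.cubes k, s.rule.Flat k Q →
      ENNReal.ofReal c₀ * surfMeasure n E Q ≤ s.area k Q) (hb : b ≤ c₀ / 8)
    (hB : volume (thickening (20 * s.η * 2 ^ (-(k + 1))) (proj N ''
        {y ∈ R | infDist y (E \ R) ≤ 100 * s.η * 2 ^ (-(k + 1))})) ≤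
        ENNReal.ofReal b * surfMeasure n E R)
    (hQ : Q ∈ D.cubes k) (hg : s.rule.good N k Q) (hR : R ∈ D.cubes (k + 1)) (hRQ : R ⊆ Q)
    (hF : ¬ s.rule.Flat (k + 1) R) (hA : s.Approx (k + 1) R) :
    volume (s.shadow N (k + 1) R) + ENNReal.ofReal (c₀ / 256) * surfMeasure n E R ≤
      ∑' T : {T | T ∈ D.cubes (k + 1 + s.M + 1) ∧ T ⊆ R}, s.area (k + 1 + s.M + 1) T.1 := by
  set ι := {T | T ∈ D.cubes (k + 1 + s.M + 1) ∧ T ⊆ R}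
  have hcount : Countable ι :=
    ((D.countable (k + 1 + s.M + 1)).mono fun R hR => hR.1).to_subtype
  obtain ⟨hN, hQF, ht1⟩ := s.good_iff.1 hg
  obtain ⟨-, hNQ, -⟩ := s.flatPlane_nrm hQF
  have hη := s.η_pos
  obtain ⟨N', c₁, c₂, h, hz⟩ : ∃ N' c₁ c₂, TwoPlane E (2 * s.Λ) s.η₁ (D.center R)
      (2 ^ (-(k + 1))) N' c₁ c₂ ∧ |⟪N', D.center R⟫_ℝ - c₁| ≤ s.η₁ * 2 ^ (-(k + 1)) := by
    obtain ⟨N', c₁, c₂, h⟩ := hA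
    have h1 : 0 ≤ 2 * s.Λ * 2 ^ (-(k + 1)) :=
      mul_nonneg (by linarith [s.Λ_pos]) (by positivity)
    rcases h.2.1 (D.center R) (D.center_mem_E hR) (by rwa [dist_self]) with h2 | h2
    · exact ⟨N', c₁, c₂, h, h2⟩
    · exact ⟨N', c₂, c₁, h.swap, h2⟩
  set S := ∑' T : ι, s.area (k + 1 + s.M + 1) T.1
  have hflat : ∀ T : ι, s.rule.Flat (k + 1 + s.M + 1) T.1 := fun T =>
    flat_of_not_flat hF hA hR T.2.1 T.2.2
  have hst : ∀ T : ι, volume (s.shadow N (k + 1 + s.M + 1) T.1) ≤ s.area (k + 1 + s.M + 1) T.1 := by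
    intro T
    have hT := T.2.2 (D.center_mem _ _ T.2.1)
    obtain ⟨c', hT'⟩ := s.flatPlane_nrm (hflat T)
    obtain ⟨c, hc'⟩ := exists_flatPlane_of_twoPlane hF hR h hT
    have ht : (0 : ℝ) < 2 ^ (-(k + 1 + s.M + 1)) := by positivity
    have h1 := tilt_nrm_le_of_flatPlane ht (D.subset_of_mem hR hT) hc' hT' (by
      rw [dist_self, zero_add]
      gcongr
      linarith [s.Λ_ge, D.Cstar_pos, D.a₀_pos])
    have h2 : tilt N' (s.rule.nrm (k + 1 + s.M + 1) T.1) ≤ 6 * s.η := by nlinarith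
    have h3 := (tilt_le_of_parent_flat hQ hQF hR hRQ hF h hz).1
    have h4 := tilt_triangle hN hNQ h.1
    have h5 := tilt_triangle hN h.1 hT'.1
    refine (volume_shadow_le_area hn hN T.2.1 (hflat T) (by linarith [s.η_le])).trans ?_
    refine (mul_le_mul_left (ENNReal.ofReal_le_one.2 ?_) _).trans (one_mul _).le
    simpa [hT'.1] using abs_inner_le_of_unit hN (s.rule.nrm (k + 1 + s.M + 1) T.1)
  have hcov := volume_le_add_of_deep (Q := R) (s := s) (N := N) (k := k + 1) (δ := 4 * s.η * 2 ^ (-(k + 1)))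
    (A := {p | ∃ y ∈ R, 100 * s.η * 2 ^ (-(k + 1)) < infDist y (E \ R) ∧
      dist p (proj N y) < 4 * s.η * 2 ^ (-(k + 1))}) (by gcongr; norm_num)
    fun p y hy hd hp => ⟨y, hy, hd, hp⟩
  have htwo := two_mul_measure_le_tsum volume (A := {p | ∃ y ∈ R,
      100 * s.η * 2 ^ (-(k + 1)) < infDist y (E \ R) ∧
      dist p (proj N y) < 4 * s.η * 2 ^ (-(k + 1))})
    (B := fun T : ι => s.shadow N (k + 1 + s.M + 1) T.1)
    (fun T => isOpen_thickening.measurableSet) (by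
      rintro p ⟨y, hy, hd, hp⟩
      obtain ⟨T₁, T₂, hne, h1, h2, hp1, hp2⟩ := exists_two_shadows hQ hg hR hRQ hF h hz hy hd hp
      exact ⟨⟨T₁, h1⟩, ⟨T₂, h2⟩, fun he => hne (congrArg Subtype.val he), hp1, hp2⟩)
  have h1 := htwo.trans (ENNReal.tsum_le_tsum hst)
  have h2 : ENNReal.ofReal c₀ * surfMeasure n E R ≤ S := by
    have := D.lintegral_eq_tsum (m := k + 1 + s.M + 1) (by omega) hR (surfMeasure n E)
      fun _ => ENNReal.ofReal c₀
    simp only [setLIntegral_const] at this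
    rw [this]
    exact ENNReal.tsum_le_tsum fun T => hc _ _ T.2.1 (hflat T)
  set V := volume {p | ∃ y ∈ R, 100 * s.η * 2 ^ (-(k + 1)) < infDist y (E \ R) ∧
      dist p (proj N y) < 4 * s.η * 2 ^ (-(k + 1))}
  set σR := surfMeasure n E R
  refine (ENNReal.mul_le_mul_iff_right (a := 2) (by norm_num) (by norm_num)).1 ?_
  calc 2 * (volume (s.shadow N (k + 1) R) + ENNReal.ofReal (c₀ / 256) * σR)
      ≤ 2 * ((V + ENNReal.ofReal (c₀ / 8) * σR) + ENNReal.ofReal (c₀ / 8) * σR) := by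
        refine mul_le_mul_right (add_le_add (hcov.trans (add_le_add_right (hB.trans ?_) _)) ?_) _
        · exact mul_le_mul_left (ENNReal.ofReal_le_ofReal hb) _
        · exact mul_le_mul_left (ENNReal.ofReal_le_ofReal (by linarith)) _
    _ = 2 * V + ENNReal.ofReal (c₀ / 2) * σR := by
        rw [show c₀ / 2 = c₀ / 8 + c₀ / 8 + c₀ / 8 + c₀ / 8 by ring,
          ENNReal.ofReal_add (by positivity) (by positivity),
          ENNReal.ofReal_add (by positivity) (by positivity),
          ENNReal.ofReal_add (by positivity) (by positivity)]
        ring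
    _ ≤ S + ENNReal.ofReal c₀ * σR := by
        refine add_le_add h1 (mul_le_mul_left (ENNReal.ofReal_le_ofReal (by linarith)) _)
    _ ≤ 2 * S := by rw [two_mul]; exact add_le_add_right h2 _

theorem exists_bound (hn : 0 < n) {C : ℝ} (hE : Regular n C E) (D : DyadicSystem n E)
    (hTP : ∀ Λ η : ℝ, 1 ≤ Λ → 0 < η → ∃ A : ℝ≥0∞, A ≠ ⊤ ∧ D.Carleson (D.family fun k Q =>
      ¬ ∃ N c₁ c₂, TwoPlane E Λ η (D.center Q) (2 ^ (-k)) N c₁ c₂) A) :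
    ∃ s : FlatScales D, ∃ A : ℝ≥0∞, A ≠ ⊤ ∧ ∀ m k, ∀ Q ∈ D.cubes k,
      ∫⁻ x in Q, s.rule.cnt D m (s.rule.root k Q) k x ∂(surfMeasure n E) ≤
        A * surfMeasure n E Q := by
  obtain ⟨B, hB, hvol⟩ := exists_volume_le hE D
  obtain ⟨c₀, hc₀, harea⟩ := exists_le_area hE D
  have hCs := D.Cstar_pos
  have ha := D.a₀_pos
  have hlim : ∀ b : ℝ, 0 < b → ∀ a : ℝ, 0 < a → ∃ i : ℕ, a * (2 : ℝ) ^ (-(i : ℤ)) ≤ b := by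
    intro b hb a ha
    obtain ⟨i, hi⟩ := exists_pow_lt_of_lt_one (show 0 < b / a by positivity)
      (show (1 / 2 : ℝ) < 1 by norm_num)
    refine ⟨i, ?_⟩
    rw [lt_div_iff₀ ha] at hi
    rw [zpow_neg, zpow_natCast, ← inv_pow, inv_eq_one_div]
    linarith
  set b := c₀ / 512 / B
  obtain ⟨i, hi⟩ := hlim (min (1 / 200) (min (D.a₀ / 102) (b ^ D.γ⁻¹))) (by positivity) D.Cstar hCs
  rw [le_min_iff, le_min_iff] at hi
  set η := D.Cstar * 2 ^ (-(i : ℤ)) with hηdef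
  have hη : 0 < η := by positivity
  set Λ := 4 * D.Cstar + 10 + D.a₀ with hΛ
  obtain ⟨M, hM⟩ := hlim η hη (16 * Λ) (by positivity)
  let s : FlatScales D :=
    { Λ := Λ
      η := η
      η₁ := η * 2 ^ (-((M : ℤ) + 1)) / 4
      i := i
      M := M
      η_eq := rfl
      η_le := hi.1
      η_lt := by linarith [hi.2.1]
      Λ_ge := le_rfl
      M_le := (mul_le_mul_of_nonneg_left (zpow_neg_le_of_le (by omega)) (by positivity)).trans hM
      η₁_pos := by positivity
      η₁_le := by linarith }
  have hκ : B * s.η ^ D.γ ≤ c₀ / 512 := by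
    have h1 : s.η ^ D.γ ≤ (b ^ D.γ⁻¹) ^ D.γ := Real.rpow_le_rpow hη.le hi.2.2 D.γ_pos.le
    rw [← Real.rpow_mul (by positivity), inv_mul_cancel₀ D.γ_pos.ne', Real.rpow_one] at h1
    calc _ ≤ B * b := by gcongr
      _ = _ := by simp only [b]; field_simp
  obtain ⟨A, hA, hCar⟩ := hTP (2 * s.Λ) s.η₁ (by simp only [s]; linarith) s.η₁_pos
  have key : s.rule.Controlled D (fun k Q => ¬ s.Approx k Q) s.area
      (fun N k Q => volume (s.shadow N k Q)) (fun N m k Q => volume (s.covered N m k Q))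
      (ENNReal.ofReal (c₀ / 256)) (ENNReal.ofReal (c₀ / 512)) (ENNReal.ofReal B) :=
    { lt := (ENNReal.ofReal_lt_ofReal_iff (by positivity)).2 (by linarith)
      ne_top := ENNReal.ofReal_ne_top
      ne_top' := ENNReal.ofReal_ne_top
      good_nrm := fun k Q hQ hF => by
        obtain ⟨c, h⟩ := s.flatPlane_nrm hF
        exact s.good_iff.2 ⟨h.1, hF, by rw [tilt_self h.1]; norm_num⟩
      a_zero := fun k Q hQ hF => if_neg hF
      le_a := fun k Q hQ hF => le_trans (mul_le_mul_left (ENNReal.ofReal_le_ofReal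
        (by linarith)) _) (harea s k Q hQ hF)
      sh_le := fun v k Q hQ hg => by
        rw [covered_zero]
        exact (hvol s v (s.good_iff.1 hg).1 k Q hQ).1
      sh_le' := fun v k Q hQ hg R hR hRQ => (hvol s v (s.good_iff.1 hg).1 _ R hR).1
      a_le_cov := fun m k Q hQ hF => by
        obtain ⟨c, h⟩ := s.flatPlane_nrm hF
        have hg := s.good_iff.2 ⟨h.1, hF, by rw [tilt_self h.1]; norm_num⟩
        rw [area, if_pos hF]
        refine (volume_le_add_of_deep le_rfl fun p y hy hd hp =>
          mem_covered m hQ hg hy hd hp).trans (add_le_add_right ?_ _)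
        exact (hvol s _ h.1 k Q hQ).2.2.trans
          (mul_le_mul_left (ENNReal.ofReal_le_ofReal hκ) _)
      cov_succ := fun v m k Q hQ hg => exists_covered_succ_le m hQ
      leave := fun v k Q hQ hg R hR hRQ hF hng =>
        volume_shadow_add_le hn hc₀ (harea s) hQ hg hR hRQ hF hng
      descend := fun k Q hQ hF hA R hR hRQ => flat_of_not_flat hF (not_not.1 hA) hQ hR hRQ
      leave_mid := fun v k Q hQ hg R hR hRQ hF hA =>
        volume_shadow_add_le_tsum hn hc₀ (harea s) (b := c₀ / 512) (by linarith)
          ((hvol s v (s.good_iff.1 hg).1 _ R hR).2.2.trans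
            (mul_le_mul_left (ENNReal.ofReal_le_ofReal hκ) _)) hQ hg hR hRQ hF (not_not.1 hA) }
  obtain ⟨A', hA', h⟩ := key.exists_bound hE hA hCar
  exact ⟨s, A', hA', h⟩

end FlatScales

theorem exists_zpow_scale {d : ℝ} (hd : 0 < d) :
    ∃ k : ℤ, (2 : ℝ) ^ (-(k + 1)) < d ∧ d ≤ 2 ^ (-k) := by
  obtain ⟨m, h1, h2⟩ := exists_mem_Ioc_zpow hd (show (1 : ℝ) < 2 by norm_num)
  exact ⟨-(m + 1), by simpa using h1, by simpa using h2⟩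

theorem lt_of_zpow_neg_lt {i k : ℤ} (h : (2 : ℝ) ^ (-k) < 2 ^ (-i)) : i < k := by
  by_contra! hc
  exact absurd (zpow_neg_le_of_le hc) (not_le.2 h)

section expansion
variable {X V : Type*} [NormedAddCommGroup X] [NormedSpace ℝ X] [NormedAddCommGroup V]
  [NormedSpace ℝ V]

/-- A set whose points see few bad scales, and which is expanded by suitable linear maps between
consecutive bad scales, can be mapped by a map with Lipschitz inverse. -/
theorem exists_expanding_map {F : Set X} {b : X → Set ℤ} {T : ℤ → X → X →ₗ[ℝ] V} {j : ℤ}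
    (hT : ∀ k > j, ∀ z ∈ F, k ∉ b z → ∀ v, ‖T k z v‖ ≤ ‖v‖)
    (hb : ∀ k > j, ∀ x ∈ F, ∀ y ∈ F, k ∈ b x → dist x y ≤ 2 ^ (-k) →
      k ∈ b y ∧ dist x y ≤ 1 / 16 * 2 ^ (-k))
    (hexp : ∀ k > j, ∀ k' ≥ k, ∀ z ∈ F, ∀ x ∈ F, ∀ y ∈ F, dist z x ≤ 1 / 8 * 2 ^ (-k) → k ∉ b z →
      (∀ i, k ≤ i → i ≤ k' → i ∉ b x) → (2 : ℝ) ^ (-(k' + 1)) < dist x y →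
      dist x y ≤ 2 ^ (-k') → dist x y ≤ 2 * ‖T k z (x - y)‖)
    (M : ℕ) : ∀ k ≥ j, ∀ F' ⊆ F, (∀ x ∈ F', ∀ y ∈ F', dist x y ≤ 1 / 16 * 2 ^ (-k)) →
      (∀ x ∈ F', (b x ∩ Ioi k).encard ≤ M) →
      ∃ ψ : X → V, (∀ x ∈ F', ‖ψ x‖ ≤ 2 * 2 ^ (-k)) ∧
        ∀ x ∈ F', ∀ y ∈ F', (1 / 32) ^ M / 4 * dist x y ≤ dist (ψ x) (ψ y) := by
  induction M using Nat.strong_induction_on with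
  | _ M ih =>
  intro k hk F' hF' hdiam hcard
  rcases F'.eq_empty_or_nonempty with rfl | ⟨z, hz⟩
  · exact ⟨0, by simp, by simp⟩
  have htk : (0 : ℝ) < 2 ^ (-k) := by positivity
  have hk1 : (2 : ℝ) ^ (-(k + 1)) = 1 / 2 * 2 ^ (-k) := by rw [zpow_neg_add]; norm_num
  have hpred : ∀ κ > k, ∀ x ∈ F', κ ∈ b x → ∃ M', M = M' + 1 ∧ (b x ∩ Ioi κ).encard ≤ M' := by
    intro κ hκ x hx hκx
    have h1 : insert κ (b x ∩ Ioi κ) ⊆ b x ∩ Ioi k :=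
      insert_subset ⟨hκx, hκ⟩ fun i hi => ⟨hi.1, hκ.trans hi.2⟩
    have h2 := (encard_le_encard h1).trans (hcard x hx)
    rw [encard_insert_of_notMem fun h => lt_irrefl κ h.2] at h2
    cases M with
    | zero => simp at h2
    | succ M' =>
      refine ⟨M', rfl, ?_⟩
      push_cast at h2
      exact (ENat.add_le_add_iff_right (by simp)).1 h2
  by_cases hkz : k + 1 ∈ b z
  · have hall : ∀ x ∈ F', k + 1 ∈ b x := fun x hx =>
      (hb (k + 1) (by omega) z (hF' hz) x (hF' hx) hkz
        (by linarith [hdiam z hz x hx])).1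
    obtain ⟨M', rfl, -⟩ := hpred (k + 1) (by omega) z hz hkz
    obtain ⟨ψ, h1, h2⟩ := ih M' (by omega) (k + 1) (by omega) F' hF' (fun x hx y hy =>
      (hb (k + 1) (by omega) x (hF' hx) y (hF' hy) (hall x hx)
        (by linarith [hdiam x hx y hy])).2) fun x hx => by
        obtain ⟨M'', h, h'⟩ := hpred (k + 1) (by omega) x hx (hall x hx)
        obtain rfl : M' = M'' := by omega
        exact h'
    refine ⟨ψ, fun x hx => (h1 x hx).trans (by linarith), fun x hx y hy => le_trans ?_ (h2 x hx y hy)⟩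
    gcongr (?_ / 4 * _)
    exact pow_le_pow_of_le_one (by norm_num) (by norm_num) (by omega)
  let fst : X → ℤ → Prop := fun x κ => κ ∈ b x ∧ k < κ ∧ ∀ i ∈ b x, k < i → κ ≤ i
  have hfst : ∀ x i, i ∈ b x → k < i → ∃ κ, fst x κ ∧ κ ≤ i := by
    intro x i hi hki
    obtain ⟨κ, h1, h2⟩ := Int.exists_least_of_bdd (P := fun i => i ∈ b x ∧ k < i)
      ⟨k, fun i hi => hi.2.le⟩ ⟨i, hi, hki⟩
    exact ⟨κ, ⟨h1.1, h1.2, fun i hi hki => h2 i ⟨hi, hki⟩⟩, h2 i ⟨hi, hki⟩⟩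
  have hclose : ∀ x ∈ F', ∀ y ∈ F', ∀ κ, fst x κ → dist x y ≤ 2 ^ (-κ) →
      fst y κ ∧ dist x y ≤ 1 / 16 * 2 ^ (-κ) := by
    intro x hx y hy κ hκ hd
    have h1 := hb κ (by have := hκ.2.1; omega) x (hF' hx) y (hF' hy) hκ.1 hd
    refine ⟨⟨h1.1, hκ.2.1, fun i hi hki => ?_⟩, h1.2⟩
    by_contra! hiκ
    have h2 := hb i (by omega) y (hF' hy) x (hF' hx) hi
      (by rw [dist_comm]; exact hd.trans (zpow_neg_le_of_le hiκ.le))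
    exact absurd (hκ.2.2 i h2.1 hki) (not_le.2 hiκ)
  let Bl : X → Set X := fun x => {y ∈ F' | y = x ∨ ∃ κ, fst x κ ∧ dist x y ≤ 2 ^ (-κ)}
  have hBl : ∀ x ∈ F', ∀ y ∈ Bl x, Bl y = Bl x := by
    have key : ∀ x ∈ F', ∀ y ∈ Bl x, Bl y ⊆ Bl x := by
      rintro x hx y ⟨hy, rfl | ⟨κ, hκ, hd⟩⟩
      · rfl
      have h1 := hclose x hx y hy κ hκ hd
      rintro w ⟨hw, rfl | ⟨κ', hκ', hd'⟩⟩
      · exact ⟨hw, .inr ⟨κ, hκ, hd⟩⟩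
      obtain rfl : κ = κ' := le_antisymm (h1.1.2.2 _ hκ'.1 hκ'.2.1) (hκ'.2.2 _ h1.1.1 h1.1.2.1)
      have h2 := hclose y hy w hw κ hκ' hd'
      have ht : (0 : ℝ) < 2 ^ (-κ) := by positivity
      exact ⟨hw, .inr ⟨κ, hκ, by linarith [dist_triangle x y w]⟩⟩
    intro x hx y hy
    refine (key x hx y hy).antisymm (key y hy.1 x ⟨hx, ?_⟩)
    rcases hy.2 with h | ⟨κ, hκ, hd⟩
    · exact .inl h.symm
    · exact .inr ⟨κ, (hclose x hx y hy.1 κ hκ hd).1, by rwa [dist_comm]⟩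
  have hself : ∀ x ∈ F', x ∈ Bl x := fun x hx => ⟨hx, .inl rfl⟩
  have hblock : ∀ B : Set X, ∃ w : X, ∃ Ψ : X → V, ∀ x ∈ F', B = Bl x → w ∈ F' ∧
      (∀ u ∈ B, ∀ v ∈ B, (1 / 32) ^ M / 4 * dist u v ≤ 1 / 32 * dist (Ψ u) (Ψ v)) ∧
      ∀ u ∈ B, ‖Ψ u‖ ≤ 2 * 2 ^ (-k) ∧ ∀ y ∈ F', y ∉ B →
        ‖Ψ u‖ ≤ 2 * dist u y ∧ dist w u ≤ 1 / 16 * dist u y := by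
    intro B
    by_cases hB : ∃ x ∈ F', B = Bl x
    swap
    · exact ⟨0, 0, fun x hx h => absurd ⟨x, hx, h⟩ hB⟩
    obtain ⟨x, hx, rfl⟩ := hB
    by_cases hx1 : ∃ κ, fst x κ
    · obtain ⟨κ, hκ⟩ := hx1
      obtain ⟨M', rfl, -⟩ := hpred κ hκ.2.1 x hx hκ.1
      have hall : ∀ u ∈ Bl x, fst u κ ∧ dist x u ≤ 1 / 16 * 2 ^ (-κ) := by
        rintro u ⟨hu, rfl | ⟨κ', hκ', hd⟩⟩
        · exact ⟨hκ, by rw [dist_self]; positivity⟩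
        · obtain rfl : κ = κ' := le_antisymm (hκ.2.2 _ hκ'.1 hκ'.2.1) (hκ'.2.2 _ hκ.1 hκ.2.1)
          exact hclose x hx u hu κ hκ hd
      have ht : (0 : ℝ) < 2 ^ (-κ) := by positivity
      obtain ⟨Ψ, h1, h2⟩ := ih M' (by omega) κ (by have := hκ.2.1; omega) (Bl x)
        ((sep_subset _ _).trans hF') (fun u hu v hv => by
          refine (hclose u hu.1 v hv.1 κ (hall u hu).1 ?_).2
          linarith [dist_triangle_left u v x, (hall u hu).2, (hall v hv).2]) fun u hu => by
          obtain ⟨M'', h, h'⟩ := hpred κ hκ.2.1 u hu.1 (hall u hu).1.1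
          obtain rfl : M' = M'' := by omega
          exact h'
      refine ⟨x, Ψ, fun _ _ _ => ⟨hx, fun u hu v hv => ?_, fun u hu => ⟨?_, fun y hy hyB => ?_⟩⟩⟩
      · have := h2 u hu v hv
        rw [pow_succ]
        linarith
      · exact (h1 u hu).trans (mul_le_mul_of_nonneg_left (zpow_neg_le_of_le hκ.2.1.le) (by norm_num))
      · have h3 : 2 ^ (-κ) ≤ dist u y := by
          by_contra! hlt
          rw [← hBl x hx u hu] at hyB
          exact hyB ⟨hy, .inr ⟨κ, (hall u hu).1, hlt.le⟩⟩
        exact ⟨(h1 u hu).trans (by linarith), by linarith [(hall u hu).2]⟩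
    · have hall : ∀ u ∈ Bl x, u = x := by
        rintro u ⟨hu, h | ⟨κ', hκ', hd⟩⟩
        · exact h
        · exact absurd ⟨κ', hκ'⟩ hx1
      refine ⟨x, 0, fun _ _ _ => ⟨hx, fun u hu v hv => ?_, fun u hu => ⟨?_, fun y hy hyB => ?_⟩⟩⟩
      · rw [hall u hu, hall v hv]; simp
      · simp only [Pi.zero_apply, norm_zero]; positivity
      · rw [hall u hu]
        simp only [Pi.zero_apply, norm_zero, dist_self]
        constructor <;> positivity
  choose w Ψ hwΨ using hblock
  have hTn := hT (k + 1) (by omega) z (hF' hz) hkz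
  refine ⟨fun x => T (k + 1) z (w (Bl x) - z) + (1 / 32 : ℝ) • Ψ (Bl x) x, fun x hx => ?_,
    fun x hx y hy => ?_⟩
  · obtain ⟨h1, -, h2⟩ := hwΨ (Bl x) x hx rfl
    have h3 := hTn (w (Bl x) - z)
    rw [← dist_eq_norm] at h3
    have h4 := hdiam _ h1 z hz
    have h5 := (h2 x (hself x hx)).1
    refine (norm_add_le _ _).trans ?_
    rw [norm_smul, Real.norm_of_nonneg (by norm_num)]
    linarith
  · beta_reduce
    by_cases hyx : y ∈ Bl x
    · rw [hBl x hx y hyx, dist_add_left, dist_smul₀, Real.norm_of_nonneg (by norm_num)]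
      exact (hwΨ (Bl x) x hx rfl).2.1 x (hself x hx) y hyx
    have hxy : x ∉ Bl y := fun h => hyx (hBl y hy x h ▸ hself y hy)
    have hne : x ≠ y := fun h => hyx (h ▸ hself x hx)
    have hd0 : 0 < dist x y := dist_pos.2 hne
    obtain ⟨k', hk'1, hk'2⟩ := exists_zpow_scale hd0
    have hkk' : k + 1 ≤ k' := by
      have := lt_of_zpow_neg_lt (hk'1.trans_le ((hdiam x hx y hy).trans
        (by rw [hk1]; linarith : _ ≤ (2 : ℝ) ^ (-(k + 1)))))
      omega
    have hmain := hexp (k + 1) (by omega) k' hkk' z (hF' hz) x (hF' hx) y (hF' hy)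
      (by linarith [hdiam z hz x hx]) hkz (fun i hi hi' hib => by
        obtain ⟨κ, hκ, hκi⟩ := hfst x i hib (by omega)
        exact hyx ⟨hy, .inr ⟨κ, hκ, hk'2.trans (zpow_neg_le_of_le (hκi.trans hi'))⟩⟩) hk'1 hk'2
    obtain ⟨-, -, h1⟩ := hwΨ (Bl x) x hx rfl
    obtain ⟨-, -, h2⟩ := hwΨ (Bl y) y hy rfl
    obtain ⟨hx1, hx2⟩ := (h1 x (hself x hx)).2 y hy hyx
    obtain ⟨hy1, hy2⟩ := (h2 y (hself y hy)).2 x hx hxy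
    rw [dist_comm y x] at hy1 hy2
    have h3 : T (k + 1) z (x - y) = (T (k + 1) z (w (Bl x) - z) + (1 / 32 : ℝ) • Ψ (Bl x) x -
        (T (k + 1) z (w (Bl y) - z) + (1 / 32 : ℝ) • Ψ (Bl y) y)) - T (k + 1) z (w (Bl x) - x) +
        T (k + 1) z (w (Bl y) - y) - (1 / 32 : ℝ) • Ψ (Bl x) x + (1 / 32 : ℝ) • Ψ (Bl y) y := by
      simp only [map_sub]; abel
    have h4 := hTn (w (Bl x) - x)
    have h5 := hTn (w (Bl y) - y)
    rw [← dist_eq_norm] at h4 h5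
    have h6 : ‖T (k + 1) z (x - y)‖ ≤ dist (T (k + 1) z (w (Bl x) - z) + (1 / 32 : ℝ) • Ψ (Bl x) x)
        (T (k + 1) z (w (Bl y) - z) + (1 / 32 : ℝ) • Ψ (Bl y) y) + ‖T (k + 1) z (w (Bl x) - x)‖ +
        ‖T (k + 1) z (w (Bl y) - y)‖ + 1 / 32 * ‖Ψ (Bl x) x‖ + 1 / 32 * ‖Ψ (Bl y) y‖ := by
      have h7 : ∀ v : V, ‖(1 / 32 : ℝ) • v‖ = 1 / 32 * ‖v‖ := fun v => by
        rw [norm_smul, Real.norm_of_nonneg (by norm_num)]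
      rw [h3, dist_eq_norm, ← h7, ← h7]
      refine (norm_add_le _ _).trans (add_le_add_left ?_ _)
      refine (norm_sub_le _ _).trans (add_le_add_left ?_ _)
      refine (norm_add_le _ _).trans (add_le_add_left ?_ _)
      exact norm_sub_le _ _
    have h8 : (1 / 32 : ℝ) ^ M ≤ 1 := pow_le_one₀ (by norm_num) (by norm_num)
    have h9 : (1 / 32 : ℝ) ^ M / 4 * dist x y ≤ 1 / 4 * dist x y := by gcongr
    linarith

end expansion

namespace StopRule
variable {n : ℕ} {V : Type*} (r : StopRule n V) {E : Set (ES n)} (D : DyadicSystem n E)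
  {s : StopState V} {j k : ℤ} {x y : ES n} {Q : Set (ES n)}

/-- The state of the process after `m` steps along the cubes containing `x`. -/
def traj (s : StopState V) (k : ℤ) (x : ES n) : ℕ → StopState V
  | 0 => s
  | m + 1 => r.step (traj s k x m) (k + m + 1) (D.cubeAt (k + m + 1) x)

theorem traj_succ (s : StopState V) (k : ℤ) (x : ES n) (m : ℕ) : r.traj D s k x (m + 1) =
    r.traj D (r.step s (k + 1) (D.cubeAt (k + 1) x)) (k + 1) x m := by
  induction m with
  | zero => simp [traj]
  | succ m ih =>
    rw [traj, ih, traj]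
    push_cast
    rw [show k + ((m : ℤ) + 1) + 1 = k + 1 + m + 1 by ring]

open Classical in
theorem cnt_eq_sum (m : ℕ) (s : StopState V) (k : ℤ) (x : ES n) : r.cnt D m s k x =
    ∑ l ∈ Finset.range m, if r.Quiet (r.traj D s k x l) (k + l + 1) (D.cubeAt (k + l + 1) x)
      then 0 else 1 := by
  induction m generalizing s k with
  | zero => simp [cnt]
  | succ m ih =>
    rw [cnt, ih, Finset.sum_range_succ', add_comm]
    congr 1
    · refine Finset.sum_congr rfl fun l _ => ?_
      rw [traj_succ]
      push_cast
      rw [show k + ((l : ℤ) + 1) + 1 = k + 1 + l + 1 by ring]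
    · simp [traj]

theorem traj_congr (s : StopState V) {m : ℕ} (hQ : Q ∈ D.cubes (k + m)) (hx : x ∈ Q)
    (hy : y ∈ Q) : r.traj D s k x m = r.traj D s k y m := by
  induction m generalizing Q with
  | zero => rfl
  | succ m ih =>
    have hx' := D.subset_of_mem hQ hx
    have h1 : Q ⊆ D.cubeAt (k + m) x := D.subset_of_mem_of_le (by push_cast; omega) hQ
      (D.cubeAt_mem _ hx') hx (D.mem_cubeAt _ hx')
    push_cast at hQ
    rw [← add_assoc] at hQ
    rw [traj, traj, ih (D.cubeAt_mem _ hx') (h1 hx) (h1 hy), D.cubeAt_eq hQ hx,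
      D.cubeAt_eq hQ hy]

/-- The process started in the state `s` in generation `j` is not quiet when it enters the
cube `Q` of generation `k`. -/
def Noisy (s : StopState V) (j k : ℤ) (Q : Set (ES n)) : Prop :=
  j < k ∧ ¬ r.Quiet (r.traj D s j (D.center Q) (k - j - 1).toNat) k Q

variable {r D}

theorem noisy_iff {l : ℕ} (hQ : Q ∈ D.cubes (j + l + 1)) (hx : x ∈ Q) :
    r.Noisy D s j (j + l + 1) Q ↔ ¬ r.Quiet (r.traj D s j x l) (j + l + 1) Q := by
  have hx' := D.subset_of_mem hQ hx
  have h1 : Q ⊆ D.cubeAt (j + l) x := D.subset_of_mem_of_le (by omega) hQ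
    (D.cubeAt_mem _ hx') hx (D.mem_cubeAt _ hx')
  rw [Noisy, show (j + l + 1 - j - 1).toNat = l by omega,
    r.traj_congr D s (D.cubeAt_mem _ hx') (h1 (D.center_mem _ Q hQ)) (h1 hx)]
  exact and_iff_right (by omega)

theorem not_mem_noisy (hjk : k ≤ j) : x ∉ D.family (r.Noisy D s j) k :=
  fun h => absurd h.2.1 (not_lt.2 hjk)

theorem tsum_noisy_le (hQ : Q ⊆ E) (hQm : MeasurableSet Q) {T : ℝ≥0∞} (h : ∀ m,
    ∫⁻ x in Q, r.cnt D m s j x ∂(surfMeasure n E) ≤ T) :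
    ∑' i : ℕ, surfMeasure n E (D.family (r.Noisy D s j) (j + i) ∩ Q) ≤ T := by
  classical
  rw [tsum_eq_zero_add' ENNReal.summable, eq_empty_of_forall_notMem (s := D.family _ _)
    fun x => not_mem_noisy (by simp), empty_inter, measure_empty, zero_add]
  refine ENNReal.tsum_le_of_sum_range_le fun m => le_trans (le_of_eq ?_) (h m)
  calc _ = ∑ l ∈ Finset.range m, ∫⁻ x in Q, (D.family (r.Noisy D s j) (j + l + 1)).indicator 1 x
        ∂(surfMeasure n E) := by
        refine Finset.sum_congr rfl fun l _ => ?_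
        rw [lintegral_indicator_one (D.measurableSet_family _),
          Measure.restrict_apply (D.measurableSet_family _)]
        push_cast
        rw [add_assoc]
    _ = _ := by
        rw [← lintegral_finsetSum _ fun l _ =>
          measurable_one.indicator (D.measurableSet_family _)]
        refine setLIntegral_congr_fun hQm fun x hx => ?_
        rw [cnt_eq_sum]
        refine Finset.sum_congr rfl fun l _ => ?_
        have h1 := D.cubeAt_mem (j + l + 1) (hQ hx)
        have h2 := D.mem_cubeAt (j + l + 1) (hQ hx)
        rw [indicator_apply, D.mem_family_of_mem h1 h2, noisy_iff h1 h2]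
        split_ifs <;> simp_all

theorem exists_good (hx : x ∈ E) {k' : ℤ} (hjk : j < k) (hk : k ≤ k')
    (h : ∀ i, k ≤ i → i ≤ k' → x ∉ D.family (r.Noisy D s j) i) :
    ∃ v, ∀ i, k ≤ i → i ≤ k' → r.good v i (D.cubeAt i x) := by
  obtain ⟨l, rfl⟩ : ∃ l : ℕ, k = j + l + 1 := ⟨(k - j - 1).toNat, by omega⟩
  have hq : ∀ q : ℕ, j + (l + q : ℕ) + 1 ≤ k' → r.Quiet (r.traj D s j x (l + q))
      (j + (l + q : ℕ) + 1) (D.cubeAt (j + (l + q : ℕ) + 1) x) := by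
    intro q hqk
    have h1 := h (j + (l + q : ℕ) + 1) (by push_cast; omega) hqk
    rwa [D.mem_family_of_mem (D.cubeAt_mem _ hx) (D.mem_cubeAt _ hx),
      noisy_iff (D.cubeAt_mem _ hx) (D.mem_cubeAt _ hx), not_not] at h1
  obtain ⟨v, hv⟩ : ∃ v, r.traj D s j x l = .tree v := by
    have := hq 0 (by simpa using hk)
    simp only [add_zero] at this
    cases h2 : r.traj D s j x l with
    | tree v => exact ⟨v, rfl⟩
    | wait i => rw [h2] at this; exact this.elim
  have key : ∀ q : ℕ, j + (l + q : ℕ) + 1 ≤ k' → r.traj D s j x (l + q) = .tree v := by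
    intro q
    induction q with
    | zero => exact fun _ => hv
    | succ q ih =>
      intro hqk
      have h0 : j + ((l + q : ℕ) : ℤ) + 1 ≤ k' := by push_cast at hqk ⊢; omega
      have h1 := hq q h0
      rw [ih h0] at h1
      rw [← add_assoc, traj, ih h0, step]
      exact if_pos h1
  refine ⟨v, fun i hi hi' => ?_⟩
  obtain ⟨q, rfl⟩ : ∃ q : ℕ, i = j + (l + q : ℕ) + 1 :=
    ⟨(i - (j + l + 1)).toNat, by push_cast; omega⟩
  have h1 := hq q hi'
  rw [key q hi'] at h1
  exact h1

end StopRule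

namespace FlatScales
variable {n : ℕ} {E : Set (ES n)} {D : DyadicSystem n E} {s : FlatScales D} {C : ℝ}

theorem dist_le_two_mul_norm_proj {k k' : ℤ} {x y z v : ES n} (hk : k ≤ k') (hx : x ∈ E)
    (hy : y ∈ E) (hz : z ∈ E) (hF : s.rule.Flat k (D.cubeAt k z))
    (hg : s.rule.good v k (D.cubeAt k x)) (hg' : s.rule.good v k' (D.cubeAt k' x))
    (hzx : dist z x ≤ 1 / 8 * 2 ^ (-k)) (hlt : 2 ^ (-(k' + 1)) < dist x y)
    (hle : dist x y ≤ 2 ^ (-k')) :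
    dist x y ≤ 2 * ‖proj (s.rule.nrm k (D.cubeAt k z)) (x - y)‖ := by
  have ht : (0 : ℝ) < 2 ^ (-k) := by positivity
  have ht' : (0 : ℝ) < 2 ^ (-k') := by positivity
  have hCs := D.Cstar_pos
  have ha := D.a₀_pos
  have hη := s.η_pos
  have hη' := s.η_le
  rw [s.good_iff] at hg hg'
  obtain ⟨c₀, h₀⟩ := s.flatPlane_nrm hF
  obtain ⟨c₁, h₁⟩ := s.flatPlane_nrm hg.2.1
  obtain ⟨c₂, h₂⟩ := s.flatPlane_nrm hg'.2.1
  set N₀ := s.rule.nrm k (D.cubeAt k z)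
  set N₁ := s.rule.nrm k (D.cubeAt k x)
  set N₂ := s.rule.nrm k' (D.cubeAt k' x)
  have hΛt : (4 * D.Cstar + 10) * 2 ^ (-k) ≤ s.Λ * 2 ^ (-k) :=
    mul_le_mul_of_nonneg_right (by linarith [s.Λ_ge]) ht.le
  have hΛt' : (4 * D.Cstar + 10) * 2 ^ (-k') ≤ s.Λ * 2 ^ (-k') :=
    mul_le_mul_of_nonneg_right (by linarith [s.Λ_ge]) ht'.le
  have hzc := dist_center_le (D.cubeAt_mem k hz) (D.mem_cubeAt k hz)
  have hxc := dist_center_le (D.cubeAt_mem k hx) (D.mem_cubeAt k hx)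
  have hxc' := dist_center_le (D.cubeAt_mem k' hx) (D.mem_cubeAt k' hx)
  have hCt : 0 < D.Cstar * 2 ^ (-k) := by positivity
  have hCt' : 0 < D.Cstar * 2 ^ (-k') := by positivity
  have h01 : tilt N₁ N₀ ≤ 6 * s.η := by
    have := tilt_nrm_le_of_flatPlane ht (D.center_mem_E (D.cubeAt_mem k hx)) h₁ h₀ (by
      have h1 := dist_triangle4 (D.center (D.cubeAt k x)) x z (D.center (D.cubeAt k z))
      rw [dist_comm (D.center (D.cubeAt k x)) x, dist_comm x z] at h1
      linarith)
    refine le_of_mul_le_mul_right (this.trans (le_of_eq ?_)) ht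
    ring
  have h20 : tilt N₂ N₀ ≤ 1 / 4 + 6 * s.η := by
    have h1 := tilt_triangle h₂.1 hg.1 h₀.1
    have h2 := tilt_triangle hg.1 h₁.1 h₀.1
    rw [tilt_comm h₂.1 hg.1] at h1
    linarith [hg.2.2, hg'.2.2]
  have hd : 2 ^ (-k') < 2 * dist x y := by
    rw [zpow_neg_add] at hlt
    norm_num at hlt ⊢
    linarith
  have h3 : |⟪N₂, x - y⟫_ℝ| ≤ 2 * s.η * 2 ^ (-k') := by
    have h4 := abs_le.1 (h₂.2.1 x hx (by linarith))
    have h5 := abs_le.1 (h₂.2.1 y hy (by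
      linarith [dist_triangle y x (D.center (D.cubeAt k' x)), dist_comm x y]))
    rw [inner_sub_right, abs_le]
    constructor <;> linarith
  have h6 : |⟪N₀, x - y⟫_ℝ| ≤ 1 / 2 * dist x y := by
    have h7 := abs_inner_le_add_tilt h₂.1 h₀.1 (x - y)
    rw [← dist_eq_norm] at h7
    have hd0 : 0 ≤ dist x y := dist_nonneg
    nlinarith
  have h8 := norm_proj_sq h₀.1 (x - y)
  rw [← dist_eq_norm] at h8
  have h9 : ⟪N₀, x - y⟫_ℝ ^ 2 ≤ (1 / 2 * dist x y) ^ 2 := by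
    rw [← sq_abs]; gcongr
  refine le_of_sq_le_sq ?_ (by positivity)
  nlinarith [sq_nonneg (dist x y)]

theorem measure_thickening_noisy_le (hE : Regular n C E) {r : StopRule n (ES n)}
    {st : StopState (ES n)} {j : ℤ} {Q : Set (ES n)} (hQ : Q ∈ D.cubes j) (k : ℤ) :
    surfMeasure n E (thickening (3 * 2 ^ (-k)) (D.family (r.Noisy D st j) k ∩ Q)) ≤
      ENNReal.ofReal (C ^ 2 * ((3 + D.Cstar + D.a₀) / D.a₀) ^ n) *
        surfMeasure n E (D.family (r.Noisy D st j) k ∩ Q) := by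
  have ht : (0 : ℝ) < 2 ^ (-k) := by positivity
  have hCs := D.Cstar_pos
  have ha := D.a₀_pos
  have key := hE.ad.transfer (A := thickening (3 * 2 ^ (-k)) (D.family (r.Noisy D st j) k ∩ Q))
    (Z := D.family (r.Noisy D st j) k ∩ Q) (R := (3 + D.Cstar + D.a₀) * 2 ^ (-k))
    (c := D.a₀ * 2 ^ (-k)) (by positivity) (by positivity) fun x hx => by
      obtain ⟨u, ⟨hu, huQ⟩, hxu⟩ := mem_thickening_iff.1 hx
      have huE := hu.1
      have hR := D.cubeAt_mem k huE
      have hjk : j ≤ k := hu.2.1.le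
      refine ⟨D.center (D.cubeAt k u), D.center_mem_E hR, ?_⟩
      rw [surfMeasure_apply hE.closed, surfMeasure_apply hE.closed]
      refine measure_mono fun w hw => ⟨⟨⟨?_, ?_⟩, ?_⟩, hw.2⟩
      · exact (D.mem_family_of_mem hR (D.contains_ball k _ hR hw.symm)).2 hu.2
      · exact D.cubeAt_subset hjk hQ huQ (D.contains_ball k _ hR hw.symm)
      · have h1 := dist_center_le hR (D.mem_cubeAt k huE)
        have h2 := mem_ball.1 hw.1
        rw [mem_ball]
        linarith [dist_triangle4 w (D.center (D.cubeAt k u)) u x,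
          dist_comm u (D.center (D.cubeAt k u)), dist_comm u x]
  rwa [mul_div_mul_right _ _ ht.ne'] at key

/-- Big pieces on which the process is rarely noisy, thinned out at the noisy scales. -/
theorem exists_thin_piece (hE : Regular n C E) {A : ℝ≥0∞} (hA : A ≠ ⊤)
    (hs : ∀ m k, ∀ Q ∈ D.cubes k, ∫⁻ x in Q, s.rule.cnt D m (s.rule.root k Q) k x
      ∂(surfMeasure n E) ≤ A * surfMeasure n E Q) (i₀ : ℕ) :
    ∃ c : ℝ≥0∞, c ≠ 0 ∧ ∃ N : ℕ, ∀ j, ∀ Q ∈ D.cubes j, ∀ Q' ∈ D.cubes (j + i₀), Q' ⊆ Q →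
      ∃ F ⊆ Q', c * surfMeasure n E Q' ≤ surfMeasure n E F ∧ ∃ B : ℤ → Set (ES n),
        (∀ k, B k = thickening (3 * 2 ^ (-k))
          (D.family (s.rule.Noisy D (s.rule.root j Q) j) k ∩ Q)) ∧
        (∀ x ∈ F, ({k | x ∈ B k} ∩ Ioi j).encard ≤ N) ∧
        ∀ k, j ≤ k → ∀ x ∈ F, ∀ y ∈ F, x ∈ B k → y ∈ B k → dist x y ≤ 2 * 2 ^ (-k) →
          dist x y ≤ 1 / 16 * 2 ^ (-k) := by
  set σ := surfMeasure n E with hσ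
  have := hE.ad.sigmaFinite
  have hCs := D.Cstar_pos
  obtain ⟨K₂, hK₂, hK⟩ := D.exists_ball_le_cube hE (R := 2 * D.Cstar * 2 ^ (i₀ : ℤ))
    (by positivity)
  set K₁ : ℝ≥0∞ := ENNReal.ofReal (C ^ 2 * ((3 + D.Cstar + D.a₀) / D.a₀) ^ n) with hK₁
  have hT : K₁ * (A * K₂) ≠ ⊤ := by finiteness
  obtain ⟨N, hN⟩ := ENNReal.exists_nat_gt (ENNReal.mul_ne_top (by simp : (2 : ℝ≥0∞) ≠ ⊤) hT)
  obtain ⟨c, hc, hthin⟩ := exists_thinning (n + 1) N (s := 1 / 16) (L := 2) (by norm_num)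
    (by norm_num)
  refine ⟨c / 2, by simp [hc], N, fun j Q hQ Q' hQ' hQQ => ?_⟩
  set U := D.family (s.rule.Noisy D (s.rule.root j Q) j) with hU
  set B : ℤ → Set (ES n) := fun k => thickening (3 * 2 ^ (-k)) (U k ∩ Q) with hB
  have hBm : ∀ k, MeasurableSet (B k) := fun k => isOpen_thickening.measurableSet
  have hQσ : σ Q ≤ K₂ * σ Q' := by
    refine le_trans (measure_mono ?_) (hK _ Q' hQ' (D.center Q'))
    have h1 := D.subset_ball hQ (hQQ (D.center_mem _ Q' hQ'))
    rw [zpow_neg_add, mul_assoc (2 * D.Cstar), ← mul_assoc ((2 : ℝ) ^ (i₀ : ℤ)),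
      ← zpow_add₀ (by norm_num)]
    simpa using h1
  have hsum : ∑' i : ℕ, σ (B (j + i) ∩ Q') ≤ K₁ * (A * K₂) * σ Q' := by
    calc _ ≤ ∑' i : ℕ, K₁ * σ (U (j + i) ∩ Q) := ENNReal.tsum_le_tsum fun i =>
          (measure_mono inter_subset_left).trans (measure_thickening_noisy_le hE hQ _)
      _ ≤ K₁ * (A * σ Q) := by
          rw [ENNReal.tsum_mul_left]
          exact mul_le_mul_right (StopRule.tsum_noisy_le (D.subset_of_mem hQ) (D.borel _ _ hQ)
            fun m => hs m j Q hQ) _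
      _ ≤ K₁ * (A * (K₂ * σ Q')) := by gcongr
      _ = _ := by ring
  have hch := measure_scaleCount_gt hBm j σ Q' (N := N) hsum
  have hQ'top : σ Q' ≠ ⊤ := D.measure_ne_top hE hQ'
  set X := {x ∈ Q' | scaleCount B j x ≤ N} with hX
  set Y := {x ∈ Q' | N ≤ scaleCount B j x} with hY
  have hN0 : (N : ℝ≥0∞) ≠ 0 := (zero_le.trans_lt hN).ne'
  have hYσ : 2 * σ Y ≤ σ Q' := by
    rw [← ENNReal.mul_le_mul_iff_right hN0 (ENNReal.natCast_ne_top N)]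
    calc _ = 2 * (N * σ Y) := by ring
      _ ≤ 2 * (K₁ * (A * K₂) * σ Q') := by gcongr
      _ = 2 * (K₁ * (A * K₂)) * σ Q' := by ring
      _ ≤ _ := by gcongr
  have hXσ : σ Q' ≤ 2 * σ X := by
    have h1 : σ Q' ≤ σ X + σ Y := by
      refine (measure_mono fun x hx => ?_).trans (measure_union_le X Y)
      exact (le_total (scaleCount B j x) N).imp (fun h => ⟨hx, h⟩) fun h => ⟨hx, h⟩
    have h2 : σ Q' + σ Q' ≤ 2 * σ X + σ Q' := by
      calc σ Q' + σ Q' = 2 * σ Q' := (two_mul _).symm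
        _ ≤ 2 * (σ X + σ Y) := by gcongr
        _ = 2 * σ X + 2 * σ Y := mul_add _ _ _
        _ ≤ _ := by gcongr
    exact (ENNReal.add_le_add_iff_right hQ'top).1 h2
  have : IsFiniteMeasure (σ.restrict Q') := ⟨by
    rw [Measure.restrict_apply_univ]; exact hQ'top.lt_top⟩
  obtain ⟨F, hFX, hF, -, hsep⟩ := hthin (σ.restrict Q') B hBm j X fun x hx => hx.2
  have hFQ : F ⊆ Q' := hFX.trans fun x hx => hx.1
  have hQ'm := D.borel _ _ hQ'
  rw [Measure.restrict_apply' hQ'm, Measure.restrict_apply' hQ'm, inter_eq_left.2 hFQ,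
    inter_eq_left.2 fun x hx => hx.1] at hF
  refine ⟨F, hFQ, ?_, B, fun k => rfl, fun x hx => ?_, hsep⟩
  · calc c / 2 * σ Q' ≤ c / 2 * (2 * σ X) := by gcongr
      _ = c * σ X := by
        rw [← mul_assoc, ENNReal.div_mul_cancel (by simp) (by simp)]
      _ ≤ _ := hF
  · obtain ⟨S, hS, hSi⟩ := finite_scales (hFX hx).2
    have h1 : {k | x ∈ B k} ∩ Ioi j ⊆ (fun i : ℕ => j + (i : ℤ)) '' (S : Set ℕ) := by
      rintro k ⟨hk, hjk⟩
      rw [mem_Ioi] at hjk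
      have hk' : j + ((k - j).toNat : ℤ) = k := by omega
      refine ⟨(k - j).toNat, ?_, hk'⟩
      rw [Finset.mem_coe, hSi, hk']
      exact hk
    calc _ ≤ _ := encard_le_encard h1
      _ ≤ (S : Set ℕ).encard := encard_image_le _ _
      _ ≤ N := by rw [encard_coe_eq_coe_finsetCard]; exact_mod_cast hS

/-- Big pieces which can be mapped to `ℝⁿ` without contracting distances too much. -/
theorem exists_expanding_piece (hE : Regular n C E) {A : ℝ≥0∞} (hA : A ≠ ⊤)
    (hs : ∀ m k, ∀ Q ∈ D.cubes k, ∫⁻ x in Q, s.rule.cnt D m (s.rule.root k Q) k x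
      ∂(surfMeasure n E) ≤ A * surfMeasure n E Q) {i₀ : ℕ}
    (hi₀ : D.Cstar * 2 ^ (-(i₀ : ℤ)) ≤ 1 / 16) :
    ∃ c : ℝ≥0∞, c ≠ 0 ∧ ∃ κ : ℝ, 0 < κ ∧ ∀ j, ∀ Q' ∈ D.cubes (j + i₀),
      ∃ F ⊆ Q', c * surfMeasure n E Q' ≤ surfMeasure n E F ∧
        ∃ ψ : ES n → EuclideanSpace ℝ (Fin n), (∀ x ∈ F, ‖ψ x‖ ≤ 2 * 2 ^ (-j)) ∧
          ∀ x ∈ F, ∀ y ∈ F, κ * dist x y ≤ dist (ψ x) (ψ y) := by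
  obtain ⟨c, hc, N, h⟩ := exists_thin_piece hE hA hs i₀
  refine ⟨c, hc, (1 / 32) ^ N / 4, by positivity, fun j Q' hQ' => ?_⟩
  have hcE := D.center_mem_E hQ'
  have hQ := D.cubeAt_mem j hcE
  set Q := D.cubeAt j (D.center Q')
  have hQQ : Q' ⊆ Q := D.subset_of_mem_of_le (by omega) hQ' hQ (D.center_mem _ _ hQ')
    (D.mem_cubeAt j hcE)
  obtain ⟨F, hFQ, hF, B, hB, hcard, hsep⟩ := h j Q hQ Q' hQ' hQQ
  have hFE : F ⊆ E := hFQ.trans (D.subset_of_mem hQ')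
  set U := D.family (s.rule.Noisy D (s.rule.root j Q) j)
  set b : ES n → Set ℤ := fun x => {k | ∃ u ∈ F, u ∈ U k ∧ dist x u ≤ 1 / 16 * 2 ^ (-k)} with hb
  have hmemB : ∀ {k : ℤ} {u w : ES n}, u ∈ F → u ∈ U k → dist w u ≤ 2 * 2 ^ (-k) → w ∈ B k := by
    intro k u w hu huU hd
    rw [hB, mem_thickening_iff]
    have : (0 : ℝ) < 2 ^ (-k) := by positivity
    exact ⟨u, ⟨huU, hQQ (hFQ hu)⟩, by linarith⟩
  have hbB : ∀ {x : ES n} {k : ℤ}, k ∈ b x → x ∈ B k := by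
    rintro x k ⟨u, hu, huU, hd⟩
    have : (0 : ℝ) < 2 ^ (-k) := by positivity
    exact hmemB hu huU (by linarith)
  have hbU : ∀ {x : ES n} {k : ℤ}, x ∈ F → k ∉ b x → x ∉ U k := fun hx hk hU =>
    hk ⟨_, hx, hU, by rw [dist_self]; positivity⟩
  have hflat : ∀ {k : ℤ} {z : ES n}, j < k → z ∈ F → k ∉ b z →
      s.rule.Flat k (D.cubeAt k z) := by
    intro k z hjk hz hk
    obtain ⟨v, hv⟩ := StopRule.exists_good (hFE hz) hjk le_rfl fun i hi hi' => by
      rw [le_antisymm hi' hi]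
      exact hbU hz hk
    exact (s.good_iff.1 (hv k le_rfl le_rfl)).2.1
  obtain ⟨ψ, hψ, hψ'⟩ := exists_expanding_map (F := F) (b := b) (j := j)
    (T := fun k z => proj (s.rule.nrm k (D.cubeAt k z)))
    (fun k hk z hz hkz v => by
      obtain ⟨c, hc⟩ := s.flatPlane_nrm (hflat hk hz hkz)
      exact norm_proj_le hc.1 v)
    (fun k hk x hx y hy ⟨u, hu, huU, hd⟩ hxy => by
      have h0 : (0 : ℝ) < 2 ^ (-k) := by positivity
      have hyu : dist y u ≤ 2 * 2 ^ (-k) := by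
        linarith [dist_triangle y x u, dist_comm x y]
      have hyB := hmemB hu huU hyu
      exact ⟨⟨u, hu, huU, hsep k hk.le y hy u hu hyB
        (hmemB hu huU (by rw [dist_self]; positivity)) hyu⟩,
        hsep k hk.le x hx y hy (hbB ⟨u, hu, huU, hd⟩) hyB (by linarith)⟩)
    (fun k hk k' hkk' z hz x hx y hy hzx hkz hbx hlt hle => by
      obtain ⟨v, hv⟩ := StopRule.exists_good (hFE hx) hk hkk' fun i hi hi' =>
        hbU hx (hbx i hi hi')
      exact dist_le_two_mul_norm_proj hkk' (hFE hx) (hFE hy) (hFE hz) (hflat hk hz hkz)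
        (hv k le_rfl hkk') (hv k' hkk' le_rfl) hzx hlt hle)
    N j le_rfl F Subset.rfl
    (fun x hx y hy => by
      refine (D.dist_le hQ' (hFQ hx) (hFQ hy)).trans ?_
      rw [zpow_neg_add, ← mul_assoc]
      exact mul_le_mul_of_nonneg_right hi₀ (by positivity))
    (fun x hx => (encard_le_encard (inter_subset_inter_left _
      (show b x ⊆ {k | x ∈ B k} from fun k hk => hbB hk))).trans
      (hcard x hx))
  exact ⟨F, hFQ, hF, ψ, hψ, hψ'⟩

theorem exists_isUR (hE : Regular n C E) {A : ℝ≥0∞} (hA : A ≠ ⊤)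
    (hs : ∀ m k, ∀ Q ∈ D.cubes k, ∫⁻ x in Q, s.rule.cnt D m (s.rule.root k Q) k x
      ∂(surfMeasure n E) ≤ A * surfMeasure n E Q) : ∃ θ M₀, IsUR n θ M₀ E := by
  have hCs := D.Cstar_pos
  have ha := D.a₀_pos
  have hC := hE.ad.pos
  obtain ⟨i₀, hi₀⟩ : ∃ i₀ : ℕ, D.Cstar * 2 ^ (-(i₀ : ℤ)) ≤ 1 / 16 := by
    obtain ⟨i₀, h⟩ := exists_pow_lt_of_lt_one (y := (1 / 2 : ℝ)) (x := 1 / (16 * D.Cstar))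
      (by positivity) (by norm_num)
    refine ⟨i₀, ?_⟩
    rw [zpow_neg, zpow_natCast, ← inv_pow, ← one_div, mul_comm]
    rw [lt_div_iff₀ (by positivity)] at h
    linarith
  obtain ⟨c, hc, κ, hκ, h⟩ := exists_expanding_piece hE hA hs hi₀
  set c' := (min c 1).toReal with hc'
  have hc'top : min c 1 ≠ ⊤ := ne_top_of_le_ne_top ENNReal.one_ne_top (min_le_right _ _)
  have hc'0 : 0 < c' := ENNReal.toReal_pos (by simp [hc]) hc'top
  set M : ℝ≥0 := lipschitzExtensionConstant (ES n) * (κ⁻¹).toNNReal with hM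
  set τ : ℝ := D.a₀ * 2 ^ (-(i₀ : ℤ)) / (2 * (D.Cstar + 2)) with hτ
  have hτ0 : 0 < τ := by positivity
  refine ⟨c' * (C⁻¹ * τ ^ n), M + 1, by positivity, by positivity, fun x hx r hr _ => ?_⟩
  obtain ⟨k, hk, hk'⟩ := exists_zpow_scale (d := r / (D.Cstar + 2)) (by positivity)
  set j := k + 1 with hj
  have hj' : (2 : ℝ) ^ (-k) = 2 * 2 ^ (-j) := by
    rw [hj, zpow_neg_add]
    norm_num
    ring
  have hpos : (0 : ℝ) < 2 ^ (-j) := by positivity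
  rw [lt_div_iff₀ (by positivity)] at hk
  rw [div_le_iff₀ (by positivity), hj'] at hk'
  have hQ' := D.cubeAt_mem (j + i₀) hx
  obtain ⟨F, hFQ, hF, ψ, hψ, hψ'⟩ := h j _ hQ'
  have hFE : F ⊆ E := hFQ.trans (D.subset_of_mem hQ')
  have hlip : LipschitzOnWith (κ⁻¹).toNNReal (Function.invFunOn ψ F) (ψ '' F) := by
    refine LipschitzOnWith.of_dist_le_mul fun p hp q hq => ?_
    have h1 := hψ' _ (Function.invFunOn_mem hp) _ (Function.invFunOn_mem hq)
    rw [Function.invFunOn_eq hp, Function.invFunOn_eq hq] at h1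
    rw [Real.coe_toNNReal _ (by positivity), inv_mul_eq_div, le_div_iff₀ hκ]
    linarith
  obtain ⟨ρ, hρ, hρeq⟩ := hlip.extend_finite_dimension
  refine ⟨ρ, hρ.weaken ?_, ?_⟩
  · rw [← NNReal.coe_le_coe, Real.coe_toNNReal _ (by positivity)]
    exact le_add_of_nonneg_right zero_le_one
  have hinj : ∀ w ∈ F, ρ (ψ w) = w := by
    intro w hw
    have hp : ψ w ∈ ψ '' F := mem_image_of_mem ψ hw
    rw [← hρeq hp]
    have h1 := hψ' _ (Function.invFunOn_mem hp) _ hw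
    rw [Function.invFunOn_eq hp, dist_self] at h1
    refine dist_le_zero.1 (le_of_mul_le_mul_left (h1.trans ?_) hκ)
    simp
  have hsub : F ⊆ E ∩ ball x r ∩ ρ '' ball 0 r := fun w hw => by
    refine ⟨⟨hFE hw, ?_⟩, ψ w, ?_, hinj w hw⟩
    · have h1 := D.dist_le hQ' (hFQ hw) (D.mem_cubeAt _ hx)
      have h2 : D.Cstar * 2 ^ (-(j + i₀ : ℤ)) ≤ D.Cstar * 2 ^ (-j) :=
        mul_le_mul_of_nonneg_left (zpow_neg_le_of_le (by omega)) hCs.le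
      rw [mem_ball]
      nlinarith
    · rw [mem_ball_zero_iff]
      nlinarith [hψ w hw]
  calc ENNReal.ofReal (c' * (C⁻¹ * τ ^ n) * r ^ n)
      = min c 1 * ENNReal.ofReal (C⁻¹ * (τ * r) ^ n) := by
        rw [mul_assoc, ENNReal.ofReal_mul hc'0.le, hc', ENNReal.ofReal_toReal hc'top, mul_pow]
        ring_nf
    _ ≤ c * ENNReal.ofReal (C⁻¹ * (D.a₀ * 2 ^ (-(j + i₀ : ℤ))) ^ n) := by
        refine mul_le_mul' (min_le_left _ _) (ENNReal.ofReal_le_ofReal ?_)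
        refine mul_le_mul_of_nonneg_left (pow_le_pow_left₀ (by positivity) ?_ n) (by positivity)
        rw [zpow_neg_add, hτ, div_mul_eq_mul_div, div_le_iff₀ (by positivity)]
        have h3 : 0 < D.a₀ * 2 ^ (-(i₀ : ℤ)) := by positivity
        nlinarith [mul_le_mul_of_nonneg_left hk' h3.le]
    _ ≤ c * surfMeasure n E (D.cubeAt (j + i₀) x) := mul_le_mul_right (D.le_measure hE hQ') _
    _ ≤ surfMeasure n E F := hF
    _ = μH[(n : ℝ)] F := (D.hausdorff_eq hE.closed hQ' hFQ).symm
    _ ≤ _ := measure_mono hsub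

end FlatScales

/-- A bounded set carrying a dyadic system with small boundaries has at most one point. -/
theorem IsADR.subsingleton {n : ℕ} {C : ℝ} {E : Set (ES n)} (hE : IsADR n C E)
    (D : DyadicSystem n E) (hb : Bornology.IsBounded E) : E.Subsingleton := by
  rw [← Metric.ediam_eq_zero_iff]
  by_contra h0
  obtain ⟨r, hr, hr'⟩ : ∃ r : ℝ, 0 < r ∧ ENNReal.ofReal r < Metric.ediam E := by
    obtain ⟨a, ha, ha'⟩ := exists_between (pos_iff_ne_zero.2 h0)
    have hat : a ≠ ⊤ := (ha'.trans_le le_top).ne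
    exact ⟨a.toReal, ENNReal.toReal_pos ha.ne' hat, by rwa [ENNReal.ofReal_toReal hat]⟩
  obtain ⟨x, hx⟩ : E.Nonempty := by
    by_contra h
    rw [not_nonempty_iff_eq_empty] at h
    simp [h] at h0
  have hpos : 0 < μH[(n : ℝ)] E :=
    (ENNReal.ofReal_pos.2 (mul_pos (inv_pos.2 (one_pos.trans_le hE.2.1)) (pow_pos hr n))).trans_le
      ((hE.2.2 x hx r hr hr').1.trans (measure_mono inter_subset_left))
  have hfin : μH[(n : ℝ)] E ≠ ⊤ := by
    have hc : IsCompact E := isCompact_of_isClosed_isBounded hE.1 hb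
    obtain ⟨t, htE, ht⟩ := hc.elim_nhds_subcover (fun y => ball y r)
      fun y _ => ball_mem_nhds y hr
    have h1 : E ⊆ ⋃ y ∈ t, E ∩ ball y r := fun y hy => by
      obtain ⟨z, hz, hyz⟩ := mem_iUnion₂.1 (ht hy)
      exact mem_iUnion₂.2 ⟨z, hz, hy, hyz⟩
    refine ((measure_mono h1).trans_lt ((measure_biUnion_finset_le _ _).trans_lt ?_)).ne
    exact ENNReal.sum_lt_top.2 fun y hy =>
      (hE.2.2 y (htE y hy) r hr hr').2.trans_lt ENNReal.ofReal_lt_top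
  have ha := D.a₀_pos
  have hCs := D.Cstar_pos
  have hγ := D.γ_pos
  obtain ⟨k, hk⟩ : ∃ k : ℤ, Metric.diam E < D.a₀ * 2 ^ (-k) := by
    obtain ⟨m, hm⟩ := pow_unbounded_of_one_lt (Metric.diam E / D.a₀) (one_lt_two (α := ℝ))
    refine ⟨-m, ?_⟩
    rw [neg_neg, zpow_natCast]
    rwa [div_lt_iff₀' ha] at hm
  obtain ⟨Q, hQ, hxQ⟩ := D.exists_cube k hx
  have hQE : Q = E := (D.subset_of_mem hQ).antisymm fun y hy => D.contains_ball k Q hQ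
    ⟨hy, (dist_le_diam_of_mem hb hy (D.center_mem_E hQ)).trans_lt hk⟩
  set ϱ : ℝ := min (D.a₀ / 2) ((1 / (2 * D.Cstar)) ^ D.γ⁻¹) with hϱ
  have hϱ0 : 0 < ϱ := lt_min (by positivity) (by positivity)
  have hsb := D.small_boundary k Q hQ ϱ hϱ0 ((min_le_left _ _).trans_lt (by linarith))
  have hall : {y ∈ E | infDist y (E \ E) ≤ ϱ * 2 ^ (-k)} = E := by
    refine sep_eq_self_iff_mem_true.2 fun y _ => ?_
    rw [diff_self, infDist_empty]
    positivity
  rw [hQE, hall] at hsb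
  have hhalf : D.Cstar * ϱ ^ D.γ ≤ 1 / 2 := by
    have h1 : ϱ ^ D.γ ≤ 1 / (2 * D.Cstar) := by
      refine (Real.rpow_le_rpow hϱ0.le (min_le_right _ _) hγ.le).trans (le_of_eq ?_)
      rw [Real.rpow_inv_rpow (by positivity) hγ.ne']
    rw [le_div_iff₀ (by positivity)] at h1
    linarith
  have h2 : μH[(n : ℝ)] E ≤ ENNReal.ofReal (1 / 2) * μH[(n : ℝ)] E :=
    hsb.trans (mul_le_mul_left (ENNReal.ofReal_le_ofReal hhalf) _)
  refine absurd h2 (not_le.2 ?_)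
  calc _ < 1 * μH[(n : ℝ)] E := by
        refine ENNReal.mul_lt_mul_left hpos.ne' hfin ?_
        rw [← ENNReal.ofReal_one]
        exact (ENNReal.ofReal_lt_ofReal_iff one_pos).2 (by norm_num)
    _ = _ := one_mul _

/-- Proposition 2.20. An `n`-dimensional ADR set `E ⊆ ℝ^{n+1}`, `n ≥ 2`,
is uniformly rectifiable if and only if it satisfies the Weak Half-Space Approximation
property: for some `K₀ > 0` and `0 < ε₀ < K₀⁻⁶`, and every `0 < ε < ε₀`, the cubes failing
the `ε`-local WHSA condition with parameter `K₀` satisfy a Carleson packing condition. -/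
theorem UR_iff_WHSA (n : ℕ) (hn : 2 ≤ n) (C_ADR : ℝ) (E : Set (ES n))
    (hE : IsADR n C_ADR E) (D : DyadicSystem n E) :
    (∃ θ M₀ : ℝ, IsUR n θ M₀ E) ↔
      ∃ K₀ ε₀ : ℝ, 0 < K₀ ∧ 0 < ε₀ ∧ ε₀ < K₀ ^ (-6 : ℤ) ∧
        ∀ ε : ℝ, 0 < ε → ε < ε₀ →
          ∃ C : ℝ, PackedBy E D (fun k Q => ¬ LocalWHSA E D K₀ ε k Q) C := by
  have hn0 : 0 < n := by omega
  by_cases hb : Bornology.IsBounded E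
  · have hsub := hE.subsingleton D hb
    refine iff_of_true ⟨1, 1, one_pos, one_pos, fun x _ r _ hr' => ?_⟩
      ⟨1, 1 / 2, one_pos, by norm_num, by norm_num, fun ε _ _ => ⟨0, fun k₀ Q₀ _ => ?_⟩⟩
    · rw [EMetric.diam, Metric.ediam_eq_zero_iff.2 hsub] at hr'
      exact absurd hr' not_lt_zero
    · have := Measure.noAtoms_hausdorff (ES n) (d := (n : ℝ)) (by exact_mod_cast hn0)
      have h0 : ∀ p : {p : ℤ × Set (ES n) // p.2 ∈ D.cubes p.1 ∧
          ¬ LocalWHSA E D 1 ε p.1 p.2 ∧ p.2 ⊆ Q₀}, μH[(n : ℝ)] p.1.2 = 0 := fun p =>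
        (hsub.anti (D.subset_of_mem p.2.1)).measure_zero _
      simp [h0]
  have hR := hE.regular hn0 hb
  constructor
  · rintro ⟨θ, M₀, hUR⟩
    exact ⟨1, 1 / 2, one_pos, by norm_num, by norm_num, fun ε hε hε' =>
      packed_not_localWHSA hR D hUR hε (by linarith)⟩
  · rintro ⟨K₀, ε₀, -, hε₀, -, hW⟩
    obtain ⟨s, A, hA, hs⟩ := FlatScales.exists_bound hn0 hR D fun Λ η hΛ hη =>
      exists_carleson_not_twoPlane hR D hε₀ hW hΛ hη
    exact FlatScales.exists_isUR hR hA hs
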